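/- arXiv:1208.3801 — 2 statements merged into one kernel-verified Lean document; each statement's English description precedes it below -/
import Mathlib

section
/- Let G ∈ G(n,p) with d = p(n−1) ≫ log³ n and n − d ≫ log n. Let i ≥ 0 be the largest integer such that d^i = o(n) and let c = d^{i+1}/n. If c → ∞, then asymptotically almost surely β(G) ≤ (1 + o(1)) · (d^i/n + e^{−c})^{−1} · log n; in particular, a.a.s. β(G) ≤ (1 + o(1)) e^c log n if e^{−c} ≫ d^i/n, and β(G) ≤ (1 + o(1)) n log n / d^i if e^{−c} ≪ d^i/n. -/
open Filter Real Asymptotics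
open scoped Topology

/-- `R` is a resolving set of the graph `G`: every pair of distinct vertices is
distinguished by its distances to some vertex of `R`. -/
def Resolves {V : Type*} (G : SimpleGraph V) (R : Set V) : Prop :=
  ∀ ⦃v w : V⦄, v ≠ w → ∃ u ∈ R, G.dist u v ≠ G.dist u w

/-- The metric dimension of a graph `G`: the smallest cardinality of a resolving set. -/
noncomputable def metricDim {V : Type*} (G : SimpleGraph V) : ℕ :=
  sInf {k : ℕ | ∃ R : Set V, R.Finite ∧ R.ncard = k ∧ Resolves G R}

/-- The `G(n,p)` probability weight of a single graph on `Fin n`. -/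
noncomputable def gnpWeight (n : ℕ) (p : ℝ) (G : SimpleGraph (Fin n)) : ℝ :=
  p ^ Nat.card G.edgeSet * (1 - p) ^ (n.choose 2 - Nat.card G.edgeSet)

/-- The probability of an event `A` under the binomial random graph `G(n,p)`. -/
noncomputable def gnpProb (n : ℕ) (p : ℝ) (A : Set (SimpleGraph (Fin n))) : ℝ :=
  ∑' G : SimpleGraph (Fin n), A.indicator (gnpWeight n p) G

/-- `S(v,i)`: the set of vertices at graph distance exactly `i` from `v`. -/
def gSphere {V : Type*} (G : SimpleGraph V) (v : V) (i : ℕ) : Set V :=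
  {u | G.Reachable v u ∧ G.dist v u = i}

/-- `N(v,i)`: the set of vertices at graph distance at most `i` from `v`. -/
def gBall {V : Type*} (G : SimpleGraph V) (v : V) (i : ℕ) : Set V :=
  {u | G.Reachable v u ∧ G.dist v u ≤ i}

/-- `S(V',i)`: union of the spheres around the vertices of `V'`. -/
def gSphereSet {V : Type*} (G : SimpleGraph V) (W : Set V) (i : ℕ) : Set V :=
  ⋃ v ∈ W, gSphere G v i

/-- `N(V',i)`: union of the balls around the vertices of `V'`. -/
def gBallSet {V : Type*} (G : SimpleGraph V) (W : Set V) (i : ℕ) : Set V :=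
  ⋃ v ∈ W, gBall G v i

section ProductSpace

open MeasureTheory ProbabilityTheory

lemma dependsOn_finset_prod {ι κ : Type*} {g : κ → (ι → Bool) → ℝ} {S : κ → Set ι}
    (s : Finset κ) (hg : ∀ x ∈ s, DependsOn (g x) (S x)) :
    DependsOn (fun ω => ∏ x ∈ s, g x ω) (⋃ x ∈ s, S x) := by
  intro ω ω' h
  refine Finset.prod_congr rfl fun x hx => hg x hx fun i hi => h i ?_
  exact Set.mem_biUnion hx hi

variable {ι κ : Type*} [Fintype ι] {ν : Measure Bool} [IsProbabilityMeasure ν]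

/-- On a finite product of copies of `Bool`, functions depending on disjoint sets of coordinates
are uncorrelated. -/
lemma integral_mul_of_dependsOn {f g : (ι → Bool) → ℝ} {S T : Set ι} (hf : DependsOn f S)
    (hg : DependsOn g T) (hST : Disjoint S T) :
    ∫ ω, f ω * g ω ∂(Measure.pi fun _ : ι => ν) =
      (∫ ω, f ω ∂(Measure.pi fun _ : ι => ν)) * ∫ ω, g ω ∂(Measure.pi fun _ : ι => ν) := by
  classical
  obtain ⟨φ, rfl⟩ := dependsOn_iff_exists_comp.1 (show DependsOn f (S.toFinset : Set ι) by simpa)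
  obtain ⟨ψ, rfl⟩ := dependsOn_iff_exists_comp.1 (show DependsOn g (T.toFinset : Set ι) by simpa)
  have hind := (iIndepFun_pi (μ := fun _ : ι => ν) (X := fun _ b => b)
    fun _ => aemeasurable_id).indepFun_finset S.toFinset T.toFinset
      (by simpa using hST) (fun i => measurable_pi_apply i)
  exact hind.integral_comp_mul_comp (f := φ) (g := ψ) Measurable.of_discrete.aemeasurable
    Measurable.of_discrete.aemeasurable
    (Measurable.of_discrete.aestronglyMeasurable) (Measurable.of_discrete.aestronglyMeasurable)

lemma integral_prod_of_dependsOn {g : κ → (ι → Bool) → ℝ} {S : κ → Set ι} (s : Finset κ)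
    (hg : ∀ x ∈ s, DependsOn (g x) (S x)) (hS : (s : Set κ).PairwiseDisjoint S) :
    ∫ ω, ∏ x ∈ s, g x ω ∂(Measure.pi fun _ : ι => ν) =
      ∏ x ∈ s, ∫ ω, g x ω ∂(Measure.pi fun _ : ι => ν) := by
  classical
  induction s using Finset.induction_on with
  | empty => simp
  | insert a s ha ih =>
    simp only [Finset.prod_insert ha]
    rw [← ih (fun x hx => hg x (Finset.mem_insert_of_mem hx))
      (hS.subset (by simp))]
    refine integral_mul_of_dependsOn (hg a (Finset.mem_insert_self a s))
      (dependsOn_finset_prod s fun x hx => hg x (Finset.mem_insert_of_mem hx)) ?_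
    simp only [Set.disjoint_iUnion_right]
    intro x hx
    exact hS (by simp) (by simp [hx]) (fun h => ha (h ▸ hx))

open Classical in
/-- The exponential moment of the number of independent events that occur. -/
lemma integral_exp_card_filter {E : κ → Set (ι → Bool)} {S : κ → Set ι} (s : Finset κ)
    (hE : ∀ x ∈ s, DependsOn (fun ω => ω ∈ E x) (S x)) (hS : (s : Set κ).PairwiseDisjoint S)
    (t : ℝ) :
    ∫ ω, exp (t * ({x ∈ s | ω ∈ E x}.card : ℝ)) ∂(Measure.pi fun _ : ι => ν) =
      ∏ x ∈ s, (1 + (exp t - 1) * (Measure.pi fun _ : ι => ν).real (E x)) := by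
  have h1 : ∀ ω : ι → Bool, exp (t * ({x ∈ s | ω ∈ E x}.card : ℝ)) =
      ∏ x ∈ s, (1 + (exp t - 1) * (E x).indicator 1 ω) := by
    intro ω
    rw [Finset.card_filter, Nat.cast_sum, Finset.mul_sum, Real.exp_sum]
    refine Finset.prod_congr rfl fun x _ => ?_
    by_cases hx : ω ∈ E x <;> simp [hx]
  simp_rw [h1]
  rw [integral_prod_of_dependsOn s (S := S) _ hS]
  · refine Finset.prod_congr rfl fun x _ => ?_
    rw [integral_add .of_finite .of_finite, integral_const_mul,
      integral_indicator_one (Set.toFinite _).measurableSet]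
    simp
  · intro x hx ω ω' h
    have := hE x hx h
    simp only [eq_iff_iff] at this
    simp [Set.indicator, this]

open Classical in
/-- Chernoff bound for the lower tail of the number of independent events that occur. -/
lemma measureReal_card_filter_lt_le {E : κ → Set (ι → Bool)} {S : κ → Set ι} (s : Finset κ)
    (hE : ∀ x ∈ s, DependsOn (fun ω => ω ∈ E x) (S x)) (hS : (s : Set κ).PairwiseDisjoint S)
    {q ε : ℝ} (hq : ∀ x ∈ s, q ≤ (Measure.pi fun _ : ι => ν).real (E x))
    (hq0 : 0 ≤ q) (hε0 : 0 ≤ ε) (hε1 : ε ≤ 1) :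
    (Measure.pi fun _ : ι => ν).real
      {ω | ({x ∈ s | ω ∈ E x}.card : ℝ) < (1 - ε) * (s.card * q)} ≤
      exp (-(ε ^ 2 * (s.card * q) / 2)) := by
  set μ := Measure.pi fun _ : ι => ν
  set m := (s.card : ℝ) * q with hm
  have hm0 : 0 ≤ m := by positivity
  have hexp : exp (-ε) - 1 ≤ -ε + ε ^ 2 / 2 := by
    have := Real.quadratic_le_exp_of_nonneg hε0
    have h2 : exp (-ε) * exp ε = 1 := by rw [← Real.exp_add]; simp
    have h3 : 0 ≤ 1 - ε + ε ^ 2 / 2 := by nlinarith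
    nlinarith [mul_le_mul_of_nonneg_left this h3, pow_nonneg hε0 4, Real.exp_pos (-ε), pow_nonneg hε0 3]
  have hneg : exp (-ε) - 1 ≤ 0 := by nlinarith
  have hbound : ∫ ω, exp (-ε * ({x ∈ s | ω ∈ E x}.card : ℝ)) ∂μ ≤ exp ((exp (-ε) - 1) * m) := by
    rw [integral_exp_card_filter s hE hS]
    have : exp ((exp (-ε) - 1) * m) = ∏ x ∈ s, exp ((exp (-ε) - 1) * q) := by
      rw [Finset.prod_const, ← Real.exp_nat_mul, hm]; ring_nf
    rw [this]
    refine Finset.prod_le_prod (fun x hx => ?_) fun x hx => ?_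
    · have h1 : μ.real (E x) ≤ 1 := measureReal_le_one
      have h2 : 0 ≤ μ.real (E x) := measureReal_nonneg
      nlinarith [Real.exp_pos (-ε)]
    · have := Real.add_one_le_exp ((exp (-ε) - 1) * q)
      nlinarith [hq x hx]
  have hmarkov := mul_meas_ge_le_integral_of_nonneg (μ := μ)
    (f := fun ω => exp (-ε * ({x ∈ s | ω ∈ E x}.card : ℝ)))
    (Filter.Eventually.of_forall fun ω => (Real.exp_pos _).le) .of_finite
    (exp (-ε * ((1 - ε) * m)))
  have hsub : μ.real {ω | ({x ∈ s | ω ∈ E x}.card : ℝ) < (1 - ε) * m} ≤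
      μ.real {ω | exp (-ε * ((1 - ε) * m)) ≤ exp (-ε * ({x ∈ s | ω ∈ E x}.card : ℝ))} := by
    refine measureReal_mono fun ω hω => ?_
    simp only [Set.mem_ofPred_eq, Real.exp_le_exp] at hω ⊢
    nlinarith
  have h4 : exp (-ε * ((1 - ε) * m)) *
      μ.real {ω | ({x ∈ s | ω ∈ E x}.card : ℝ) < (1 - ε) * m} ≤ exp ((exp (-ε) - 1) * m) :=
    (mul_le_mul_of_nonneg_left hsub (Real.exp_pos _).le).trans (hmarkov.trans hbound)
  rw [← le_div_iff₀' (Real.exp_pos _), ← Real.exp_sub] at h4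
  refine h4.trans (Real.exp_le_exp.2 ?_)
  nlinarith

open Classical in
/-- Chernoff bound for the upper tail of the number of independent events that occur. -/
lemma measureReal_lt_card_filter_le {E : κ → Set (ι → Bool)} {S : κ → Set ι} (s : Finset κ)
    (hE : ∀ x ∈ s, DependsOn (fun ω => ω ∈ E x) (S x)) (hS : (s : Set κ).PairwiseDisjoint S)
    {q ε : ℝ} (hq : ∀ x ∈ s, (Measure.pi fun _ : ι => ν).real (E x) ≤ q)
    (hq0 : 0 ≤ q) (hε0 : 0 ≤ ε) (hε1 : ε ≤ 1) :
    (Measure.pi fun _ : ι => ν).real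
      {ω | (1 + ε) * (s.card * q) < ({x ∈ s | ω ∈ E x}.card : ℝ)} ≤
      exp (-(ε ^ 2 * (s.card * q) / 4)) := by
  set μ := Measure.pi fun _ : ι => ν
  set m := (s.card : ℝ) * q with hm
  have hm0 : 0 ≤ m := by positivity
  have hexp : exp (ε / 2) - 1 ≤ ε / 2 + (ε / 2) ^ 2 := by
    have := Real.abs_exp_sub_one_sub_id_le (x := ε / 2) (by rw [abs_of_nonneg] <;> linarith)
    linarith [(abs_le.1 this).2]
  have hpos : 0 ≤ exp (ε / 2) - 1 := by linarith [Real.add_one_le_exp (ε / 2)]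
  have hbound : ∫ ω, exp (ε / 2 * ({x ∈ s | ω ∈ E x}.card : ℝ)) ∂μ ≤
      exp ((exp (ε / 2) - 1) * m) := by
    rw [integral_exp_card_filter s hE hS]
    have : exp ((exp (ε / 2) - 1) * m) = ∏ x ∈ s, exp ((exp (ε / 2) - 1) * q) := by
      rw [Finset.prod_const, ← Real.exp_nat_mul, hm]; ring_nf
    rw [this]
    refine Finset.prod_le_prod (fun x hx => ?_) fun x hx => ?_
    · have h2 : 0 ≤ μ.real (E x) := measureReal_nonneg
      positivity
    · have := Real.add_one_le_exp ((exp (ε / 2) - 1) * q)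
      nlinarith [hq x hx]
  have hmarkov := mul_meas_ge_le_integral_of_nonneg (μ := μ)
    (f := fun ω => exp (ε / 2 * ({x ∈ s | ω ∈ E x}.card : ℝ)))
    (Filter.Eventually.of_forall fun ω => (Real.exp_pos _).le) .of_finite
    (exp (ε / 2 * ((1 + ε) * m)))
  have hsub : μ.real {ω | (1 + ε) * m < ({x ∈ s | ω ∈ E x}.card : ℝ)} ≤
      μ.real {ω | exp (ε / 2 * ((1 + ε) * m)) ≤ exp (ε / 2 * ({x ∈ s | ω ∈ E x}.card : ℝ))} := by
    refine measureReal_mono fun ω hω => ?_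
    simp only [Set.mem_ofPred_eq, Real.exp_le_exp] at hω ⊢
    nlinarith
  have h4 : exp (ε / 2 * ((1 + ε) * m)) *
      μ.real {ω | (1 + ε) * m < ({x ∈ s | ω ∈ E x}.card : ℝ)} ≤ exp ((exp (ε / 2) - 1) * m) :=
    (mul_le_mul_of_nonneg_left hsub (Real.exp_pos _).le).trans (hmarkov.trans hbound)
  rw [← le_div_iff₀' (Real.exp_pos _), ← Real.exp_sub] at h4
  refine h4.trans (Real.exp_le_exp.2 ?_)
  nlinarith

/-- Deferred decisions: if the event `X = a` does not look at the coordinates in `F a`, then a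
uniform bound on the probability of the events `B a`, each looking only at coordinates in `F a`,
bounds the probability of `B X`. -/
lemma measureReal_deferred_le {α : Type*} [Fintype α] (X : (ι → Bool) → α) (F : α → Set ι)
    (hX : ∀ ω ω', (∀ e ∉ F (X ω), ω e = ω' e) → X ω' = X ω) (B : α → Set (ι → Bool))
    (hB : ∀ a, DependsOn (fun ω => ω ∈ B a) (F a)) {b : ℝ}
    (hb : ∀ a, (Measure.pi fun _ : ι => ν).real (B a) ≤ b) :
    (Measure.pi fun _ : ι => ν).real {ω | ω ∈ B (X ω)} ≤ b := by
  classical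
  set μ := Measure.pi fun _ : ι => ν
  have hcov : {ω | ω ∈ B (X ω)} = ⋃ a ∈ (Finset.univ : Finset α), (X ⁻¹' {a} ∩ B a) := by
    ext ω; simp
  have hmul : ∀ a, μ.real (X ⁻¹' {a} ∩ B a) = μ.real (X ⁻¹' {a}) * μ.real (B a) := by
    intro a
    have := integral_mul_of_dependsOn (ν := ν) (f := (X ⁻¹' {a}).indicator 1)
      (g := (B a).indicator 1) (S := (F a)ᶜ) (T := F a) ?_ ?_ disjoint_compl_left
    · rw [integral_indicator_one (Set.toFinite _).measurableSet,
        integral_indicator_one (Set.toFinite _).measurableSet] at this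
      rw [← this, ← integral_indicator_one (Set.toFinite _).measurableSet]
      simp_rw [Set.inter_indicator_one]
      rfl
    · intro ω ω' h
      have : X ω = a ↔ X ω' = a := by
        constructor
        · rintro rfl
          exact hX ω ω' fun e he => h e he
        · rintro rfl
          exact hX ω' ω fun e he => (h e he).symm
      simp [Set.indicator, this]
    · intro ω ω' h
      have := hB a h
      simp only [eq_iff_iff] at this
      simp [Set.indicator, this]
  calc μ.real {ω | ω ∈ B (X ω)} ≤ ∑ a, μ.real (X ⁻¹' {a} ∩ B a) := by
        rw [hcov]; exact measureReal_biUnion_finset_le _ _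
    _ ≤ ∑ a, μ.real (X ⁻¹' {a}) * b := by
        refine Finset.sum_le_sum fun a _ => ?_
        rw [hmul]
        exact mul_le_mul_of_nonneg_left (hb a) measureReal_nonneg
    _ = b := by
        rw [← Finset.sum_mul, sum_measureReal_preimage_singleton _
          fun _ _ => (Set.toFinite _).measurableSet]
        simp [μ]

end ProductSpace

section EdgeMeasure

open MeasureTheory ProbabilityTheory

/-- The law of a family of independent coin tosses of bias `p`, one for each unordered pair. -/
noncomputable def coinMeasure (n : ℕ) (p : unitInterval) : Measure (Sym2 (Fin n) → Bool) :=
  Measure.pi fun _ => bernoulliMeasure true false p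

instance (n : ℕ) (p : unitInterval) : IsProbabilityMeasure (coinMeasure n p) := by
  unfold coinMeasure; infer_instance

/-- The graph whose edges are the pairs whose coin shows `true`. -/
def coinGraph {n : ℕ} (ω : Sym2 (Fin n) → Bool) : SimpleGraph (Fin n) :=
  SimpleGraph.fromEdgeSet {e | ω e = true}

lemma coinGraph_adj {n : ℕ} (ω : Sym2 (Fin n) → Bool) (x y : Fin n) :
    (coinGraph ω).Adj x y ↔ ω s(x, y) = true ∧ x ≠ y := by
  simp [coinGraph]

lemma measureReal_coinGraph_eq {n : ℕ} (p : unitInterval) (G : SimpleGraph (Fin n)) :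
    (coinMeasure n p).real {ω | coinGraph ω = G} = gnpWeight n p G := by
  classical
  have hset : {ω : Sym2 (Fin n) → Bool | coinGraph ω = G} =
      Set.univ.pi fun e => if e.IsDiag then Set.univ else {decide (e ∈ G.edgeSet)} := by
    ext ω
    simp only [Set.mem_ofPred_eq, Set.mem_univ_pi]
    constructor
    · rintro rfl e
      by_cases he : e.IsDiag
      · simp [he]
      · simp only [he, if_false, coinGraph, SimpleGraph.edgeSet_fromEdgeSet]
        simp [he]
    · intro h
      ext x y
      rw [coinGraph_adj]
      have := h s(x, y)
      by_cases hxy : x = y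
      · subst hxy; simp
      · simp [hxy] at this
        simp [this, hxy]
  have hcard : (Finset.univ.filter fun e : Sym2 (Fin n) => ¬ e.IsDiag).card = n.choose 2 := by
    have := Sym2.card_subtype_not_diag (α := Fin n)
    rwa [Fintype.card_subtype, Fintype.card_fin] at this
  have hedge : (Finset.univ.filter fun e : Sym2 (Fin n) => ¬ e.IsDiag).filter
      (fun e => e ∈ G.edgeSet) = G.edgeFinset := by
    ext e
    simp only [Finset.mem_filter, Finset.mem_univ, true_and, SimpleGraph.mem_edgeFinset,
      and_iff_right_iff_imp]
    exact fun h => G.not_isDiag_of_mem_edgeSet h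
  rw [hset, Measure.real, coinMeasure, Measure.pi_pi, ENNReal.toReal_prod, gnpWeight]
  have hterm : ∀ e : Sym2 (Fin n), ((bernoulliMeasure true false p)
      (if e.IsDiag then Set.univ else {decide (e ∈ G.edgeSet)})).toReal =
      if ¬ e.IsDiag then (if e ∈ G.edgeSet then (p : ℝ) else 1 - p) else 1 := by
    intro e
    by_cases he : e.IsDiag
    · simp [he]
    · by_cases h2 : e ∈ G.edgeSet
      · simp [he, h2]
      · simp [he, h2]
  simp_rw [hterm]
  rw [← Finset.prod_filter, Finset.prod_ite, Finset.prod_const, Finset.prod_const, hedge,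
    Nat.card_eq_fintype_card, ← SimpleGraph.edgeFinset_card]
  congr 2
  have := Finset.card_filter_add_card_filter_not
    (s := Finset.univ.filter fun e : Sym2 (Fin n) => ¬ e.IsDiag) (fun e => e ∈ G.edgeSet)
  rw [hedge, hcard] at this
  omega

lemma gnpProb_eq_measureReal {n : ℕ} (p : unitInterval) (A : Set (SimpleGraph (Fin n))) :
    gnpProb n p A = (coinMeasure n p).real {ω | coinGraph ω ∈ A} := by
  classical
  have hA : {ω : Sym2 (Fin n) → Bool | coinGraph ω ∈ A} =
      coinGraph ⁻¹' ((Finset.univ.filter (· ∈ A) : Finset (SimpleGraph (Fin n))) : Set _) := by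
    ext; simp
  rw [gnpProb, tsum_fintype, hA, ← sum_measureReal_preimage_singleton _
    fun _ _ => (Set.toFinite _).measurableSet, Finset.sum_filter]
  refine Finset.sum_congr rfl fun G _ => ?_
  rw [Set.indicator_apply, ← measureReal_coinGraph_eq]
  rfl

/-- The probability that no vertex of `B` is joined to `x`. -/
lemma measureReal_forall_eq_false {n : ℕ} (p : unitInterval) (x : Fin n) (B : Finset (Fin n)) :
    (coinMeasure n p).real {ω | ∀ y ∈ B, ω s(x, y) = false} = (1 - (p : ℝ)) ^ B.card := by
  classical
  have hset : {ω : Sym2 (Fin n) → Bool | ∀ y ∈ B, ω s(x, y) = false} =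
      Set.univ.pi fun e => if e ∈ B.image (fun y => s(x, y)) then {false} else Set.univ := by
    ext ω
    simp only [Set.mem_ofPred_eq, Set.mem_univ_pi]
    constructor
    · intro h e
      split_ifs with he
      · obtain ⟨y, hy, rfl⟩ := Finset.mem_image.1 he
        exact h y hy
      · trivial
    · intro h y hy
      have := h s(x, y)
      rwa [if_pos (Finset.mem_image_of_mem _ hy)] at this
  rw [hset, Measure.real, coinMeasure, Measure.pi_pi, ENNReal.toReal_prod]
  have hterm : ∀ e : Sym2 (Fin n), ((bernoulliMeasure true false p)
      (if e ∈ B.image (fun y => s(x, y)) then {false} else Set.univ)).toReal =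
      if e ∈ B.image (fun y => s(x, y)) then 1 - (p : ℝ) else 1 := by
    intro e
    split_ifs
    · simp
    · simp
  simp_rw [hterm]
  rw [Finset.prod_ite_mem, Finset.univ_inter, Finset.prod_const, Finset.card_image_of_injective]
  intro y z h
  rcases Sym2.congr_right.1 h with rfl
  rfl

end EdgeMeasure

section Exploration

open scoped Classical

variable {V : Type*} [Fintype V] [DecidableEq V]

/-- The vertices joined to `v` by a walk of length less than `k`. -/
noncomputable def nearBall (G : SimpleGraph V) (v : V) : ℕ → Finset V
  | 0 => ∅
  | k + 1 => {x | x = v ∨ x ∈ nearBall G v k ∨ ∃ y ∈ nearBall G v k, G.Adj y x}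

lemma mem_nearBall_succ {G : SimpleGraph V} {v x : V} {k : ℕ} :
    x ∈ nearBall G v (k + 1) ↔
      x = v ∨ x ∈ nearBall G v k ∨ ∃ y ∈ nearBall G v k, G.Adj y x := by
  simp [nearBall]

lemma nearBall_subset_succ (G : SimpleGraph V) (v : V) (k : ℕ) :
    nearBall G v k ⊆ nearBall G v (k + 1) :=
  fun _ hx => mem_nearBall_succ.2 (.inr (.inl hx))

lemma mem_nearBall_iff {G : SimpleGraph V} {v x : V} {k : ℕ} :
    x ∈ nearBall G v k ↔ G.Reachable v x ∧ G.dist v x < k := by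
  constructor
  · intro h
    suffices ∃ W : G.Walk v x, W.length < k by
      obtain ⟨W, hW⟩ := this
      exact ⟨W.reachable, (SimpleGraph.dist_le W).trans_lt hW⟩
    induction k generalizing x with
    | zero => simp [nearBall] at h
    | succ k ih =>
      rcases mem_nearBall_succ.1 h with rfl | h | ⟨y, hy, hyx⟩
      · exact ⟨.nil, by simp⟩
      · obtain ⟨W, hW⟩ := ih h
        exact ⟨W, by omega⟩
      · obtain ⟨W, hW⟩ := ih hy
        exact ⟨W.concat hyx, by simpa using hW⟩
  · rintro ⟨hr, hd⟩
    obtain ⟨W, hW⟩ := hr.exists_walk_length_eq_dist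
    rw [← hW] at hd
    clear hW hr
    suffices ∀ (m : ℕ) (x : V) (W : G.Walk v x), W.length = m → ∀ k, m < k →
        x ∈ nearBall G v k from this _ x W rfl k hd
    clear hd W
    intro m
    induction m with
    | zero =>
      intro x W hW k hk
      obtain ⟨k, rfl⟩ := Nat.exists_eq_succ_of_ne_zero hk.ne'
      exact mem_nearBall_succ.2 (.inl (SimpleGraph.Walk.eq_of_length_eq_zero hW).symm)
    | succ m ih =>
      intro x W hW k hk
      obtain ⟨k, rfl⟩ := Nat.exists_eq_succ_of_ne_zero (Nat.ne_zero_of_lt hk)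
      have hnil : ¬ W.Nil := by
        intro h
        have := SimpleGraph.Walk.length_eq_zero_iff.2 h
        omega
      refine mem_nearBall_succ.2 (.inr (.inr ⟨W.penultimate, ?_, W.adj_penultimate hnil⟩))
      exact ih _ W.dropLast (by simp [hW]) k (by omega)

lemma nearBall_congr {G G' : SimpleGraph V} {v : V} {k : ℕ}
    (h : ∀ y ∈ nearBall G v k, ∀ x, G.Adj y x ↔ G'.Adj y x) :
    nearBall G' v k = nearBall G v k ∧ nearBall G' v (k + 1) = nearBall G v (k + 1) := by
  have key : ∀ j, nearBall G' v j = nearBall G v j →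
      (∀ y ∈ nearBall G v j, ∀ x, G.Adj y x ↔ G'.Adj y x) →
      nearBall G' v (j + 1) = nearBall G v (j + 1) := by
    intro j hj hadj
    ext x
    rw [mem_nearBall_succ, mem_nearBall_succ, hj]
    refine or_congr_right (or_congr_right (exists_congr fun y => and_congr_right fun hy => ?_))
    exact (hadj y hy x).symm
  suffices nearBall G' v k = nearBall G v k from ⟨this, key k this h⟩
  induction k with
  | zero => rfl
  | succ k ih =>
    have h' : ∀ y ∈ nearBall G v k, ∀ x, G.Adj y x ↔ G'.Adj y x :=
      fun y hy => h y (nearBall_subset_succ G v k hy)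
    exact key k (ih h') h'

lemma card_nearBall_succ_sdiff_le {G : SimpleGraph V} {Δ : ℝ}
    (hΔ : ∀ y, (({x | G.Adj y x} : Finset V).card : ℝ) ≤ Δ) (v : V) (k : ℕ) :
    ((nearBall G v (k + 1) \ nearBall G v k).card : ℝ) ≤ Δ ^ k := by
  have hΔ0 : 0 ≤ Δ := (Nat.cast_nonneg _).trans (hΔ v)
  induction k with
  | zero =>
    have : nearBall G v (0 + 1) \ nearBall G v 0 = {v} := by
      ext x; simp [nearBall]
    simp [this]
  | succ k ih =>
    have hsub : nearBall G v (k + 1 + 1) \ nearBall G v (k + 1) ⊆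
        (nearBall G v (k + 1) \ nearBall G v k).biUnion fun y => ({x | G.Adj y x} : Finset V) := by
      intro x hx
      rw [Finset.mem_sdiff] at hx
      obtain ⟨hx1, hx2⟩ := hx
      rcases mem_nearBall_succ.1 hx1 with rfl | h | ⟨y, hy, hyx⟩
      · exact absurd (mem_nearBall_succ.2 (.inl rfl)) hx2
      · exact absurd h hx2
      · refine Finset.mem_biUnion.2 ⟨y, Finset.mem_sdiff.2 ⟨hy, fun hy' => hx2 ?_⟩, by simpa⟩
        exact mem_nearBall_succ.2 (.inr (.inr ⟨y, hy', hyx⟩))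
    calc _ ≤ (((nearBall G v (k + 1) \ nearBall G v k).biUnion
              fun y => ({x | G.Adj y x} : Finset V)).card : ℝ) :=
          Nat.cast_le.2 (Finset.card_le_card hsub)
      _ ≤ ∑ y ∈ nearBall G v (k + 1) \ nearBall G v k, (({x | G.Adj y x} : Finset V).card : ℝ) := by
          exact_mod_cast Finset.card_biUnion_le
      _ ≤ ∑ _y ∈ nearBall G v (k + 1) \ nearBall G v k, Δ := Finset.sum_le_sum fun y _ => hΔ y
      _ ≤ Δ ^ (k + 1) := by
          rw [Finset.sum_const, nsmul_eq_mul, pow_succ]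
          gcongr

lemma card_nearBall_le {G : SimpleGraph V} {Δ : ℝ} (hΔ1 : 1 ≤ Δ)
    (hΔ : ∀ y, (({x | G.Adj y x} : Finset V).card : ℝ) ≤ Δ) (v : V) {i k : ℕ} (hk : k ≤ i + 1) :
    ((nearBall G v k).card : ℝ) ≤ k * Δ ^ i := by
  induction k with
  | zero => simp [nearBall]
  | succ k ih =>
    have h1 := card_nearBall_succ_sdiff_le hΔ v k
    have h2 : Δ ^ k ≤ Δ ^ i := pow_le_pow_right₀ hΔ1 (by omega)
    have h3 := Finset.card_sdiff_add_card_eq_card (nearBall_subset_succ G v k)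
    have h4 : ((nearBall G v (k + 1)).card : ℝ) =
        (nearBall G v (k + 1) \ nearBall G v k).card + (nearBall G v k).card := by
      exact_mod_cast h3.symm
    push_cast
    linarith [ih (by omega)]

/-- The vertices joined to one of `v`, `w` by a walk of length less than `k`. -/
noncomputable def nearPair (G : SimpleGraph V) (v w : V) (k : ℕ) : Finset V :=
  nearBall G v k ∪ nearBall G w k

lemma nearPair_subset_succ (G : SimpleGraph V) (v w : V) (k : ℕ) :
    nearPair G v w k ⊆ nearPair G v w (k + 1) :=
  Finset.union_subset_union (nearBall_subset_succ G v k) (nearBall_subset_succ G w k)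

lemma nearPair_comm (G : SimpleGraph V) (v w : V) (k : ℕ) :
    nearPair G v w k = nearPair G w v k := Finset.union_comm _ _

/-- A vertex outside `nearPair` enters the next ball around `v` exactly through a neighbour in the
current layer of `v`. -/
lemma mem_nearBall_succ_iff_of_notMem {G : SimpleGraph V} {v w x : V} {k : ℕ}
    (hx : x ∉ nearPair G v w (k + 1)) :
    x ∈ nearBall G v (k + 2) ↔
      ∃ y ∈ nearBall G v (k + 1) \ nearPair G v w k, G.Adj x y := by
  have hxv : x ∉ nearBall G v (k + 1) := fun h => hx (Finset.mem_union_left _ h)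
  constructor
  · intro h
    rcases mem_nearBall_succ.1 h with rfl | h | ⟨y, hy, hyx⟩
    · exact absurd (mem_nearBall_succ.2 (.inl rfl)) hxv
    · exact absurd h hxv
    · refine ⟨y, Finset.mem_sdiff.2 ⟨hy, fun hy' => hx ?_⟩, hyx.symm⟩
      rcases Finset.mem_union.1 hy' with hy' | hy'
      · exact Finset.mem_union_left _ (mem_nearBall_succ.2 (.inr (.inr ⟨y, hy', hyx⟩)))
      · exact Finset.mem_union_right _ (mem_nearBall_succ.2 (.inr (.inr ⟨y, hy', hyx⟩)))
  · rintro ⟨y, hy, hyx⟩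
    exact mem_nearBall_succ.2 (.inr (.inr ⟨y, (Finset.mem_sdiff.1 hy).1, hyx.symm⟩))

lemma nearPair_succ_sdiff {G : SimpleGraph V} {v w : V} {k : ℕ} :
    nearPair G v w (k + 2) \ nearPair G v w (k + 1) =
      {x ∈ (nearPair G v w (k + 1))ᶜ |
        ∃ y ∈ nearPair G v w (k + 1) \ nearPair G v w k, G.Adj x y} := by
  ext x
  rw [Finset.mem_sdiff, Finset.mem_filter, Finset.mem_compl, and_comm]
  refine and_congr_right fun hx => ?_
  have h1 := mem_nearBall_succ_iff_of_notMem hx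
  have h2 := mem_nearBall_succ_iff_of_notMem (v := w) (w := v) (by rwa [nearPair_comm])
  rw [nearPair_comm] at h2
  have h3 : nearPair G v w (k + 1) \ nearPair G v w k = _ := Finset.union_sdiff_distrib _ _ _
  rw [show x ∈ nearPair G v w (k + 2) ↔ _ from Finset.mem_union, h1, h2, h3]
  simp only [Finset.mem_union]
  constructor
  · rintro (⟨y, hy, h⟩ | ⟨y, hy, h⟩)
    exacts [⟨y, .inl hy, h⟩, ⟨y, .inr hy, h⟩]
  · rintro ⟨y, hy | hy, h⟩
    exacts [.inl ⟨y, hy, h⟩, .inr ⟨y, hy, h⟩]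

lemma dist_ne_of_mem_nearBall {G : SimpleGraph V} {v w u : V} {k : ℕ}
    (hv : u ∈ nearBall G v k) (hw : u ∉ nearBall G w k) (huv : u ≠ v) :
    G.dist u v ≠ G.dist u w := by
  obtain ⟨hr, hd⟩ := mem_nearBall_iff.1 hv
  rw [mem_nearBall_iff, not_and] at hw
  rw [G.dist_comm (u := u), G.dist_comm (u := u)]
  intro h
  by_cases hwr : G.Reachable w u
  · exact hw hwr (h ▸ hd)
  · rw [SimpleGraph.dist_eq_zero_of_not_reachable hwr] at h
    exact huv (hr.dist_eq_zero_iff.1 h).symm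

/-- Counting vertices that resolve `v` and `w`: those first reached in round `i` from exactly one
of the two, and those not reached by then but reached from exactly one of the two in the following
round. -/
lemma le_card_filter_dist_ne {G : SimpleGraph V} {v w : V} {i : ℕ} (hi : 1 ≤ i)
    {A B L : Finset V} (hA : A = nearBall G v (i + 1) \ nearPair G v w i)
    (hB : B = nearBall G w (i + 1) \ nearPair G v w i)
    (hL : L = nearPair G v w (i + 1) \ nearPair G v w i) :
    2 * L.card + ({x ∈ (nearPair G v w (i + 1))ᶜ |
        Xor (∃ y ∈ A, G.Adj x y) (∃ y ∈ B, G.Adj x y)} : Finset V).card ≤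
      A.card + B.card + ({u | G.dist u v ≠ G.dist u w} : Finset V).card := by
  obtain ⟨j, rfl⟩ := Nat.exists_eq_succ_of_ne_zero (by omega : i ≠ 0)
  set X := ({x ∈ (nearPair G v w (j + 1 + 1))ᶜ |
        Xor (∃ y ∈ A, G.Adj x y) (∃ y ∈ B, G.Adj x y)} : Finset V) with hX
  have hv1 : ∀ k, v ∈ nearPair G v w (k + 1) := fun k =>
    Finset.mem_union_left _ (mem_nearBall_succ.2 (.inl rfl))
  have hw1 : ∀ k, w ∈ nearPair G v w (k + 1) := fun k =>
    Finset.mem_union_right _ (mem_nearBall_succ.2 (.inl rfl))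
  have hLAB : L = A ∪ B := by
    rw [hL, hA, hB, ← Finset.union_sdiff_distrib]; rfl
  have hsub : (A \ B ∪ B \ A) ∪ X ⊆ ({u | G.dist u v ≠ G.dist u w} : Finset V) := by
    intro u hu
    rw [Finset.mem_filter_univ]
    rcases Finset.mem_union.1 hu with hu | hu
    · rcases Finset.mem_union.1 hu with hu | hu
      · rw [Finset.mem_sdiff, hA, hB, Finset.mem_sdiff, Finset.mem_sdiff] at hu
        refine dist_ne_of_mem_nearBall (k := j + 1 + 1) hu.1.1 (fun h => hu.2 ⟨h, hu.1.2⟩) ?_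
        rintro rfl
        exact hu.1.2 (hv1 j)
      · rw [Finset.mem_sdiff, hA, hB, Finset.mem_sdiff, Finset.mem_sdiff] at hu
        refine (dist_ne_of_mem_nearBall (k := j + 1 + 1) hu.1.1
          (fun h => hu.2 ⟨h, hu.1.2⟩) ?_).symm
        rintro rfl
        exact hu.1.2 (hw1 j)
    · rw [hX, Finset.mem_filter, Finset.mem_compl] at hu
      obtain ⟨hu, hx⟩ := hu
      have h1 := mem_nearBall_succ_iff_of_notMem hu
      have h2 := mem_nearBall_succ_iff_of_notMem (v := w) (w := v) (by rwa [nearPair_comm])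
      rw [← hA] at h1
      rw [nearPair_comm, ← hB] at h2
      rw [← h1, ← h2] at hx
      have huv : u ≠ v := by rintro rfl; exact hu (hv1 _)
      have huw : u ≠ w := by rintro rfl; exact hu (hw1 _)
      rcases hx with hx | hx
      · exact dist_ne_of_mem_nearBall hx.1 hx.2 huv
      · exact (dist_ne_of_mem_nearBall hx.1 hx.2 huw).symm
  have hdisj : Disjoint (A \ B ∪ B \ A) X := by
    refine Finset.disjoint_left.2 fun u hu hux => ?_
    rw [hX, Finset.mem_filter, Finset.mem_compl] at hux
    have : u ∈ A ∪ B := by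
      rcases Finset.mem_union.1 hu with hu | hu
      · exact Finset.mem_union_left _ (Finset.mem_sdiff.1 hu).1
      · exact Finset.mem_union_right _ (Finset.mem_sdiff.1 hu).1
    rw [← hLAB, hL] at this
    exact hux.1 (Finset.mem_sdiff.1 this).1
  have hc := Finset.card_le_card hsub
  rw [Finset.card_union_of_disjoint hdisj, Finset.card_union_of_disjoint disjoint_sdiff_sdiff] at hc
  have h1 := Finset.card_sdiff_add_card A B
  have h2 := Finset.card_sdiff_add_card B A
  rw [Finset.union_comm B A] at h2
  rw [hLAB]
  omega

end Exploration

section ExplorationProbability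

open MeasureTheory ProbabilityTheory
open scoped Classical

variable {n : ℕ}

/-- The state of the exploration from `v` and `w` in round `k`: the vertices explored before, and
the balls around `v` and `w` after this round. -/
noncomputable def exploreState (v w : Fin n) (k : ℕ) (ω : Sym2 (Fin n) → Bool) :
    Finset (Fin n) × Finset (Fin n) × Finset (Fin n) :=
  (nearPair (coinGraph ω) v w k, nearBall (coinGraph ω) v (k + 1),
    nearBall (coinGraph ω) w (k + 1))

/-- The pairs between the current layer of the exploration and the unexplored vertices. -/
def unexposedPairs (a : Finset (Fin n) × Finset (Fin n) × Finset (Fin n)) : Set (Sym2 (Fin n)) :=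
  {e | ∃ x ∉ a.2.1 ∪ a.2.2, ∃ y ∈ (a.2.1 ∪ a.2.2) \ a.1, e = s(x, y)}

lemma exploreState_congr {v w : Fin n} {k : ℕ} {ω ω' : Sym2 (Fin n) → Bool}
    (h : ∀ e ∉ unexposedPairs (exploreState v w k ω), ω e = ω' e) :
    exploreState v w k ω' = exploreState v w k ω := by
  have hadj : ∀ y ∈ nearPair (coinGraph ω) v w k, ∀ x,
      (coinGraph ω).Adj y x ↔ (coinGraph ω').Adj y x := by
    intro y hy x
    rw [coinGraph_adj, coinGraph_adj, h]
    rintro ⟨o, ho, l, hl, he⟩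
    have hy' := nearPair_subset_succ _ _ _ _ hy
    rcases Sym2.eq_iff.1 he with ⟨rfl, rfl⟩ | ⟨rfl, rfl⟩
    · exact ho (by simpa [exploreState, nearPair] using hy')
    · exact (Finset.mem_sdiff.1 hl).2 hy
  have hv := nearBall_congr (v := v) fun y hy => hadj y (Finset.mem_union_left _ hy)
  have hw := nearBall_congr (v := w) fun y hy => hadj y (Finset.mem_union_right _ hy)
  simp only [exploreState, nearPair, hv, hw]

/-- One round of the exploration: if every unexplored vertex satisfies a property of its pairs
to the current layer with probability at least `q`, then it is unlikely that noticeably fewer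
unexplored vertices than expected satisfy it. -/
lemma measureReal_exploreState_le (p : unitInterval) (v w : Fin n) (k : ℕ)
    (good : Finset (Fin n) × Finset (Fin n) × Finset (Fin n) → Prop)
    (E : Finset (Fin n) × Finset (Fin n) × Finset (Fin n) → Fin n → Set (Sym2 (Fin n) → Bool))
    (hE : ∀ a x, DependsOn (fun ω => ω ∈ E a x)
      {e | ∃ y ∈ (a.2.1 ∪ a.2.2) \ a.1, e = s(x, y)})
    {q m ε : ℝ} (hq0 : 0 ≤ q) (hε0 : 0 ≤ ε) (hε1 : ε ≤ 1)
    (hq : ∀ a, good a → ∀ x ∉ a.2.1 ∪ a.2.2, q ≤ (coinMeasure n p).real (E a x))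
    (hm : ∀ a, good a → m ≤ ((a.2.1 ∪ a.2.2)ᶜ.card : ℝ)) :
    (coinMeasure n p).real {ω | good (exploreState v w k ω) ∧
      (({x ∈ ((exploreState v w k ω).2.1 ∪ (exploreState v w k ω).2.2)ᶜ |
        ω ∈ E (exploreState v w k ω) x} : Finset (Fin n)).card : ℝ) < (1 - ε) * (m * q)} ≤
      exp (-(ε ^ 2 * (m * q) / 2)) := by
  refine measureReal_deferred_le (exploreState v w k) unexposedPairs
    (fun ω ω' h => exploreState_congr h)
    (fun a => {ω | good a ∧ (({x ∈ (a.2.1 ∪ a.2.2)ᶜ | ω ∈ E a x} : Finset (Fin n)).card : ℝ) <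
      (1 - ε) * (m * q)}) ?_ ?_
  · intro a ω ω' h
    have : ∀ x ∈ (a.2.1 ∪ a.2.2)ᶜ, (ω ∈ E a x ↔ ω' ∈ E a x) := by
      intro x hx
      refine iff_of_eq (hE a x fun e he => h e ?_)
      obtain ⟨y, hy, rfl⟩ := he
      exact ⟨x, Finset.mem_compl.1 hx, y, hy, rfl⟩
    simp only [Set.mem_ofPred_eq, Finset.filter_congr this]
  · intro a
    by_cases ha : good a
    · have hmono : m * q ≤ ((a.2.1 ∪ a.2.2)ᶜ.card : ℝ) * q :=
        mul_le_mul_of_nonneg_right (hm a ha) hq0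
      refine le_trans (measureReal_mono ?_) ((measureReal_card_filter_lt_le
        (ν := bernoulliMeasure true false p) (a.2.1 ∪ a.2.2)ᶜ (E := E a) (fun x _ => hE a x) ?_
        (fun x hx => hq a ha x (Finset.mem_compl.1 hx)) hq0 hε0 hε1).trans ?_)
      · rintro ω ⟨-, hω⟩
        exact hω.trans_le (mul_le_mul_of_nonneg_left hmono (by linarith))
      · intro x hx x' hx' hne
        refine Set.disjoint_left.2 ?_
        rintro e ⟨y, hy, rfl⟩ ⟨y', hy', he⟩
        rcases Sym2.eq_iff.1 he with ⟨h, -⟩ | ⟨rfl, -⟩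
        · exact hne h
        · exact Finset.mem_compl.1 (Finset.mem_coe.1 hx) (Finset.mem_sdiff.1 hy').1
      · rw [Real.exp_le_exp]
        have : 0 ≤ ε ^ 2 := by positivity
        nlinarith
    · simp [ha, Real.exp_nonneg]

lemma dependsOn_exists_eq_true {x : Fin n} {B L : Finset (Fin n)} (hB : B ⊆ L) :
    DependsOn (fun ω : Sym2 (Fin n) → Bool => ∃ y ∈ B, ω s(x, y) = true)
      {e | ∃ y ∈ L, e = s(x, y)} := by
  intro ω ω' h
  refine propext (exists_congr fun y => and_congr_right fun hy => ?_)
  rw [h s(x, y) ⟨y, hB hy, rfl⟩]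

lemma measureReal_exists_eq_true (p : unitInterval) (x : Fin n) (B : Finset (Fin n)) :
    (coinMeasure n p).real {ω | ∃ y ∈ B, ω s(x, y) = true} = 1 - (1 - (p : ℝ)) ^ B.card := by
  rw [← measureReal_forall_eq_false p x B, ← probReal_compl_eq_one_sub
    (Set.toFinite _).measurableSet]
  congr 1
  ext ω
  simp

lemma le_measureReal_xor (p : unitInterval) (x : Fin n) (A B : Finset (Fin n)) :
    (1 - (p : ℝ)) ^ A.card + (1 - (p : ℝ)) ^ B.card - 2 * (1 - (p : ℝ)) ^ (A ∪ B).card ≤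
      (coinMeasure n p).real
        {ω | Xor (∃ y ∈ A, ω s(x, y) = true) (∃ y ∈ B, ω s(x, y) = true)} := by
  set N : Finset (Fin n) → Set (Sym2 (Fin n) → Bool) :=
    fun C => {ω | ∀ y ∈ C, ω s(x, y) = false} with hN
  have hmem : ∀ C ω, ω ∈ N C ↔ ¬ ∃ y ∈ C, ω s(x, y) = true := by
    intro C ω; simp [hN]
  have hsub : ∀ C, C ⊆ A ∪ B → (coinMeasure n p).real (N C \ N (A ∪ B)) =
      (1 - (p : ℝ)) ^ C.card - (1 - (p : ℝ)) ^ (A ∪ B).card := by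
    intro C hC
    rw [measureReal_sdiff (show N (A ∪ B) ⊆ N C from fun ω hω y hy => hω y (hC hy)) (Set.toFinite _).measurableSet,
      measureReal_forall_eq_false, measureReal_forall_eq_false]
  have hdisj : Disjoint (N A \ N (A ∪ B)) (N B \ N (A ∪ B)) := by
    refine Set.disjoint_left.2 fun ω h1 h2 => h1.2 fun y hy => ?_
    rcases Finset.mem_union.1 hy with hy | hy
    exacts [h1.1 y hy, h2.1 y hy]
  calc _ = (coinMeasure n p).real (N A \ N (A ∪ B) ∪ N B \ N (A ∪ B)) := by
        rw [measureReal_union hdisj (Set.toFinite _).measurableSet,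
          hsub A Finset.subset_union_left, hsub B Finset.subset_union_right]
        ring
    _ ≤ _ := by
        refine measureReal_mono fun ω hω => ?_
        simp only [Set.mem_union, Set.mem_sdiff, hmem, Finset.mem_union, or_and_right, exists_or,
          not_not] at hω
        simp only [Set.mem_ofPred_eq, Xor]
        rcases hω with ⟨h1, h2 | h2⟩ | ⟨h1, h2 | h2⟩
        exacts [absurd h2 h1, .inr ⟨h2, h1⟩, .inl ⟨h2, h1⟩, absurd h2 h1]

lemma measureReal_lt_degree_le (p : unitInterval) (v : Fin n) {τ : ℝ} (hτ0 : 0 ≤ τ)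
    (hτ1 : τ ≤ 1) :
    (coinMeasure n p).real {ω | (1 + τ) * (p * ((n : ℝ) - 1)) <
      (({x | (coinGraph ω).Adj v x} : Finset (Fin n)).card : ℝ)} ≤
      exp (-(τ ^ 2 * (p * ((n : ℝ) - 1)) / 4)) := by
  have hcard : ((Finset.univ.erase v).card : ℝ) = (n : ℝ) - 1 := by
    rw [Finset.card_erase_of_mem (Finset.mem_univ v), Finset.card_univ, Fintype.card_fin,
      Nat.cast_sub (Nat.one_le_of_lt v.2), Nat.cast_one]
  have := measureReal_lt_card_filter_le (ν := bernoulliMeasure true false p)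
    (Finset.univ.erase v) (E := fun x => {ω : Sym2 (Fin n) → Bool | ω s(v, x) = true})
    (S := fun x => {s(v, x)}) ?_ ?_ (q := p) ?_ p.2.1 hτ0 hτ1
  · rw [hcard, mul_comm ((n : ℝ) - 1)] at this
    refine le_trans (measureReal_mono fun ω hω => ?_) this
    rw [Set.mem_ofPred_eq] at hω ⊢
    convert hω using 3
    ext x
    simp only [Finset.mem_filter, Finset.mem_erase, Finset.mem_univ, true_and,
      coinGraph_adj, Set.mem_ofPred_eq, ne_comm (a := v), and_comm]
  · intro x _ ω ω' h
    have := h s(v, x) rfl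
    simp [this]
  · intro x _ y _ hxy
    exact Set.disjoint_singleton.2 fun h => hxy (Sym2.congr_right.1 h)
  · intro x _
    have := measureReal_exists_eq_true p v {x}
    simp only [Finset.mem_singleton, exists_eq_left, Finset.card_singleton, pow_one,
      sub_sub_cancel] at this
    exact this.le

end ExplorationProbability

section ResolvingPairs

open MeasureTheory
open scoped Classical

variable {n : ℕ}

lemma exists_coinGraph_adj_iff {ω : Sym2 (Fin n) → Bool} {x : Fin n} {B N : Finset (Fin n)}
    (hx : x ∉ N) (hB : B ⊆ N) :
    (∃ y ∈ B, (coinGraph ω).Adj x y) ↔ ∃ y ∈ B, ω s(x, y) = true := by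
  refine exists_congr fun y => and_congr_right fun hy => ?_
  rw [coinGraph_adj, and_iff_left]
  rintro rfl
  exact hx (hB hy)

/-- Every layer of the exploration is large when each layer is followed by a large one. -/
lemma measureReal_layer_lt_le (p : unitInterval) (v w : Fin n) (k : ℕ) {ε l r b : ℝ}
    (hε0 : 0 ≤ ε) (hε1 : ε ≤ 1) (hl : 1 ≤ l) (hr : r ≤ (1 - ε) ^ 3 * (n * p))
    (hb : exp (-(ε ^ 2 * r / 2)) ≤ b) :
    (coinMeasure n p).real {ω |
      (l ≤ ((nearPair (coinGraph ω) v w (k + 1) \ nearPair (coinGraph ω) v w k).card : ℝ) ∧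
        p * ((nearPair (coinGraph ω) v w (k + 1) \ nearPair (coinGraph ω) v w k).card : ℝ) ≤ ε ∧
        (1 - ε) * n ≤ ((nearPair (coinGraph ω) v w (k + 1))ᶜ.card : ℝ)) ∧
      ((nearPair (coinGraph ω) v w (k + 2) \ nearPair (coinGraph ω) v w (k + 1)).card : ℝ) <
        r * l} ≤ b := by
  have hp0 : (0 : ℝ) ≤ p := p.2.1
  have hp1 : (p : ℝ) ≤ 1 := p.2.2
  have hε : 0 ≤ 1 - ε := by linarith
  have key := measureReal_exploreState_le p v w k
    (fun a => l ≤ (((a.2.1 ∪ a.2.2) \ a.1).card : ℝ) ∧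
      p * (((a.2.1 ∪ a.2.2) \ a.1).card : ℝ) ≤ ε ∧ (1 - ε) * n ≤ ((a.2.1 ∪ a.2.2)ᶜ.card : ℝ))
    (fun a x => {ω | ∃ y ∈ (a.2.1 ∪ a.2.2) \ a.1, ω s(x, y) = true})
    (fun a x => dependsOn_exists_eq_true subset_rfl)
    (q := (1 - ε) * (p * l)) (m := (1 - ε) * n) (by positivity) hε0 hε1 ?_ fun a ha => ha.2.2
  · refine le_trans (measureReal_mono ?_) (key.trans (le_trans (Real.exp_le_exp.2 ?_) hb))
    · rintro ω ⟨hgood, hlt⟩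
      refine ⟨hgood, ?_⟩
      rw [nearPair_succ_sdiff] at hlt
      have hrl : r * l ≤ (1 - ε) * ((1 - ε) * n * ((1 - ε) * (p * l))) := by
        calc r * l ≤ (1 - ε) ^ 3 * (n * p) * l := by gcongr
          _ = _ := by ring
      refine lt_of_eq_of_lt ?_ (hlt.trans_le hrl)
      congr 2
      ext x
      simp only [Finset.mem_filter, Finset.mem_compl]
      refine and_congr_right fun hx => ?_
      exact (exists_coinGraph_adj_iff hx Finset.sdiff_subset).symm
    · have h1 : r ≤ (1 - ε) * n * ((1 - ε) * (p * l)) := by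
        have h2 : 0 ≤ (1 - ε) ^ 2 * (n * p) := by positivity
        calc r ≤ (1 - ε) ^ 2 * (n * p) * (1 - ε) := by linarith
          _ ≤ (1 - ε) ^ 2 * (n * p) * l := by gcongr; linarith
          _ = _ := by ring
      have : 0 ≤ ε ^ 2 := by positivity
      nlinarith
  · rintro a ⟨h1, h2, -⟩ x -
    rw [measureReal_exists_eq_true]
    set s := ((a.2.1 ∪ a.2.2) \ a.1).card
    have h3 : (1 - (p : ℝ)) ^ s ≤ exp (-(p * s)) := by
      calc (1 - (p : ℝ)) ^ s ≤ exp (-p) ^ s :=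
            pow_le_pow_left₀ (by linarith) (by linarith [Real.add_one_le_exp (-(p : ℝ))]) _
        _ = exp (-(p * s)) := by rw [← Real.exp_nat_mul]; ring_nf
    have hps : 0 ≤ (p : ℝ) * s := by positivity
    have h4 : exp (-(p * s : ℝ)) ≤ 1 - p * s + (p * s) ^ 2 := by
      have := Real.abs_exp_sub_one_sub_id_le (x := -(p * s : ℝ))
        (by rw [abs_neg, abs_of_nonneg hps]; linarith)
      have := (abs_le.1 this).2
      nlinarith
    have h5 : (p : ℝ) * l ≤ p * s := by gcongr
    nlinarith

/-- Vertices that are reached from exactly one of `v` and `w` in the next round of the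
exploration are plentiful. -/
lemma measureReal_xor_lt_le (p : unitInterval) (v w : Fin n) (k : ℕ) {ε l D q b : ℝ}
    (hε0 : 0 ≤ ε) (hε1 : ε ≤ 1) (hq0 : 0 ≤ q)
    (hq : ∀ s t u : ℕ, (s : ℝ) ≤ D → (t : ℝ) ≤ D → l ≤ u →
      q ≤ (1 - (p : ℝ)) ^ s + (1 - (p : ℝ)) ^ t - 2 * (1 - (p : ℝ)) ^ u)
    (hb0 : 0 ≤ b) (hb : q = 0 ∨ exp (-(ε ^ 2 * ((1 - ε) * n * q) / 2)) ≤ b) :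
    (coinMeasure n p).real {ω |
      (((nearBall (coinGraph ω) v (k + 1) \ nearPair (coinGraph ω) v w k).card : ℝ) ≤ D ∧
        ((nearBall (coinGraph ω) w (k + 1) \ nearPair (coinGraph ω) v w k).card : ℝ) ≤ D ∧
        l ≤ ((nearPair (coinGraph ω) v w (k + 1) \ nearPair (coinGraph ω) v w k).card : ℝ) ∧
        (1 - ε) * n ≤ ((nearPair (coinGraph ω) v w (k + 1))ᶜ.card : ℝ)) ∧
      (({x ∈ (nearPair (coinGraph ω) v w (k + 1))ᶜ |
        Xor (∃ y ∈ nearBall (coinGraph ω) v (k + 1) \ nearPair (coinGraph ω) v w k,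
            (coinGraph ω).Adj x y)
          (∃ y ∈ nearBall (coinGraph ω) w (k + 1) \ nearPair (coinGraph ω) v w k,
            (coinGraph ω).Adj x y)} : Finset (Fin n)).card : ℝ) < (1 - ε) * ((1 - ε) * n * q)} ≤
      b := by
  rcases hb with rfl | hb
  · refine le_of_eq_of_le ?_ hb0
    convert measureReal_empty using 2
    refine Set.eq_empty_of_forall_notMem fun ω hω => ?_
    have := hω.2
    rw [mul_zero, mul_zero] at this
    exact absurd this (Nat.cast_nonneg _).not_gt
  · have key := measureReal_exploreState_le p v w k
      (fun a => ((a.2.1 \ a.1).card : ℝ) ≤ D ∧ ((a.2.2 \ a.1).card : ℝ) ≤ D ∧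
        l ≤ (((a.2.1 ∪ a.2.2) \ a.1).card : ℝ) ∧ (1 - ε) * n ≤ ((a.2.1 ∪ a.2.2)ᶜ.card : ℝ))
      (fun a x => {ω | Xor (∃ y ∈ a.2.1 \ a.1, ω s(x, y) = true)
        (∃ y ∈ a.2.2 \ a.1, ω s(x, y) = true)})
      ?_ hq0 hε0 hε1 ?_ (fun a ha => ha.2.2.2)
    · refine le_trans (measureReal_mono ?_) (key.trans hb)
      rintro ω ⟨hgood, hlt⟩
      refine ⟨hgood, lt_of_eq_of_lt ?_ hlt⟩
      congr 2
      ext x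
      simp only [Finset.mem_filter, Finset.mem_compl]
      refine and_congr_right fun hx' => ?_
      have h1 := exists_coinGraph_adj_iff (ω := ω) hx'
        (Finset.sdiff_subset.trans Finset.subset_union_left :
          nearBall (coinGraph ω) v (k + 1) \ nearPair (coinGraph ω) v w k ⊆ _)
      have h2 := exists_coinGraph_adj_iff (ω := ω) hx'
        (Finset.sdiff_subset.trans Finset.subset_union_right :
          nearBall (coinGraph ω) w (k + 1) \ nearPair (coinGraph ω) v w k ⊆ _)
      rw [h1, h2]
      rfl
    · intro a x ω ω' h
      have h1 := dependsOn_exists_eq_true (x := x)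
        (Finset.sdiff_subset_sdiff (Finset.subset_union_left (s₁ := a.2.1) (s₂ := a.2.2))
          (subset_refl a.1)) h
      have h2 := dependsOn_exists_eq_true (x := x)
        (Finset.sdiff_subset_sdiff (Finset.subset_union_right (s₁ := a.2.1) (s₂ := a.2.2))
          (subset_refl a.1)) h
      simp only [eq_iff_iff, Set.mem_ofPred_eq] at h1 h2 ⊢
      rw [h1, h2]
    · rintro a ⟨h1, h2, h3, -⟩ x -
      rw [Finset.union_sdiff_distrib] at h3
      exact (hq _ _ _ h1 h2 h3).trans (le_measureReal_xor p x _ _)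

/-- With high probability every pair of vertices is resolved by many vertices. -/
lemma measureReal_exists_card_dist_ne_lt_le (p : unitInterval) {i : ℕ} (hi : 1 ≤ i)
    {d ε τ q b : ℝ} (hd : d = p * ((n : ℝ) - 1)) (hε0 : 0 ≤ ε) (hε1 : ε ≤ 1) (hτ0 : 0 ≤ τ)
    (hτ1 : τ ≤ 1) (hsmall : 4 * (i + 1) * ((1 + τ) * d) ^ i ≤ ε * n)
    (hgrow : 1 ≤ (1 - ε) ^ 3 * d) (hdeg : exp (-(τ ^ 2 * d / 4)) ≤ b)
    (hlayer : exp (-(ε ^ 2 * ((1 - ε) ^ 3 * d) / 2)) ≤ b) (hq0 : 0 ≤ q)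
    (hq : ∀ s t u : ℕ, (s : ℝ) ≤ ((1 + τ) * d) ^ i → (t : ℝ) ≤ ((1 + τ) * d) ^ i →
      2 * ((1 - ε) ^ 3 * d) ^ i ≤ u →
      q ≤ (1 - (p : ℝ)) ^ s + (1 - (p : ℝ)) ^ t - 2 * (1 - (p : ℝ)) ^ u)
    (hb : q = 0 ∨ exp (-(ε ^ 2 * ((1 - ε) * n * q) / 2)) ≤ b) :
    (coinMeasure n p).real {ω | ∃ v w, v ≠ w ∧
      (({u | (coinGraph ω).dist u v ≠ (coinGraph ω).dist u w} : Finset (Fin n)).card : ℝ) <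
        4 * ((1 - ε) ^ 3 * d) ^ i - 2 * ((1 + τ) * d) ^ i + (1 - ε) * ((1 - ε) * n * q)} ≤
      n * b + n ^ 2 * ((i + 1) * b) := by
  set μ := coinMeasure n p
  set Δ := (1 + τ) * d with hΔ
  set r := (1 - ε) ^ 3 * d with hr
  have hp0 : (0 : ℝ) ≤ p := p.2.1
  have hp1 : (p : ℝ) ≤ 1 := p.2.2
  have hb0 : 0 ≤ b := (Real.exp_nonneg _).trans hdeg
  have hεp : 0 ≤ 1 - ε := by linarith
  have hd1 : 1 ≤ d := by
    have h1 : (1 - ε) ^ 3 ≤ 1 := pow_le_one₀ hεp (by linarith)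
    have h0 : 0 ≤ (1 - ε) ^ 3 := by positivity
    have h2 : 0 < d := by
      by_contra! h
      linarith [mul_nonpos_of_nonneg_of_nonpos h0 h]
    linarith [mul_le_mul_of_nonneg_right h1 h2.le]
  have hΔ1 : 1 ≤ Δ := by nlinarith
  have hrΔ : 1 ≤ r := hgrow
  have hdn : d ≤ n * p := by rw [hd]; nlinarith
  set degBad : Fin n → Set (Sym2 (Fin n) → Bool) := fun v =>
    {ω | Δ < (({x | (coinGraph ω).Adj v x} : Finset (Fin n)).card : ℝ)} with hdegBad
  set layBad : Fin n → Fin n → ℕ → Set (Sym2 (Fin n) → Bool) := fun v w k => {ω |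
      (2 * r ^ k ≤
          ((nearPair (coinGraph ω) v w (k + 1) \ nearPair (coinGraph ω) v w k).card : ℝ) ∧
        p * ((nearPair (coinGraph ω) v w (k + 1) \ nearPair (coinGraph ω) v w k).card : ℝ) ≤ ε ∧
        (1 - ε) * n ≤ ((nearPair (coinGraph ω) v w (k + 1))ᶜ.card : ℝ)) ∧
      ((nearPair (coinGraph ω) v w (k + 2) \ nearPair (coinGraph ω) v w (k + 1)).card : ℝ) <
        r * (2 * r ^ k)} with hlayBad
  set xorBad : Fin n → Fin n → Set (Sym2 (Fin n) → Bool) := fun v w => {ω |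
      (((nearBall (coinGraph ω) v (i + 1) \ nearPair (coinGraph ω) v w i).card : ℝ) ≤ Δ ^ i ∧
        ((nearBall (coinGraph ω) w (i + 1) \ nearPair (coinGraph ω) v w i).card : ℝ) ≤ Δ ^ i ∧
        2 * r ^ i ≤
          ((nearPair (coinGraph ω) v w (i + 1) \ nearPair (coinGraph ω) v w i).card : ℝ) ∧
        (1 - ε) * n ≤ ((nearPair (coinGraph ω) v w (i + 1))ᶜ.card : ℝ)) ∧
      (({x ∈ (nearPair (coinGraph ω) v w (i + 1))ᶜ |
        Xor (∃ y ∈ nearBall (coinGraph ω) v (i + 1) \ nearPair (coinGraph ω) v w i,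
            (coinGraph ω).Adj x y)
          (∃ y ∈ nearBall (coinGraph ω) w (i + 1) \ nearPair (coinGraph ω) v w i,
            (coinGraph ω).Adj x y)} : Finset (Fin n)).card : ℝ) < (1 - ε) * ((1 - ε) * n * q)}
    with hxorBad
  have hdegle : ∀ v, μ.real (degBad v) ≤ b := fun v => by
    have := measureReal_lt_degree_le p v hτ0 hτ1
    rw [← hd] at this
    exact this.trans hdeg
  have hlayle : ∀ v w k, μ.real (layBad v w k) ≤ b := fun v w k =>
    measureReal_layer_lt_le p v w k hε0 hε1
      (by nlinarith [one_le_pow₀ hrΔ (n := k)]) (by rw [hr]; gcongr) hlayer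
  have hxorle : ∀ v w, μ.real (xorBad v w) ≤ b := fun v w =>
    measureReal_xor_lt_le p v w i hε0 hε1 hq0 hq hb0 hb
  have hcover : {ω | ∃ v w, v ≠ w ∧
      (({u | (coinGraph ω).dist u v ≠ (coinGraph ω).dist u w} : Finset (Fin n)).card : ℝ) <
        4 * r ^ i - 2 * Δ ^ i + (1 - ε) * ((1 - ε) * n * q)} ⊆
      (⋃ v ∈ (Finset.univ : Finset (Fin n)), degBad v) ∪
      ⋃ e ∈ (Finset.univ : Finset (Fin n × Fin n)),
        ((⋃ k ∈ Finset.range i, layBad e.1 e.2 k) ∪ xorBad e.1 e.2) := by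
    rintro ω ⟨v, w, hvw, hlt⟩
    by_contra hω
    simp only [Set.mem_union, Set.mem_iUnion, Finset.mem_univ, true_and, not_or, not_exists,
      exists_prop, Finset.mem_range, not_and, Prod.forall] at hω
    obtain ⟨hdeg, hlx⟩ := hω
    have hlay := (hlx v w).1
    have hxor := (hlx v w).2
    have hdeg' : ∀ y, (({x | (coinGraph ω).Adj y x} : Finset (Fin n)).card : ℝ) ≤ Δ :=
      fun y => not_lt.1 (hdeg y)
    have hA : ∀ v' k, ((nearBall (coinGraph ω) v' (k + 1) \
        nearBall (coinGraph ω) v' k).card : ℝ) ≤ Δ ^ k :=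
      fun v' k => card_nearBall_succ_sdiff_le hdeg' v' k
    have hAv : ∀ k, ((nearBall (coinGraph ω) v (k + 1) \
        nearPair (coinGraph ω) v w k).card : ℝ) ≤ Δ ^ k := fun k =>
      le_trans (Nat.cast_le.2 (Finset.card_le_card
        (Finset.sdiff_subset_sdiff subset_rfl Finset.subset_union_left))) (hA v k)
    have hAw : ∀ k, ((nearBall (coinGraph ω) w (k + 1) \
        nearPair (coinGraph ω) v w k).card : ℝ) ≤ Δ ^ k := fun k =>
      le_trans (Nat.cast_le.2 (Finset.card_le_card
        (Finset.sdiff_subset_sdiff subset_rfl Finset.subset_union_right))) (hA w k)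
    have hL : ∀ k, ((nearPair (coinGraph ω) v w (k + 1) \
        nearPair (coinGraph ω) v w k).card : ℝ) ≤ 2 * Δ ^ k := by
      intro k
      have h1 : nearPair (coinGraph ω) v w (k + 1) \ nearPair (coinGraph ω) v w k = _ :=
        Finset.union_sdiff_distrib _ _ _
      have h2 := Finset.card_union_le
        (nearBall (coinGraph ω) v (k + 1) \ nearPair (coinGraph ω) v w k)
        (nearBall (coinGraph ω) w (k + 1) \ nearPair (coinGraph ω) v w k)
      rw [← h1] at h2
      have h3 : ((nearPair (coinGraph ω) v w (k + 1) \
          nearPair (coinGraph ω) v w k).card : ℝ) ≤ _ := Nat.cast_le.2 h2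
      push_cast at h3
      linarith [hAv k, hAw k]
    have hcompl : ∀ k ≤ i, (1 - ε) * n ≤ ((nearPair (coinGraph ω) v w (k + 1))ᶜ.card : ℝ) := by
      intro k hk
      have h1 := card_nearBall_le hΔ1 hdeg' v (i := i) (k := k + 1) (by omega)
      have h2 := card_nearBall_le hΔ1 hdeg' w (i := i) (k := k + 1) (by omega)
      have h3 : ((nearPair (coinGraph ω) v w (k + 1)).card : ℝ) ≤ _ :=
        Nat.cast_le.2 (Finset.card_union_le _ _)
      have h4 : ((nearPair (coinGraph ω) v w (k + 1)).card : ℝ) +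
          ((nearPair (coinGraph ω) v w (k + 1))ᶜ.card : ℝ) = n := by
        have := Finset.card_add_card_compl (nearPair (coinGraph ω) v w (k + 1))
        rw [Fintype.card_fin] at this
        exact_mod_cast this
      have h5 : ((k + 1 : ℕ) : ℝ) * Δ ^ i ≤ (i + 1) * Δ ^ i := by
        have : ((k + 1 : ℕ) : ℝ) ≤ i + 1 := by exact_mod_cast Nat.succ_le_succ hk
        gcongr
      push_cast at h3
      have h6 : 0 ≤ (i + 1) * Δ ^ i := by positivity
      linarith
    have hpL : ∀ k < i, (p : ℝ) * ((nearPair (coinGraph ω) v w (k + 1) \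
        nearPair (coinGraph ω) v w k).card : ℝ) ≤ ε := by
      intro k hk
      have hn : (0 : ℝ) < n := by exact_mod_cast (Nat.zero_le _).trans_lt v.2
      have h1 : (p : ℝ) * n ≤ 2 * Δ := by
        have : (p : ℝ) * n = d + p := by rw [hd]; ring
        nlinarith
      have h2 : Δ ^ (k + 1) ≤ Δ ^ i := pow_le_pow_right₀ hΔ1 hk
      have h3 : 0 ≤ (i : ℝ) * Δ ^ i := by positivity
      have h4 : (p : ℝ) * n * ((nearPair (coinGraph ω) v w (k + 1) \
          nearPair (coinGraph ω) v w k).card : ℝ) ≤ 2 * Δ * (2 * Δ ^ k) :=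
        mul_le_mul h1 (hL k) (Nat.cast_nonneg _) (by linarith)
      refine le_of_mul_le_mul_right ?_ hn
      calc _ = (p : ℝ) * n * ((nearPair (coinGraph ω) v w (k + 1) \
          nearPair (coinGraph ω) v w k).card : ℝ) := by ring
        _ ≤ _ := h4
        _ = 4 * Δ ^ (k + 1) := by ring
        _ ≤ ε * n := by nlinarith
    have hgrowth : ∀ k ≤ i, 2 * r ^ k ≤
        ((nearPair (coinGraph ω) v w (k + 1) \ nearPair (coinGraph ω) v w k).card : ℝ) := by
      intro k
      induction k with
      | zero =>
        intro _
        have : nearPair (coinGraph ω) v w (0 + 1) \ nearPair (coinGraph ω) v w 0 = {v, w} := by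
          ext x; simp [nearPair, nearBall]
        rw [this, Finset.card_pair hvw]
        simp
      | succ k ih =>
        intro hk
        have := hlay k (by omega)
        simp only [hlayBad, Set.mem_ofPred_eq, not_and, not_lt] at this
        have := this ⟨ih (by omega), hpL k (by omega), hcompl k (by omega)⟩
        calc 2 * r ^ (k + 1) = r * (2 * r ^ k) := by ring
          _ ≤ _ := this
    simp only [hxorBad, Set.mem_ofPred_eq, not_and, not_lt] at hxor
    have hX := hxor ⟨hAv i, hAw i, hgrowth i le_rfl, hcompl i le_rfl⟩
    have hcount : 2 * (nearPair (coinGraph ω) v w (i + 1) \ nearPair (coinGraph ω) v w i).card +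
        ({x ∈ (nearPair (coinGraph ω) v w (i + 1))ᶜ |
          Xor (∃ y ∈ nearBall (coinGraph ω) v (i + 1) \ nearPair (coinGraph ω) v w i,
              (coinGraph ω).Adj x y)
            (∃ y ∈ nearBall (coinGraph ω) w (i + 1) \ nearPair (coinGraph ω) v w i,
              (coinGraph ω).Adj x y)} : Finset (Fin n)).card ≤
        (nearBall (coinGraph ω) v (i + 1) \ nearPair (coinGraph ω) v w i).card +
        (nearBall (coinGraph ω) w (i + 1) \ nearPair (coinGraph ω) v w i).card +
        ({u | (coinGraph ω).dist u v ≠ (coinGraph ω).dist u w} : Finset (Fin n)).card := by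
      convert le_card_filter_dist_ne (G := coinGraph ω) (v := v) (w := w) hi rfl rfl rfl
    have hcount' := Nat.cast_le (α := ℝ).2 hcount
    push_cast at hcount'
    linarith [hgrowth i le_rfl, hAv i, hAw i]
  calc _ ≤ _ := measureReal_mono hcover
    _ ≤ ∑ v : Fin n, b + ∑ e : Fin n × Fin n, (∑ k ∈ Finset.range i, b + b) := by
        refine (measureReal_union_le _ _).trans (add_le_add ?_ ?_)
        · exact (measureReal_biUnion_finset_le _ _).trans
            (Finset.sum_le_sum fun v _ => hdegle v)
        · refine (measureReal_biUnion_finset_le _ _).trans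
            (Finset.sum_le_sum fun e _ => (measureReal_union_le _ _).trans
              (add_le_add ?_ (hxorle _ _)))
          exact (measureReal_biUnion_finset_le _ _).trans
            (Finset.sum_le_sum fun k _ => hlayle _ _ k)
    _ = n * b + n ^ 2 * ((i + 1) * b) := by
        simp; ring

lemma metricDim_le_ncard {V : Type*} [Finite V] {G : SimpleGraph V} {R : Set V}
    (h : Resolves G R) : metricDim G ≤ R.ncard :=
  Nat.sInf_le ⟨R, R.toFinite, rfl, h⟩

/-- If every pair of distinct vertices is resolved by at least `M` vertices, then random sampling
finds a small resolving set. -/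
lemma metricDim_le_of_card_dist_ne (G : SimpleGraph (Fin n)) {M : ℝ} {r : ℕ}
    (hM : ∀ v w, v ≠ w → M ≤ (({u | G.dist u v ≠ G.dist u w} : Finset (Fin n)).card : ℝ))
    (hr : (n : ℝ) ^ 2 * exp (-(r * M / n)) < 1) : metricDim G ≤ r := by
  rcases Nat.eq_zero_or_pos n with rfl | hn
  · refine (metricDim_le_ncard (R := ∅) fun v => v.elim0).trans ?_
    rw [Set.ncard_empty]
    exact Nat.zero_le r
  have hn' : (0 : ℝ) < n := by exact_mod_cast hn
  set bad : Fin n × Fin n → Finset (Fin r → Fin n) := fun e =>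
    Fintype.piFinset fun _ => ({u | G.dist u e.1 = G.dist u e.2} : Finset (Fin n)) with hbad
  have hcard : ∀ e ∈ (Finset.univ : Finset (Fin n)).offDiag,
      ((bad e).card : ℝ) ≤ n ^ r * exp (-(r * M / n)) := by
    intro e he
    have h1 : (bad e).card = ({u | G.dist u e.1 = G.dist u e.2} : Finset (Fin n)).card ^ r := by
      simp [hbad, Fintype.card_piFinset]
    have h2 := Finset.card_filter_add_card_filter_not (s := (Finset.univ : Finset (Fin n)))
      (fun u => G.dist u e.1 = G.dist u e.2)
    have h2' : ((({u | G.dist u e.1 = G.dist u e.2} : Finset (Fin n)).card : ℝ)) +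
        (({u | G.dist u e.1 ≠ G.dist u e.2} : Finset (Fin n)).card : ℝ) = n := by
      rw [Finset.card_univ, Fintype.card_fin] at h2
      exact_mod_cast h2
    have h3 := hM e.1 e.2 (Finset.mem_offDiag.1 he).2.2
    have h4 : (({u | G.dist u e.1 = G.dist u e.2} : Finset (Fin n)).card : ℝ) ≤
        n * exp (-(M / n)) := by
      have h5 := Real.add_one_le_exp (-(M / n))
      calc _ ≤ n - M := by linarith
        _ = n * (-(M / n) + 1) := by field_simp; ring
        _ ≤ _ := by gcongr
    rw [h1, Nat.cast_pow]
    calc _ ≤ (n * exp (-(M / n))) ^ r := by gcongr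
      _ = _ := by rw [mul_pow, ← Real.exp_nat_mul]; ring_nf
  have hlt : (((Finset.univ : Finset (Fin n)).offDiag.biUnion bad).card : ℝ) <
      (Finset.univ : Finset (Fin r → Fin n)).card := by
    have hoff : ((Finset.univ : Finset (Fin n)).offDiag.card : ℝ) ≤ n ^ 2 := by
      have : (Finset.univ : Finset (Fin n)).offDiag.card ≤ n ^ 2 := by
        rw [Finset.offDiag_card, Finset.card_univ, Fintype.card_fin, sq]
        exact Nat.sub_le _ _
      exact_mod_cast this
    calc (((Finset.univ : Finset (Fin n)).offDiag.biUnion bad).card : ℝ)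
        ≤ ∑ e ∈ (Finset.univ : Finset (Fin n)).offDiag, ((bad e).card : ℝ) := by
          exact_mod_cast Finset.card_biUnion_le
      _ ≤ ∑ _e ∈ (Finset.univ : Finset (Fin n)).offDiag, (n ^ r * exp (-(r * M / n)) : ℝ) :=
          Finset.sum_le_sum hcard
      _ ≤ n ^ 2 * (n ^ r * exp (-(r * M / n))) := by
          rw [Finset.sum_const, nsmul_eq_mul]
          gcongr
      _ = n ^ r * (n ^ 2 * exp (-(r * M / n))) := by ring
      _ < n ^ r * 1 := by gcongr
      _ = _ := by simp
  obtain ⟨f, -, hf⟩ := Finset.exists_mem_notMem_of_card_lt_card (Nat.cast_lt.1 hlt)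
  refine (metricDim_le_ncard (R := Set.range f) ?_).trans ?_
  · intro v w hvw
    by_contra! h
    refine hf (Finset.mem_biUnion.2 ⟨(v, w), by simpa using hvw, ?_⟩)
    rw [hbad, Fintype.mem_piFinset]
    intro j
    rw [Finset.mem_filter]
    exact ⟨Finset.mem_univ _, h (f j) (Set.mem_range_self j)⟩
  · rw [← Set.image_univ]
    refine (Set.ncard_image_le (Set.finite_univ)).trans ?_
    rw [Set.ncard_univ, Nat.card_eq_fintype_card, Fintype.card_fin]

end ResolvingPairs

section Asymptotics

open MeasureTheory
open scoped Classical

lemma exp_neg_le_one_sub_pow {p : ℝ} (hp0 : 0 ≤ p) (hp : p ≤ 1 / 2) (s : ℕ) :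
    exp (-(p * exp (2 * p) * s)) ≤ (1 - p) ^ s := by
  have h1 : exp (-(p * exp (2 * p))) ≤ 1 - p := by
    have h2 : p * (1 + 2 * p) ≤ p * exp (2 * p) := by
      gcongr
      linarith [Real.add_one_le_exp (2 * p)]
    have h3 : 1 + p * (1 + 2 * p) ≤ exp (p * exp (2 * p)) :=
      le_trans (by linarith) (Real.add_one_le_exp _)
    have h4 : 1 ≤ (1 - p) * (1 + p * (1 + 2 * p)) := by
      nlinarith [mul_nonneg (sq_nonneg p) (by linarith : 0 ≤ 1 - 2 * p)]
    rw [Real.exp_neg, inv_le_iff_one_le_mul₀ (Real.exp_pos _)]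
    exact h4.trans (mul_le_mul_of_nonneg_left h3 (by linarith))
  calc exp (-(p * exp (2 * p) * s)) = exp (-(p * exp (2 * p))) ^ s := by
        rw [← Real.exp_nat_mul]; ring_nf
    _ ≤ (1 - p) ^ s := pow_le_pow_left₀ (Real.exp_nonneg _) h1 s

lemma one_sub_pow_le_exp_neg {p : ℝ} (hp : p ≤ 1) (s : ℕ) : (1 - p) ^ s ≤ exp (-(p * s)) := by
  calc (1 - p) ^ s ≤ exp (-p) ^ s :=
        pow_le_pow_left₀ (by linarith) (by linarith [Real.add_one_le_exp (-p)]) _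
    _ = exp (-(p * s)) := by rw [← Real.exp_nat_mul]; ring_nf

/-- The probability that an unexposed vertex joins exactly one of two explorations is almost
`2 * exp (-c)`. -/
lemma two_mul_exp_neg_le {n i : ℕ} {p d c ε τ L : ℝ} (hn : 2 ≤ n) (hp0 : 0 ≤ p)
    (hp : p ≤ 1 / 2) (hd : d = p * (n - 1)) (hc : c = d ^ (i + 1) / n) (hε : ε ≤ 1 / 2)
    (hτ : 0 ≤ τ) (hL : 1 ≤ L) (hcL : c ≤ L) (hY : L * (i * τ + 2 / n + 2 * p) ≤ ε / 2)
    (hε3 : 3 / 4 ≤ ((1 - ε) ^ 3) ^ i) (hcε : exp (-(c / 2)) ≤ ε)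
    (s t u : ℕ) (hs : (s : ℝ) ≤ ((1 + τ) * d) ^ i) (ht : (t : ℝ) ≤ ((1 + τ) * d) ^ i)
    (hu : 2 * ((1 - ε) ^ 3 * d) ^ i ≤ u) :
    2 * ((1 - 2 * ε) * exp (-c)) ≤ (1 - p) ^ s + (1 - p) ^ t - 2 * (1 - p) ^ u := by
  have hn2 : (2 : ℝ) ≤ n := by exact_mod_cast hn
  have hn0 : (0 : ℝ) < n := by linarith
  have hd0 : 0 ≤ d := by rw [hd]; exact mul_nonneg hp0 (by linarith)
  have hc0 : 0 ≤ c := by rw [hc]; positivity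
  have hcn : c * n = p * d ^ i * (n - 1) := by
    rw [hc, div_mul_cancel₀ _ hn0.ne', pow_succ, hd]; ring
  have hpd : 0 ≤ p * d ^ i := by positivity
  set Y := i * τ + 2 / n + 2 * p with hYdef
  have hY0 : 0 ≤ Y := by positivity
  have hY1 : Y ≤ 1 := by nlinarith
  have hexpY : exp Y ≤ 1 + 2 * Y := by
    have h := (abs_le.1 (Real.abs_exp_sub_one_sub_id_le (x := Y)
      (by rw [abs_of_nonneg hY0]; exact hY1))).2
    nlinarith
  have hlow : ∀ s : ℕ, (s : ℝ) ≤ ((1 + τ) * d) ^ i → (1 - ε) * exp (-c) ≤ (1 - p) ^ s := by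
    intro s hs
    have h1 : p * d ^ i ≤ c * exp (2 / n) := by
      have h2 : 1 + 2 / n ≤ exp (2 / (n : ℝ)) := by linarith [Real.add_one_le_exp (2 / (n : ℝ))]
      have h3 : n ≤ (n - 1) * (1 + 2 / (n : ℝ)) := by
        have : (n - 1) * (1 + 2 / (n : ℝ)) = n + (1 - 2 / n) := by field_simp; ring
        have : 2 / (n : ℝ) ≤ 1 := by rw [div_le_one hn0]; exact hn2
        linarith
      refine le_of_mul_le_mul_right ?_ hn0
      calc p * d ^ i * n ≤ p * d ^ i * ((n - 1) * exp (2 / (n : ℝ))) := by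
            gcongr
            refine h3.trans ?_
            gcongr
            linarith
        _ = c * n * exp (2 / (n : ℝ)) := by rw [hcn]; ring
        _ = _ := by ring
    have h2 : (1 + τ) ^ i ≤ exp (i * τ) := by
      rw [Real.exp_nat_mul]
      gcongr
      linarith [Real.add_one_le_exp τ]
    have h3 : p * exp (2 * p) * s ≤ c + ε := by
      calc p * exp (2 * p) * s ≤ p * exp (2 * p) * ((1 + τ) * d) ^ i := by gcongr
        _ = (1 + τ) ^ i * exp (2 * p) * (p * d ^ i) := by rw [mul_pow]; ring
        _ ≤ exp (i * τ) * exp (2 * p) * (c * exp (2 / n)) := by gcongr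
        _ = c * exp Y := by rw [hYdef, Real.exp_add, Real.exp_add]; ring
        _ ≤ c * (1 + 2 * Y) := by gcongr
        _ ≤ c + ε := by nlinarith
    calc (1 - ε) * exp (-c) ≤ exp (-ε) * exp (-c) := by
          gcongr
          linarith [Real.add_one_le_exp (-ε)]
      _ = exp (-(c + ε)) := by rw [← Real.exp_add]; ring_nf
      _ ≤ exp (-(p * exp (2 * p) * s)) := by gcongr
      _ ≤ _ := exp_neg_le_one_sub_pow hp0 hp s
  have hup : (1 - p) ^ u ≤ ε * exp (-c) := by
    have h1 : c ≤ p * d ^ i := by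
      refine le_of_mul_le_mul_right ?_ hn0
      rw [hcn]
      gcongr
      linarith
    have h2 : c / 2 + c ≤ p * u := by
      calc c / 2 + c = 2 * (3 / 4 * c) := by ring
        _ ≤ 2 * (((1 - ε) ^ 3) ^ i * (p * d ^ i)) := by gcongr
        _ = p * (2 * ((1 - ε) ^ 3 * d) ^ i) := by rw [mul_pow]; ring
        _ ≤ p * u := by gcongr
    calc (1 - p) ^ u ≤ exp (-(p * u)) := one_sub_pow_le_exp_neg (by linarith) u
      _ ≤ exp (-(c / 2 + c)) := by gcongr
      _ = exp (-(c / 2)) * exp (-c) := by rw [← Real.exp_add]; ring_nf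
      _ ≤ ε * exp (-c) := by gcongr
  linarith [hlow s hs, hlow t ht]

/-- Every pair of distinct vertices is likely to be resolved by about
`2 * (d ^ i + n * exp (-c))` vertices. -/
lemma measureReal_card_dist_ne_lt_le_of_large {n i : ℕ} {p d c ε κ η L : ℝ} (hn : 2 ≤ n)
    (hp : 0 ≤ p ∧ p ≤ 1) (hd : d = p * (n - 1)) (hc : c = d ^ (i + 1) / n) (hi1 : 1 ≤ i)
    (hε0 : 0 < ε) (hεη : (6 * i + 2) * ε ≤ η) (hεi : 12 * i * ε ≤ 1) (hκ0 : 0 < κ)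
    (hiκ : i * κ = ε / 6) (hLn : exp L = n) (hL : 1 ≤ L) (hd1 : 1 * L ^ 3 ≤ d)
    (hdε : 1 / ε * L ^ 3 ≤ d) (hdκ : 12 / κ ^ 2 * L ^ 3 ≤ d)
    (hdlay : 6 / (ε ^ 2 * (1 - ε) ^ 3) * L ^ 3 ≤ d) (hdgrow : 1 / (1 - ε) ^ 3 * L ^ 3 ≤ d)
    (hdq : 3 / (ε ^ 3 * (1 - ε) * (1 - 2 * ε)) * L ^ 3 ≤ d)
    (hsmall : d ^ i ≤ ε / (8 * (i + 1)) * n) (hcbig : -(2 * Real.log ε) ≤ c)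
    (hLn' : L ≤ ε / 12 * n) (hL3n : L ^ 3 ≤ (ε / 12) ^ 2 / 4 * n) :
    (coinMeasure n ⟨p, hp⟩).real {ω | ∃ v w, v ≠ w ∧
      (({u | (coinGraph ω).dist u v ≠ (coinGraph ω).dist u w} : Finset (Fin n)).card : ℝ) <
        2 * (1 - η) * (d ^ i + n * exp (-c))} ≤
      n * exp (-(3 * L)) + n ^ 2 * ((i + 1) * exp (-(3 * L))) := by
  have hi1' : (1 : ℝ) ≤ i := by exact_mod_cast hi1
  have hε12 : ε ≤ 1 / 12 := by nlinarith
  have h1ε : 0 < 1 - ε := by linarith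
  have h12ε : 0 < 1 - 2 * ε := by linarith
  have hε3 : 1 - 3 * i * ε ≤ ((1 - ε) ^ 3) ^ i := by
    rw [← pow_mul]
    have := one_add_mul_le_pow (a := -ε) (by linarith) (3 * i)
    push_cast at this
    calc _ = 1 + 3 * i * (-ε) := by ring
      _ ≤ _ := this
      _ = _ := by ring
  have hL3 : L ≤ L ^ 3 := by
    calc L = L * 1 := by ring
      _ ≤ L * L ^ 2 := by gcongr; exact one_le_pow₀ hL
      _ = L ^ 3 := by ring
  have hL31 : 1 ≤ L ^ 3 := hL.trans hL3
  have hn2 : (2 : ℝ) ≤ n := by exact_mod_cast hn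
  have hn0 : (0 : ℝ) < n := by linarith
  have hp0 := (hp).1
  have hd1' : 1 ≤ d := by linarith
  have hd0 : 0 < d := by linarith
  have hddi : d ≤ d ^ i := le_self_pow₀ hd1' (by omega)
  have hdi0 : 0 < d ^ i := by positivity
  obtain ⟨τ, hτ⟩ : ∃ τ, τ = κ / L := ⟨_, rfl⟩
  have hτ0 : 0 ≤ τ := by rw [hτ]; positivity
  have hiτ : L * (i * τ) = ε / 6 := by rw [hτ, ← hiκ]; field_simp
  have hiτ' : i * τ ≤ ε / 6 := by
    rw [← hiτ]
    exact le_mul_of_one_le_left (by positivity) hL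
  have hτ1 : τ ≤ 1 := by
    have : 1 * τ ≤ i * τ := by gcongr
    linarith
  have hτi : (1 + τ) ^ i ≤ 1 + ε := by
    have h1 : (1 + τ) ^ i ≤ exp (i * τ) := by
      rw [Real.exp_nat_mul]
      gcongr
      linarith [Real.add_one_le_exp τ]
    have h2 : 0 ≤ i * τ := by positivity
    have h3 := (abs_le.1 (Real.abs_exp_sub_one_sub_id_le (x := i * τ)
      (by rw [abs_of_nonneg h2]; linarith))).2
    have h4 : (i * τ) ^ 2 ≤ i * τ := by
      rw [sq]
      exact mul_le_of_le_one_left h2 (by linarith)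
    linarith
  have hsm : 4 * (i + 1) * ((1 + τ) * d) ^ i ≤ ε * n := by
    calc 4 * (i + 1) * ((1 + τ) * d) ^ i = 4 * (i + 1) * ((1 + τ) ^ i * d ^ i) := by
          rw [mul_pow]
      _ ≤ 4 * (i + 1) * (2 * (ε / (8 * (i + 1)) * n)) := by gcongr; linarith
      _ = ε * n := by field_simp; ring
  have hgrow : 1 ≤ (1 - ε) ^ 3 * d := by
    calc 1 ≤ (1 - ε) ^ 3 * (1 / (1 - ε) ^ 3 * L ^ 3) := by
          rw [← mul_assoc, mul_one_div_cancel (by positivity), one_mul]; exact hL31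
      _ ≤ _ := by gcongr
  have hdeg : exp (-(τ ^ 2 * d / 4)) ≤ exp (-(3 * L)) := by
    gcongr
    calc 3 * L = τ ^ 2 * (12 / κ ^ 2 * L ^ 3) / 4 := by rw [hτ]; field_simp; ring
      _ ≤ _ := by gcongr
  have hlayer : exp (-(ε ^ 2 * ((1 - ε) ^ 3 * d) / 2)) ≤ exp (-(3 * L)) := by
    gcongr
    calc 3 * L ≤ 3 * L ^ 3 := by gcongr
      _ = ε ^ 2 * ((1 - ε) ^ 3 * (6 / (ε ^ 2 * (1 - ε) ^ 3) * L ^ 3)) / 2 := by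
          field_simp; ring
      _ ≤ _ := by gcongr
  have hmain : 4 * ((1 - ε) ^ 3 * d) ^ i - 2 * ((1 + τ) * d) ^ i ≥
      2 * (1 - (6 * i + 1) * ε) * d ^ i := by
    have h1 := mul_le_mul_of_nonneg_right hε3 hdi0.le
    have h2 := mul_le_mul_of_nonneg_right hτi hdi0.le
    rw [mul_pow, mul_pow]
    linarith
  have hec : 0 ≤ n * exp (-c) := by positivity
  have hηM : 2 * (1 - η) * (d ^ i + n * exp (-c)) ≤
      2 * (1 - (6 * i + 2) * ε) * (d ^ i + n * exp (-c)) := by gcongr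
  by_cases hcase : n * exp (-c) < ε * d ^ i
  · refine (measureReal_mono ?_).trans (measureReal_exists_card_dist_ne_lt_le ⟨p, hp⟩ hi1
      (hd) hε0.le (by linarith) hτ0 hτ1 hsm hgrow hdeg hlayer (q := 0) le_rfl ?_ (Or.inl rfl))
    · rintro ω ⟨v, w, hvw, hlt⟩
      refine ⟨v, w, hvw, hlt.trans_le (hηM.trans ?_)⟩
      have h1 : (1 - (6 * i + 2) * ε) * (d ^ i + n * exp (-c)) ≤
          (1 - (6 * i + 2) * ε) * (d ^ i + ε * d ^ i) := by
        have : 0 ≤ 1 - (6 * i + 2) * ε := by linarith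
        gcongr
      have h2 : 0 ≤ (6 * i + 2) * ε * (ε * d ^ i) := by positivity
      linarith
    · intro s t u hs ht hu
      have hmono : ∀ s : ℕ, (s : ℝ) ≤ ((1 + τ) * d) ^ i → (1 - p) ^ u ≤ (1 - p) ^ s := by
        intro s hs
        refine pow_le_pow_of_le_one (by linarith [hp.2]) (by linarith) ?_
        have h1 := mul_le_mul_of_nonneg_right (hτi.trans (by linarith :
          1 + ε ≤ 2 * ((1 - ε) ^ 3) ^ i)) hdi0.le
        rw [mul_pow] at hs hu
        exact_mod_cast (by linarith : (s : ℝ) ≤ u)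
      linarith [hmono s hs, hmono t ht]
  · have hcase' := not_lt.1 hcase
    have hεd : 1 ≤ ε * d ^ i := by
      calc 1 ≤ ε * (1 / ε * L ^ 3) := by
            rw [← mul_assoc, mul_one_div_cancel hε0.ne', one_mul]; exact hL31
        _ ≤ ε * d ^ i := by gcongr; linarith
    have hcL : c ≤ L := by
      have h1 : exp (c) ≤ n := by
        have h2 : 1 ≤ n * exp (-c) := hεd.trans hcase'
        rw [Real.exp_neg] at h2
        rwa [← div_eq_mul_inv, le_div_iff₀ (Real.exp_pos _), one_mul] at h2
      rwa [← hLn, Real.exp_le_exp] at h1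
    have hpL : p * L ≤ ε / 12 := by
      have h1 : d ^ 2 ≤ n * L := by
        calc d ^ 2 ≤ d ^ (i + 1) := pow_le_pow_right₀ hd1' (by omega)
          _ = n * c := by rw [hc]; field_simp
          _ ≤ n * L := by gcongr
      have h2 : p * n / 2 ≤ d := by
        rw [hd, mul_div_assoc]
        gcongr
        linarith
      have h3 : (p * n / 2) ^ 2 ≤ n * L := le_trans (by gcongr) h1
      refine (sq_le_sq₀ (by positivity) (by positivity)).1 (le_of_mul_le_mul_right ?_ hn0)
      have h4 : p ^ 2 * n ≤ 4 * L := by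
        refine le_of_mul_le_mul_right ?_ hn0
        linarith
      calc (p * L) ^ 2 * n = p ^ 2 * n * L ^ 2 := by ring
        _ ≤ 4 * L * L ^ 2 := by gcongr
        _ ≤ (ε / 12) ^ 2 * n := by linarith
    have hp2 : p ≤ 1 / 2 := by linarith [le_mul_of_one_le_right hp0 hL]
    have hY : L * (i * τ + 2 / n + 2 * p) ≤ ε / 2 := by
      have : L * (2 / n) ≤ ε / 6 := by
        calc L * (2 / n) ≤ ε / 12 * n * (2 / n) := by gcongr
          _ = ε / 6 := by field_simp; norm_num
      linarith
    have hcε : exp (-(c / 2)) ≤ ε := by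
      rw [← Real.le_log_iff_exp_le hε0]
      linarith
    refine (measureReal_mono ?_).trans (measureReal_exists_card_dist_ne_lt_le ⟨p, hp⟩ hi1
      (hd) hε0.le (by linarith) hτ0 hτ1 hsm hgrow hdeg hlayer
      (q := 2 * ((1 - 2 * ε) * exp (-c))) (by positivity)
      (two_mul_exp_neg_le hn hp0 hp2 (hd) (hc) (by linarith) hτ0 hL hcL hY
        (by linarith) hcε) (Or.inr ?_))
    · rintro ω ⟨v, w, hvw, hlt⟩
      refine ⟨v, w, hvw, hlt.trans_le (hηM.trans ?_)⟩
      have h1 : (1 - 4 * ε) ≤ (1 - ε) * ((1 - ε) * (1 - 2 * ε)) := by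
        have : 0 ≤ ε ^ 2 * (5 - 2 * ε) := mul_nonneg (sq_nonneg ε) (by linarith)
        linarith
      have h2 := mul_le_mul_of_nonneg_right h1 hec
      have h3 : 0 ≤ ε * (d ^ i) := by positivity
      have h4 : (1 - (6 * i + 2) * ε) * (n * exp (-c)) ≤ (1 - 4 * ε) * (n * exp (-c)) := by
        gcongr; linarith [mul_le_mul_of_nonneg_right hi1' hε0.le]
      linarith
    · gcongr
      have h1 : ε * (3 / (ε ^ 3 * (1 - ε) * (1 - 2 * ε)) * L ^ 3) ≤ n * exp (-c) :=
        le_trans (by gcongr; exact hdq.trans hddi) hcase'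
      calc 3 * L ≤ 3 * L ^ 3 := by gcongr
        _ = ε ^ 2 * (1 - ε) * (1 - 2 * ε) *
            (ε * (3 / (ε ^ 3 * (1 - ε) * (1 - 2 * ε)) * L ^ 3)) := by
              have : 1 - ε * 2 ≠ 0 := by rw [mul_comm]; exact h12ε.ne'
              field_simp
        _ ≤ ε ^ 2 * (1 - ε) * (1 - 2 * ε) * (n * exp (-c)) := by gcongr
        _ = _ := by ring

variable {p d c : ℕ → ℝ} {i : ℕ}

/-- Asymptotically almost surely every pair of distinct vertices is resolved by about
`2 * (d ^ i + n * exp (-c))` vertices. -/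
lemma eventually_measureReal_card_dist_ne_lt_le (hp : ∀ n, 0 ≤ p n ∧ p n ≤ 1)
    (hd : ∀ n, d n = p n * ((n : ℝ) - 1))
    (hd_lower : Tendsto (fun n : ℕ => d n / (Real.log n) ^ 3) atTop atTop) (hi1 : 1 ≤ i)
    (hi : (fun n : ℕ => d n ^ i) =o[atTop] (fun n : ℕ => (n : ℝ)))
    (hc : ∀ n : ℕ, c n = d n ^ (i + 1) / n) (hc_inf : Tendsto c atTop atTop)
    {η : ℝ} (hη : 0 < η) :
    ∀ᶠ n : ℕ in atTop, (coinMeasure n ⟨p n, hp n⟩).real {ω | ∃ v w, v ≠ w ∧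
      (({u | (coinGraph ω).dist u v ≠ (coinGraph ω).dist u w} : Finset (Fin n)).card : ℝ) <
        2 * (1 - η) * (d n ^ i + n * exp (-c n))} ≤
      n * exp (-(3 * Real.log n)) + n ^ 2 * ((i + 1) * exp (-(3 * Real.log n))) := by
  have hi1' : (1 : ℝ) ≤ i := by exact_mod_cast hi1
  obtain ⟨ε, hε0, hεη, hεi⟩ : ∃ ε : ℝ, 0 < ε ∧ (6 * i + 2) * ε ≤ η ∧ 12 * i * ε ≤ 1 := by
    refine ⟨min (η / (6 * i + 2)) (1 / (12 * i)), by positivity, ?_, ?_⟩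
    · calc _ ≤ (6 * i + 2) * (η / (6 * i + 2)) := by gcongr; exact min_le_left _ _
        _ = η := by field_simp
    · calc _ ≤ 12 * i * (1 / (12 * i) : ℝ) := by gcongr; exact min_le_right _ _
        _ = 1 := by field_simp
  have hlog : Tendsto (fun n : ℕ => Real.log n) atTop atTop :=
    Real.tendsto_log_atTop.comp tendsto_natCast_atTop_atTop
  have hlogpow : ∀ k : ℕ, ∀ δ : ℝ, 0 < δ → ∀ᶠ n : ℕ in atTop, Real.log n ^ k ≤ δ * n := by
    intro k δ hδ
    have h := ((Real.isLittleO_pow_log_id_atTop (n := k)).comp_tendsto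
      tendsto_natCast_atTop_atTop).bound hδ
    filter_upwards [h] with n hn
    simp only [Function.comp, id, Real.norm_natCast] at hn
    exact (le_abs_self _).trans hn
  have hdT : ∀ T : ℝ, ∀ᶠ n : ℕ in atTop, T * Real.log n ^ 3 ≤ d n := by
    intro T
    filter_upwards [hd_lower.eventually_ge_atTop T, hlog.eventually_ge_atTop 1] with n hn hL
    rwa [le_div_iff₀ (by positivity)] at hn
  filter_upwards [eventually_ge_atTop 2, hlog.eventually_ge_atTop 1, hdT 1, hdT (1 / ε),
    hdT (12 / (ε / (6 * i)) ^ 2), hdT (6 / (ε ^ 2 * (1 - ε) ^ 3)), hdT (1 / (1 - ε) ^ 3),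
    hdT (3 / (ε ^ 3 * (1 - ε) * (1 - 2 * ε))),
    hi.bound (c := ε / (8 * (i + 1))) (by positivity),
    hc_inf.eventually_ge_atTop (-(2 * Real.log ε)), hlogpow 1 (ε / 12) (by positivity),
    hlogpow 3 ((ε / 12) ^ 2 / 4) (by positivity)]
    with n hn hL hd1 hdε hdκ hdlay hdgrow hdq hsmall hcbig hLn hL3n
  rw [Real.norm_natCast] at hsmall
  rw [pow_one] at hLn
  exact measureReal_card_dist_ne_lt_le_of_large hn (hp n) (hd n) (hc n) hi1 hε0 hεη hεi
    (κ := ε / (6 * i)) (by positivity) (by field_simp)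
    (Real.exp_log (by exact_mod_cast (by omega : 0 < n))) hL hd1 hdε hdκ hdlay hdgrow hdq
    ((le_abs_self _).trans hsmall) hcbig hLn hL3n

lemma one_le_of_tendsto_atTop (hp : ∀ n, 0 ≤ p n ∧ p n ≤ 1)
    (hd : ∀ n, d n = p n * ((n : ℝ) - 1)) (hc : ∀ n : ℕ, c n = d n ^ (i + 1) / n)
    (hc_inf : Tendsto c atTop atTop) : 1 ≤ i := by
  by_contra! h
  obtain rfl : i = 0 := by omega
  obtain ⟨n, hn, hn1⟩ := ((hc_inf.eventually_ge_atTop 2).and (eventually_ge_atTop 1)).exists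
  have hn1' : (1 : ℝ) ≤ n := by exact_mod_cast hn1
  rw [hc, zero_add, pow_one, le_div_iff₀ (by linarith), hd] at hn
  have := mul_le_mul_of_nonneg_right (hp n).2 (by linarith : (0 : ℝ) ≤ n - 1)
  linarith

lemma tendsto_error_bound (i : ℕ) : Tendsto (fun n : ℕ =>
    n * exp (-(3 * Real.log n)) + n ^ 2 * ((i + 1) * exp (-(3 * Real.log n)))) atTop (𝓝 0) := by
  have h := tendsto_inv_atTop_zero.comp (tendsto_natCast_atTop_atTop (R := ℝ))
  have h1 := (h.pow 2).add (h.const_mul (i + 1 : ℝ))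
  rw [zero_pow two_ne_zero, mul_zero, add_zero] at h1
  refine h1.congr' ?_
  filter_upwards [eventually_ge_atTop 1] with n hn
  have hn0 : (0 : ℝ) < n := by exact_mod_cast hn
  have h2 : exp (-(3 * Real.log n)) = ((n : ℝ) ^ 3)⁻¹ := by
    rw [Real.exp_neg, ← Real.exp_log (pow_pos hn0 3), Real.log_pow]
    norm_num
  rw [h2, Function.comp]
  field_simp

lemma tendsto_gnpProb_metricDim_le (hp : ∀ n, 0 ≤ p n ∧ p n ≤ 1)
    (hd : ∀ n, d n = p n * ((n : ℝ) - 1))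
    (hd_lower : Tendsto (fun n : ℕ => d n / (Real.log n) ^ 3) atTop atTop)
    (hi : (fun n : ℕ => d n ^ i) =o[atTop] (fun n : ℕ => (n : ℝ)))
    (hc : ∀ n : ℕ, c n = d n ^ (i + 1) / n) (hc_inf : Tendsto c atTop atTop)
    {y : ℕ → ℝ} (hy : ∀ᶠ n : ℕ in atTop,
      (d n ^ i / n + exp (-c n))⁻¹ * Real.log n ≤ y n) {δ : ℝ} (hδ : 0 < δ) :
    Tendsto (fun n : ℕ => gnpProb n (p n)
      {G : SimpleGraph (Fin n) | (metricDim G : ℝ) ≤ (1 + δ) * y n}) atTop (𝓝 1) := by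
  have hi1 := one_le_of_tendsto_atTop hp hd hc hc_inf
  set η := δ / (2 * (1 + δ)) with hη
  have hη0 : 0 < η := by positivity
  have hηδ : (1 - η) * (1 + δ) = 1 + δ / 2 := by rw [hη]; field_simp; ring
  have hη1 : η ≤ 1 := by rw [hη, div_le_one (by positivity)]; linarith
  have hlog : Tendsto (fun n : ℕ => Real.log n) atTop atTop :=
    Real.tendsto_log_atTop.comp tendsto_natCast_atTop_atTop
  have hprob : ∀ (n : ℕ) (A : Set (SimpleGraph (Fin n))), gnpProb n (p n) A =
      (coinMeasure n ⟨p n, hp n⟩).real {ω | coinGraph ω ∈ A} :=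
    fun n A => gnpProb_eq_measureReal ⟨p n, hp n⟩ A
  have hlim := (tendsto_error_bound i).const_sub 1
  rw [sub_zero] at hlim
  refine tendsto_of_tendsto_of_tendsto_of_le_of_le' hlim tendsto_const_nhds ?_
    (Eventually.of_forall fun n => by rw [hprob]; exact measureReal_le_one)
  filter_upwards [eventually_measureReal_card_dist_ne_lt_le hp hd hd_lower hi1 hi hc hc_inf hη0,
    hy, hi.bound (c := 1) one_pos, hc_inf.eventually_ge_atTop 0, eventually_ge_atTop 1,
    hlog.eventually_gt_atTop (4 / δ)] with n hbad hyn hdn hcn hn1 hL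
  have hn0 : (0 : ℝ) < n := by exact_mod_cast hn1
  have hn1' : (1 : ℝ) ≤ n := by exact_mod_cast hn1
  have hd0 : 0 ≤ d n := by rw [hd]; exact mul_nonneg (hp n).1 (by linarith)
  refine le_trans ?_ (hprob n _).ge
  rw [sub_le_iff_le_add]
  refine le_trans ?_ (add_le_add_right hbad _)
  refine le_trans ?_ (measureReal_union_le _ _)
  refine le_of_eq_of_le (probReal_univ (μ := coinMeasure n ⟨p n, hp n⟩)).symm ?_
  refine measureReal_mono fun ω _ => or_iff_not_imp_right.2 fun hω => ?_
  set x := d n ^ i / n + exp (-c n) with hx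
  have hx0 : 0 < x := by positivity
  have hx2 : x ≤ 2 := by
    rw [Real.norm_of_nonneg (by positivity), Real.norm_natCast, one_mul] at hdn
    have h1 : d n ^ i / n ≤ 1 := by rwa [div_le_one hn0]
    have h2 : exp (-c n) ≤ 1 := by rw [Real.exp_le_one_iff]; linarith
    linarith
  have hL0 : 0 ≤ Real.log n := Real.log_nonneg hn1'
  have hM : 2 * (1 - η) * (d n ^ i + n * exp (-c n)) = 2 * (1 - η) * x * n := by
    rw [hx]; field_simp
  have hr := Nat.lt_floor_add_one ((1 + δ) * (x⁻¹ * Real.log n))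
  have hdim : metricDim (coinGraph ω) ≤ ⌊(1 + δ) * (x⁻¹ * Real.log n)⌋₊ := by
    refine metricDim_le_of_card_dist_ne _ (M := 2 * (1 - η) * x * n) ?_ ?_
    · intro v w hvw
      by_contra! h
      exact hω ⟨v, w, hvw, h.trans_eq hM.symm⟩
    · set r := ⌊(1 + δ) * (x⁻¹ * Real.log n)⌋₊
      have h1 : (1 + δ) * Real.log n ≤ (r + 1) * x := by
        have := mul_le_mul_of_nonneg_right hr.le hx0.le
        calc _ = (1 + δ) * (x⁻¹ * Real.log n) * x := by field_simp
          _ ≤ _ := this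
      have h2 : (1 + δ / 2) * Real.log n ≤ (1 - η) * ((r + 1) * x) := by
        rw [← hηδ, mul_assoc]
        exact mul_le_mul_of_nonneg_left h1 (by linarith)
      have h3 : (1 - η) * x ≤ 2 := by
        calc (1 - η) * x ≤ 1 * x := by gcongr; linarith
          _ ≤ 2 := by linarith
      have h4 : 4 < δ * Real.log n := by
        rwa [div_lt_iff₀ hδ, mul_comm] at hL
      have h5 : r * (2 * (1 - η) * x * n) / n = 2 * ((1 - η) * (r * x)) := by field_simp
      have h6 : (n : ℝ) ^ 2 = exp (2 * Real.log n) := by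
        rw [two_mul, Real.exp_add, Real.exp_log hn0, sq]
      rw [h5, h6, ← Real.exp_add, Real.exp_lt_one_iff]
      linarith
  change (metricDim (coinGraph ω) : ℝ) ≤ _
  calc (metricDim (coinGraph ω) : ℝ) ≤ ⌊(1 + δ) * (x⁻¹ * Real.log n)⌋₊ := by exact_mod_cast hdim
    _ ≤ (1 + δ) * (x⁻¹ * Real.log n) := Nat.floor_le (by positivity)
    _ ≤ (1 + δ) * y n := by gcongr

end Asymptotics

/-- Theorem 3.1(ii): if `d ≫ log³ n`, `n−d ≫ log n` and `c → ∞`, then a.a.s.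
`β(G) ≤ (1+o(1))·(d^i/n + e^{-c})⁻¹·log n`; in particular a.a.s.
`β(G) ≤ (1+o(1))·e^c·log n` when `e^{-c} ≫ d^i/n`, and
`β(G) ≤ (1+o(1))·n·log n/d^i` when `e^{-c} ≪ d^i/n`. -/
theorem stmt_9 (p d c : ℕ → ℝ)
    (hp : ∀ n, 0 ≤ p n ∧ p n ≤ 1)
    (hd : ∀ n, d n = p n * ((n : ℝ) - 1))
    (hd_lower : Tendsto (fun n : ℕ => d n / (Real.log n) ^ 3) atTop atTop)
    (hd_upper : Tendsto (fun n : ℕ => ((n : ℝ) - d n) / Real.log n) atTop atTop)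
    (i : ℕ)
    (hi : (fun n : ℕ => d n ^ i) =o[atTop] (fun n : ℕ => (n : ℝ)))
    (hi_max : ∀ j : ℕ, ((fun n : ℕ => d n ^ j) =o[atTop] (fun n : ℕ => (n : ℝ))) → j ≤ i)
    (hc : ∀ n : ℕ, c n = d n ^ (i + 1) / n)
    (hc_inf : Tendsto c atTop atTop) :
    (∀ δ : ℝ, 0 < δ →
      Tendsto (fun n : ℕ => gnpProb n (p n)
        {G : SimpleGraph (Fin n) |
          (metricDim G : ℝ) ≤
            (1 + δ) * ((d n ^ i / n + Real.exp (-c n))⁻¹ * Real.log n)})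
        atTop (𝓝 1)) ∧
    (((fun n : ℕ => d n ^ i / n) =o[atTop] (fun n : ℕ => Real.exp (-c n))) →
      ∀ δ : ℝ, 0 < δ →
        Tendsto (fun n : ℕ => gnpProb n (p n)
          {G : SimpleGraph (Fin n) |
            (metricDim G : ℝ) ≤ (1 + δ) * (Real.exp (c n) * Real.log n)})
          atTop (𝓝 1)) ∧
    (((fun n : ℕ => Real.exp (-c n)) =o[atTop] (fun n : ℕ => d n ^ i / n)) →
      ∀ δ : ℝ, 0 < δ →
        Tendsto (fun n : ℕ => gnpProb n (p n)
          {G : SimpleGraph (Fin n) |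
            (metricDim G : ℝ) ≤ (1 + δ) * ((n : ℝ) * Real.log n / d n ^ i)})
          atTop (𝓝 1)) := by
  refine ⟨fun δ hδ => ?_, fun _ δ hδ => ?_, fun _ δ hδ => ?_⟩
  · exact tendsto_gnpProb_metricDim_le hp hd hd_lower hi hc hc_inf
      (Eventually.of_forall fun n => le_rfl) hδ
  · refine tendsto_gnpProb_metricDim_le hp hd hd_lower hi hc hc_inf ?_ hδ
    filter_upwards [eventually_ge_atTop 1] with n hn
    have hn1 : (1 : ℝ) ≤ n := by exact_mod_cast hn
    have hd0 : 0 ≤ d n := by rw [hd]; exact mul_nonneg (hp n).1 (by linarith)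
    have hL0 : 0 ≤ Real.log n := Real.log_nonneg hn1
    have hx : (d n ^ i / n + Real.exp (-c n))⁻¹ ≤ Real.exp (c n) := by
      rw [← inv_inv (Real.exp (c n)), ← Real.exp_neg]
      refine inv_anti₀ (Real.exp_pos _) (le_add_of_nonneg_left ?_)
      positivity
    gcongr
  · refine tendsto_gnpProb_metricDim_le hp hd hd_lower hi hc hc_inf ?_ hδ
    filter_upwards [eventually_ge_atTop 1, hc_inf.eventually_gt_atTop 0] with n hn hcn
    have hn1 : (1 : ℝ) ≤ n := by exact_mod_cast hn
    have hd0 : 0 ≤ d n := by rw [hd]; exact mul_nonneg (hp n).1 (by linarith)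
    have hdi : 0 < d n ^ i := by
      refine pow_pos (hd0.lt_of_ne' fun h => ?_) i
      rw [hc, h, zero_pow (Nat.succ_ne_zero i), zero_div] at hcn
      exact hcn.false
    have hL0 : 0 ≤ Real.log n := Real.log_nonneg hn1
    have hx : (d n ^ i / n + Real.exp (-c n))⁻¹ ≤ n / d n ^ i := by
      rw [← inv_div (d n ^ i) (n : ℝ)]
      exact inv_anti₀ (by positivity) (le_add_of_nonneg_right (Real.exp_nonneg _))
    calc _ ≤ n / d n ^ i * Real.log n := by gcongr
      _ = _ := by ring
end

section
/- Suppose log n ≪ d = p(n−1) = o(n). Let i ≥ 1 be the largest integer such that d^i = o(n), let c = d^{i+1}/n, and let η = log_n(d^i). Suppose c − 2 log n → ∞. Then for G ∈ G(n,p), asymptotically almost surely β(G) ≥ (η + o(1)) · n log n / d^i. -/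
open Filter Real Asymptotics
open scoped Topology

/-- The expectation of `f` under the binomial random graph `G(n,p)`. -/
noncomputable def gnpExp (n : ℕ) (p : ℝ) (f : SimpleGraph (Fin n) → ℝ) : ℝ :=
  ∑ G : SimpleGraph (Fin n), gnpWeight n p G * f G

/-- `h` does not depend on the status of the pairs in `D`. -/
def IgnoresEdges {V : Type*} (D : Set (Sym2 V)) (h : SimpleGraph V → ℝ) : Prop :=
  ∀ G G' : SimpleGraph V, (∀ e, e ∉ D → (e ∈ G.edgeSet ↔ e ∈ G'.edgeSet)) → h G = h G'

/-- The pairs with one end in `W` and the other in `S`. -/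
def crossing {V : Type*} (W S : Finset V) : Set (Sym2 V) :=
  {e | ∃ v ∈ W, ∃ u ∈ S, e = s(v, u)}

open scoped Classical in
/-- The vertices of `W` without a neighbour in `S`. -/
noncomputable def nonNbrs {V : Type*} (G : SimpleGraph V) (W S : Finset V) : Finset V :=
  {v ∈ W | ∀ u ∈ S, ¬ G.Adj v u}

open scoped Classical in
/-- The vertices of `W` with a neighbour in `S`. -/
noncomputable def nbrs {V : Type*} (G : SimpleGraph V) (W S : Finset V) : Finset V :=
  {v ∈ W | ∃ u ∈ S, G.Adj v u}

lemma IgnoresEdges.mono {V : Type*} {D D' : Set (Sym2 V)} {h : SimpleGraph V → ℝ}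
    (hh : IgnoresEdges D h) (hD : D' ⊆ D) : IgnoresEdges D' h :=
  fun G G' hG => hh G G' fun e he => hG e fun he' => he (hD he')

lemma IgnoresEdges.mul {V : Type*} {D : Set (Sym2 V)} {h k : SimpleGraph V → ℝ}
    (hh : IgnoresEdges D h) (hk : IgnoresEdges D k) : IgnoresEdges D fun G => h G * k G :=
  fun G G' hG => by simp only [hh G G' hG, hk G G' hG]

lemma gnpWeight_nonneg {n : ℕ} {p : ℝ} (hp : 0 ≤ p ∧ p ≤ 1) (G : SimpleGraph (Fin n)) :
    0 ≤ gnpWeight n p G :=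
  mul_nonneg (pow_nonneg hp.1 _) (pow_nonneg (by linarith [hp.2]) _)

lemma gnpExp_mono {n : ℕ} {p : ℝ} (hp : 0 ≤ p ∧ p ≤ 1) {f g : SimpleGraph (Fin n) → ℝ}
    (h : ∀ G, f G ≤ g G) : gnpExp n p f ≤ gnpExp n p g :=
  Finset.sum_le_sum fun G _ => mul_le_mul_of_nonneg_left (h G) (gnpWeight_nonneg hp G)

lemma gnpExp_nonneg {n : ℕ} {p : ℝ} (hp : 0 ≤ p ∧ p ≤ 1) {f : SimpleGraph (Fin n) → ℝ}
    (h : ∀ G, 0 ≤ f G) : 0 ≤ gnpExp n p f :=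
  Finset.sum_nonneg fun G _ => mul_nonneg (gnpWeight_nonneg hp G) (h G)

lemma gnpExp_add (n : ℕ) (p : ℝ) (f g : SimpleGraph (Fin n) → ℝ) :
    gnpExp n p (fun G => f G + g G) = gnpExp n p f + gnpExp n p g := by
  simp [gnpExp, mul_add, Finset.sum_add_distrib]

lemma gnpExp_mul_const (n : ℕ) (p : ℝ) (f : SimpleGraph (Fin n) → ℝ) (a : ℝ) :
    gnpExp n p (fun G => f G * a) = gnpExp n p f * a := by
  simp [gnpExp, Finset.sum_mul, mul_assoc]

lemma gnpExp_sum {ι : Type*} (n : ℕ) (p : ℝ) (s : Finset ι) (f : ι → SimpleGraph (Fin n) → ℝ) :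
    gnpExp n p (fun G => ∑ j ∈ s, f j G) = ∑ j ∈ s, gnpExp n p (f j) := by
  simp only [gnpExp, Finset.mul_sum]
  exact Finset.sum_comm

lemma gnpProb_eq_gnpExp (n : ℕ) (p : ℝ) (A : Set (SimpleGraph (Fin n))) :
    gnpProb n p A = gnpExp n p (A.indicator 1) := by
  classical
  simp [gnpProb, gnpExp, tsum_fintype, Set.indicator_apply]

lemma gnpWeight_sup_edge {n : ℕ} (p : ℝ) {G : SimpleGraph (Fin n)} {a b : Fin n} (hab : a ≠ b)
    (hG : ¬ G.Adj a b) :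
    (1 - p) * gnpWeight n p (G ⊔ SimpleGraph.edge a b) = p * gnpWeight n p G := by
  classical
  have hcard : Nat.card (G ⊔ SimpleGraph.edge a b).edgeSet = Nat.card G.edgeSet + 1 := by
    simp only [Nat.card_eq_fintype_card, SimpleGraph.card_edgeSet]
    exact SimpleGraph.card_edgeFinset_sup_edge G hG hab
  have hle : Nat.card (G ⊔ SimpleGraph.edge a b).edgeSet ≤ n.choose 2 := by
    rw [Nat.card_eq_fintype_card, SimpleGraph.card_edgeSet]
    simpa using (SimpleGraph.card_edgeFinset_le_card_choose_two
      (G := G ⊔ SimpleGraph.edge a b))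
  obtain ⟨k, hk⟩ : ∃ k, n.choose 2 = Nat.card G.edgeSet + 1 + k :=
    Nat.exists_eq_add_of_le (hcard ▸ hle)
  rw [gnpWeight, gnpWeight, hcard, hk, Nat.add_sub_cancel_left,
    show Nat.card G.edgeSet + 1 + k - Nat.card G.edgeSet = k + 1 by omega]
  ring

open scoped Classical in
lemma gnpExp_not_adj {n : ℕ} {p : ℝ} {a b : Fin n} (hab : a ≠ b) {h : SimpleGraph (Fin n) → ℝ}
    (hh : IgnoresEdges {s(a, b)} h) :
    gnpExp n p (fun G => h G * if G.Adj a b then 0 else 1) = gnpExp n p h * (1 - p) := by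
  have hsplit := Finset.sum_filter_add_sum_filter_not (Finset.univ : Finset (SimpleGraph (Fin n)))
    (fun G => G.Adj a b) (fun G => gnpWeight n p G * h G)
  have hleft : gnpExp n p (fun G => h G * if G.Adj a b then 0 else 1)
      = ∑ G with ¬ G.Adj a b, gnpWeight n p G * h G := by
    rw [gnpExp, Finset.sum_filter]
    refine Finset.sum_congr rfl fun G _ => ?_
    by_cases hG : G.Adj a b <;> simp [hG]
  have hbij : ∑ G with ¬ G.Adj a b, p * (gnpWeight n p G * h G)
      = ∑ G with G.Adj a b, (1 - p) * (gnpWeight n p G * h G) := by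
    refine Finset.sum_bij' (fun G _ => G ⊔ SimpleGraph.edge a b)
      (fun G _ => G.deleteEdges {s(a, b)}) ?_ ?_ ?_ ?_ ?_
    · intro G _
      simp [SimpleGraph.edge_adj, hab]
    · intro G _
      simp
    · intro G hG
      have hG' : ¬ G.Adj a b := by simpa using hG
      ext x y
      simp only [SimpleGraph.deleteEdges_adj, SimpleGraph.sup_adj, SimpleGraph.adj_edge,
        Set.mem_singleton_iff]
      constructor
      · rintro ⟨h1 | h1, h2⟩
        · exact h1
        · exact absurd h1.1.symm h2
      · intro h1
        refine ⟨Or.inl h1, fun h2 => hG' ?_⟩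
        rw [← SimpleGraph.mem_edgeSet, ← h2]
        exact h1
    · intro G hG
      have hG' : G.Adj a b := by simpa using hG
      ext x y
      simp only [SimpleGraph.deleteEdges_adj, SimpleGraph.sup_adj, SimpleGraph.adj_edge,
        Set.mem_singleton_iff]
      constructor
      · rintro (h1 | h1)
        · exact h1.1
        · rw [← SimpleGraph.mem_edgeSet, ← h1.1]
          exact hG'
      · intro h1
        by_cases h2 : s(x, y) = s(a, b)
        · exact Or.inr ⟨h2.symm, h1.ne⟩
        · exact Or.inl ⟨h1, h2⟩
    · intro G hG
      have hG' : ¬ G.Adj a b := by simpa using hG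
      have : h (G ⊔ SimpleGraph.edge a b) = h G := by
        refine hh _ _ fun e he => ?_
        induction e with | _ x y
        simp only [SimpleGraph.mem_edgeSet, SimpleGraph.sup_adj, SimpleGraph.adj_edge]
        constructor
        · rintro (h1 | h1)
          · exact h1
          · exact absurd h1.1.symm he
        · exact Or.inl
      rw [this, ← mul_assoc, ← mul_assoc, gnpWeight_sup_edge p hab hG']
  rw [← Finset.mul_sum, ← Finset.mul_sum] at hbij
  rw [hleft]
  change _ = (∑ G, gnpWeight n p G * h G) * (1 - p)
  rw [← hsplit]
  linear_combination hbij

open scoped Classical in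
lemma gnpExp_no_edge {n : ℕ} {p : ℝ} (D : Finset (Sym2 (Fin n))) (hD : ∀ e ∈ D, ¬ e.IsDiag)
    {h : SimpleGraph (Fin n) → ℝ} (hh : IgnoresEdges (D : Set (Sym2 (Fin n))) h) :
    gnpExp n p (fun G => h G * if ∀ e ∈ D, e ∉ G.edgeSet then 1 else 0)
      = gnpExp n p h * (1 - p) ^ D.card := by
  induction D using Finset.induction_on generalizing h with
  | empty => simp
  | insert e D he ih =>
    induction e with | _ a b
    have hab : a ≠ b := by simpa using hD s(a, b) (Finset.mem_insert_self _ _)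
    rw [Finset.card_insert_of_notMem he, pow_succ, ← mul_assoc,
      ← ih (fun e he => hD e (Finset.mem_insert_of_mem he)) (hh.mono (by simp)),
      ← gnpExp_not_adj hab]
    · congr 1
      funext G
      by_cases hG : G.Adj a b <;> simp [hG]
    · refine (hh.mono (by simp)).mul fun G G' hG => ?_
      have : ∀ e ∈ D, (e ∈ G.edgeSet ↔ e ∈ G'.edgeSet) := fun e he' => hG e fun h' => he (by
        rw [Set.mem_singleton_iff] at h'
        exact h' ▸ he')
      have : (∀ e ∈ D, e ∉ G.edgeSet) ↔ ∀ e ∈ D, e ∉ G'.edgeSet :=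
        forall₂_congr fun e he' => not_congr (this e he')
      simp only [this]

lemma gnpExp_one (n : ℕ) (p : ℝ) : gnpExp n p (fun _ => 1) = 1 := by
  classical
  by_cases hp : p = 1
  · subst hp
    have hb : (⊤ : SimpleGraph (Fin n)).edgeFinset.card = n.choose 2 := by
      simpa using SimpleGraph.card_edgeFinset_top_eq_card_choose_two (V := Fin n)
    rw [gnpExp, Finset.sum_eq_single (⊤ : SimpleGraph (Fin n))]
    · simp only [gnpWeight, Nat.card_eq_fintype_card, SimpleGraph.card_edgeSet, hb]
      simp
    · intro G _ hG
      have hlt : G.edgeFinset.card < n.choose 2 := by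
        rw [← hb]
        exact Finset.card_lt_card (SimpleGraph.edgeFinset_ssubset_edgeFinset.2 (lt_top_iff_ne_top.2 hG))
      simp only [gnpWeight, Nat.card_eq_fintype_card, SimpleGraph.card_edgeSet]
      rw [sub_self, zero_pow (by omega)]
      simp
    · simp
  · have hb : (⊤ : SimpleGraph (Fin n)).edgeFinset.card = n.choose 2 := by
      simpa using SimpleGraph.card_edgeFinset_top_eq_card_choose_two (V := Fin n)
    have h := gnpExp_no_edge (p := p) (⊤ : SimpleGraph (Fin n)).edgeFinset
      (fun e he => SimpleGraph.not_isDiag_of_mem_edgeFinset he) (h := fun _ => 1) (fun _ _ _ => rfl)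
    have hbot : ∀ G : SimpleGraph (Fin n),
        (∀ e ∈ (⊤ : SimpleGraph (Fin n)).edgeFinset, e ∉ G.edgeSet) ↔ G = ⊥ := by
      intro G
      constructor
      · intro hG
        ext x y
        simp only [SimpleGraph.bot_adj, iff_false]
        intro hxy
        exact hG s(x, y) (by simpa using hxy.ne) hxy
      · rintro rfl
        simp
    simp only [hbot] at h
    rw [hb] at h
    have h2 : gnpExp n p (fun G => 1 * if G = ⊥ then 1 else 0) = (1 - p) ^ n.choose 2 := by
      rw [gnpExp, Finset.sum_eq_single (⊥ : SimpleGraph (Fin n))]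
      · simp [gnpWeight]
      · intro G _ hG
        simp [hG]
      · simp
    rw [h2] at h
    have : (1 - p) ^ n.choose 2 ≠ 0 := pow_ne_zero _ (sub_ne_zero.2 (Ne.symm hp))
    field_simp at h
    linarith

lemma gnpProb_mono {n : ℕ} {p : ℝ} (hp : 0 ≤ p ∧ p ≤ 1) {A B : Set (SimpleGraph (Fin n))}
    (h : A ⊆ B) : gnpProb n p A ≤ gnpProb n p B := by
  rw [gnpProb_eq_gnpExp, gnpProb_eq_gnpExp]
  exact gnpExp_mono hp fun G => Set.indicator_le_indicator_of_subset h (by simp) G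

lemma gnpProb_add_compl (n : ℕ) (p : ℝ) (A : Set (SimpleGraph (Fin n))) :
    gnpProb n p A + gnpProb n p Aᶜ = 1 := by
  rw [gnpProb_eq_gnpExp, gnpProb_eq_gnpExp, ← gnpExp_add, ← gnpExp_one n p]
  congr 1
  funext G
  exact congrFun (Set.indicator_self_add_compl A 1) G

lemma gnpProb_nonneg {n : ℕ} {p : ℝ} (hp : 0 ≤ p ∧ p ≤ 1) (A : Set (SimpleGraph (Fin n))) :
    0 ≤ gnpProb n p A := by
  rw [gnpProb_eq_gnpExp]
  exact gnpExp_nonneg hp fun G => Set.indicator_nonneg (by simp) G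

lemma gnpProb_le_gnpExp {n : ℕ} {p : ℝ} (hp : 0 ≤ p ∧ p ≤ 1) {A : Set (SimpleGraph (Fin n))}
    {f : SimpleGraph (Fin n) → ℝ} (hf : ∀ G, 0 ≤ f G) (h : ∀ G ∈ A, 1 ≤ f G) :
    gnpProb n p A ≤ gnpExp n p f := by
  rw [gnpProb_eq_gnpExp]
  exact gnpExp_mono hp fun G => Set.indicator_le' (fun G hG => h G hG) (fun G _ => hf G) G

lemma gnpProb_union_le {n : ℕ} {p : ℝ} (hp : 0 ≤ p ∧ p ≤ 1) (A B : Set (SimpleGraph (Fin n))) :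
    gnpProb n p (A ∪ B) ≤ gnpProb n p A + gnpProb n p B := by
  rw [gnpProb_eq_gnpExp n p A, gnpProb_eq_gnpExp n p B, ← gnpExp_add]
  refine gnpProb_le_gnpExp hp
    (fun G => add_nonneg (Set.indicator_nonneg (by simp) G) (Set.indicator_nonneg (by simp) G)) ?_
  classical
  rintro G (hG | hG)
  · simp only [Set.indicator_of_mem hG, Pi.one_apply, le_add_iff_nonneg_right]
    exact Set.indicator_nonneg (by simp) G
  · simp only [Set.indicator_of_mem hG, Pi.one_apply, le_add_iff_nonneg_left]
    exact Set.indicator_nonneg (by simp) G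

lemma gnpProb_exists_le {ι : Type*} {n : ℕ} {p : ℝ} (hp : 0 ≤ p ∧ p ≤ 1) (s : Finset ι)
    (A : ι → Set (SimpleGraph (Fin n))) :
    gnpProb n p {G | ∃ j ∈ s, G ∈ A j} ≤ ∑ j ∈ s, gnpProb n p (A j) := by
  simp only [gnpProb_eq_gnpExp n p (A _)]
  rw [← gnpExp_sum]
  have h0 : ∀ j G, 0 ≤ (A j).indicator (1 : SimpleGraph (Fin n) → ℝ) G :=
    fun j G => Set.indicator_nonneg (by simp) G
  refine gnpProb_le_gnpExp hp (fun G => Finset.sum_nonneg fun j _ => h0 j G) ?_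
  rintro G ⟨j, hj, hG⟩
  refine le_trans ?_ (Finset.single_le_sum (fun j _ => h0 j G) hj)
  simp [Set.indicator_of_mem hG]

open scoped Classical in
lemma gnpExp_not_adj_set {n : ℕ} {p : ℝ} {v : Fin n} {S : Finset (Fin n)} (hv : v ∉ S)
    {h : SimpleGraph (Fin n) → ℝ} (hh : IgnoresEdges (crossing {v} S) h) :
    gnpExp n p (fun G => h G * if ∀ u ∈ S, ¬ G.Adj v u then 1 else 0)
      = gnpExp n p h * (1 - p) ^ S.card := by
  have hinj : Set.InjOn (fun u => s(v, u)) (S : Set (Fin n)) := fun x _ y _ hxy =>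
    Sym2.congr_right.1 hxy
  rw [← Finset.card_image_of_injOn hinj, ← gnpExp_no_edge]
  · simp
  · intro e he
    obtain ⟨u, hu, rfl⟩ := Finset.mem_image.1 he
    rw [Sym2.mk_isDiag_iff]
    rintro rfl
    exact hv hu
  · refine hh.mono fun e he => ?_
    obtain ⟨u, hu, rfl⟩ := Finset.mem_image.1 (Finset.mem_coe.1 he)
    exact ⟨v, by simp, u, hu, rfl⟩

open scoped Classical in
lemma gnpExp_prod_not_adj {n : ℕ} {p : ℝ} (a b : ℝ) {W S : Finset (Fin n)} (hWS : Disjoint W S)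
    {h : SimpleGraph (Fin n) → ℝ} (hh : IgnoresEdges (crossing W S) h) :
    gnpExp n p (fun G => h G * ∏ v ∈ W, if ∀ u ∈ S, ¬ G.Adj v u then a else b)
      = gnpExp n p h * ((1 - p) ^ S.card * a + (1 - (1 - p) ^ S.card) * b) ^ W.card := by
  induction W using Finset.induction_on with
  | empty => simp
  | insert w W hw ih =>
    have hsub : crossing W S ⊆ crossing (insert w W) S := by
      rintro e ⟨v, hv, u, hu, rfl⟩
      exact ⟨v, Finset.mem_insert_of_mem hv, u, hu, rfl⟩
    have hsub' : crossing {w} S ⊆ crossing (insert w W) S := by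
      rintro e ⟨v, hv, u, hu, rfl⟩
      rw [Finset.mem_singleton] at hv
      exact ⟨v, by simp [hv], u, hu, rfl⟩
    have hwS : w ∉ S := Finset.disjoint_left.1 hWS (Finset.mem_insert_self _ _)
    have hWS' : Disjoint W S := hWS.mono_left (Finset.subset_insert _ _)
    have hH : IgnoresEdges (crossing {w} S)
        (fun G => h G * ∏ v ∈ W, if ∀ u ∈ S, ¬ G.Adj v u then a else b) := by
      refine (hh.mono hsub').mul fun G G' hG => Finset.prod_congr rfl fun v hv => ?_
      have : (∀ u ∈ S, ¬ G.Adj v u) ↔ ∀ u ∈ S, ¬ G'.Adj v u := by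
        refine forall₂_congr fun u hu => not_congr (hG s(v, u) ?_)
        rintro ⟨w', hw', u', hu', he⟩
        rw [Finset.mem_singleton] at hw'
        subst hw'
        rcases Sym2.eq_iff.1 he with ⟨h1, _⟩ | ⟨h1, _⟩
        · exact hw (h1 ▸ hv)
        · exact Finset.disjoint_left.1 hWS' hv (h1 ▸ hu')
      simp only [this]
    rw [Finset.card_insert_of_notMem hw, pow_succ, ← mul_assoc,
      ← ih hWS' (hh.mono hsub), mul_add, ← mul_assoc, ← gnpExp_not_adj_set hwS hH, sub_mul,
      mul_sub, one_mul, ← mul_assoc, ← gnpExp_not_adj_set hwS hH]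
    simp only [← gnpExp_mul_const]
    rw [← add_sub_assoc, eq_sub_iff_add_eq, ← gnpExp_add, ← gnpExp_add]
    congr 1
    funext G
    rw [Finset.prod_insert hw]
    split_ifs <;> ring

lemma exp_card_nonNbrs {n : ℕ} (G : SimpleGraph (Fin n)) (W S : Finset (Fin n)) (t : ℝ) :
    open scoped Classical in
    Real.exp (t * (nonNbrs G W S).card)
      = ∏ v ∈ W, if ∀ u ∈ S, ¬ G.Adj v u then Real.exp t else 1 := by
  classical
  rw [Finset.prod_ite, Finset.prod_const, Finset.prod_const_one, mul_one, mul_comm, Real.exp_nat_mul]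
  simp only [nonNbrs]
  congr!

lemma exp_card_nbrs {n : ℕ} (G : SimpleGraph (Fin n)) (W S : Finset (Fin n)) (t : ℝ) :
    open scoped Classical in
    Real.exp (t * (nbrs G W S).card)
      = ∏ v ∈ W, if ∀ u ∈ S, ¬ G.Adj v u then 1 else Real.exp t := by
  classical
  rw [Finset.prod_ite, Finset.prod_const_one, Finset.prod_const, one_mul, mul_comm, Real.exp_nat_mul]
  simp only [nbrs, not_forall, not_not, exists_prop]
  congr!

lemma gnpExp_exp_nonNbrs_le {n : ℕ} {p : ℝ} (hp : 0 ≤ p ∧ p ≤ 1) (t : ℝ) {W S : Finset (Fin n)}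
    (hWS : Disjoint W S) {h : SimpleGraph (Fin n) → ℝ} (h0 : ∀ G, 0 ≤ h G)
    (hh : IgnoresEdges (crossing W S) h) :
    gnpExp n p (fun G => h G * Real.exp (t * (nonNbrs G W S).card))
      ≤ gnpExp n p h * Real.exp (W.card * ((1 - p) ^ S.card * (Real.exp t - 1))) := by
  simp only [exp_card_nonNbrs]
  rw [gnpExp_prod_not_adj _ _ hWS hh, Real.exp_nat_mul]
  have hq0 : 0 ≤ (1 - p) ^ S.card := pow_nonneg (by linarith [hp.2]) _
  have hq1 : (1 - p) ^ S.card ≤ 1 := pow_le_one₀ (by linarith [hp.2]) (by linarith [hp.1])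
  refine mul_le_mul_of_nonneg_left (pow_le_pow_left₀ ?_ ?_ _) (gnpExp_nonneg hp h0)
  · have := mul_nonneg hq0 (Real.exp_pos t).le
    linarith
  · linarith [Real.add_one_le_exp ((1 - p) ^ S.card * (Real.exp t - 1))]

lemma gnpExp_exp_nbrs_le {n : ℕ} {p : ℝ} (hp : 0 ≤ p ∧ p ≤ 1) (t : ℝ) {W S : Finset (Fin n)}
    (hWS : Disjoint W S) :
    gnpExp n p (fun G => Real.exp (t * (nbrs G W S).card))
      ≤ Real.exp (W.card * ((1 - (1 - p) ^ S.card) * (Real.exp t - 1))) := by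
  have key := gnpExp_prod_not_adj (p := p) 1 (Real.exp t) hWS (h := fun _ => 1) (fun _ _ _ => rfl)
  simp only [one_mul, gnpExp_one, ← exp_card_nbrs] at key
  rw [key, Real.exp_nat_mul]
  have hq0 : 0 ≤ (1 - p) ^ S.card := pow_nonneg (by linarith [hp.2]) _
  have hq1 : (1 - p) ^ S.card ≤ 1 := pow_le_one₀ (by linarith [hp.2]) (by linarith [hp.1])
  refine pow_le_pow_left₀ ?_ ?_ _
  · have := mul_nonneg (sub_nonneg.2 hq1) (Real.exp_pos t).le
    linarith
  · linarith [Real.add_one_le_exp ((1 - (1 - p) ^ S.card) * (Real.exp t - 1))]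

open scoped Classical in
/-- The vertices reached from `R` in `k` exploration rounds: none for `k = 0`, and those within
distance `k - 1` of `R` for `k ≥ 1`. -/
noncomputable def reach {V : Type*} [Fintype V] (G : SimpleGraph V) (R : Finset V) :
    ℕ → Finset V
  | 0 => ∅
  | k + 1 => {v | v ∈ R ∨ v ∈ reach G R k ∨ ∃ u ∈ reach G R k, G.Adj v u}

section Reach

variable {V : Type*} [Fintype V] (G : SimpleGraph V) (R : Finset V)

lemma mem_reach_succ {k : ℕ} {v : V} :
    v ∈ reach G R (k + 1) ↔ v ∈ R ∨ v ∈ reach G R k ∨ ∃ u ∈ reach G R k, G.Adj v u := by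
  simp [reach]

lemma reach_subset_succ (k : ℕ) : reach G R k ⊆ reach G R (k + 1) :=
  fun _ hv => (mem_reach_succ G R).2 (Or.inr (Or.inl hv))

lemma subset_reach_succ (k : ℕ) : R ⊆ reach G R (k + 1) :=
  fun _ hv => (mem_reach_succ G R).2 (Or.inl hv)

lemma reach_mono {k l : ℕ} (h : k ≤ l) : reach G R k ⊆ reach G R l :=
  monotone_nat_of_le_succ (f := reach G R) (reach_subset_succ G R) h

lemma reach_one : reach G R 1 = R := by
  ext v
  rw [mem_reach_succ]
  simp [reach]

lemma mem_reach_of_walk {k : ℕ} {u v : V} (hu : u ∈ R) (w : G.Walk u v) (hw : w.length ≤ k) :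
    v ∈ reach G R (k + 1) := by
  suffices h : ∀ (l : ℕ) {a b : V} (w : G.Walk a b) (j : ℕ), a ∈ reach G R j → w.length ≤ l →
      b ∈ reach G R (j + l) by
    rw [add_comm]
    exact h k w 1 (subset_reach_succ G R 0 hu) hw
  intro l a b w
  induction w generalizing l with
  | nil => exact fun j ha _ => reach_mono G R (Nat.le_add_right _ _) ha
  | cons hadj w ih =>
    intro j ha hl
    rw [SimpleGraph.Walk.length_cons] at hl
    have := ih (l - 1) (j + 1)
      ((mem_reach_succ G R).2 (Or.inr (Or.inr ⟨_, ha, hadj.symm⟩))) (by omega)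
    rwa [show j + 1 + (l - 1) = j + l by omega] at this

lemma exists_walk_of_mem_reach {k : ℕ} {v : V} (hv : v ∈ reach G R (k + 1)) :
    ∃ u ∈ R, ∃ w : G.Walk u v, w.length ≤ k := by
  induction k generalizing v with
  | zero =>
    rw [reach_one] at hv
    exact ⟨v, hv, .nil, le_rfl⟩
  | succ k ih =>
    rcases (mem_reach_succ G R).1 hv with hv | hv | ⟨x, hx, hadj⟩
    · exact ⟨v, hv, .nil, by simp⟩
    · obtain ⟨u, hu, w, hw⟩ := ih hv
      exact ⟨u, hu, w, by omega⟩
    · obtain ⟨u, hu, w, hw⟩ := ih hx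
      exact ⟨u, hu, w.concat hadj.symm, by simp; omega⟩

lemma reach_congr {G G' : SimpleGraph V} {R : Finset V} {k : ℕ}
    (h : ∀ u ∈ reach G R k, ∀ v, G.Adj v u ↔ G'.Adj v u) {j : ℕ} (hj : j ≤ k + 1) :
    reach G R j = reach G' R j := by
  induction j with
  | zero => rfl
  | succ j ih =>
    have hjk := ih (by omega)
    ext v
    rw [mem_reach_succ, mem_reach_succ, ← hjk]
    refine or_congr_right (or_congr_right (exists_congr fun u => and_congr_right fun hu => ?_))
    exact h u (reach_mono G R (by omega) hu) v

lemma dist_eq_of_mem_reach {k : ℕ} {u v : V} (hu : u ∈ R) (hv : v ∉ reach G R (k + 1))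
    (hv' : v ∈ reach G {u} (k + 2)) : G.dist u v = k + 1 := by
  obtain ⟨u', hu', w, hw⟩ := exists_walk_of_mem_reach G {u} hv'
  obtain rfl := Finset.mem_singleton.1 hu'
  refine le_antisymm ((SimpleGraph.dist_le w).trans hw) ?_
  by_contra hlt
  obtain ⟨w', hw'⟩ := w.reachable.exists_walk_length_eq_dist
  exact hv (mem_reach_of_walk G R hu w' (by omega))

end Reach

lemma ignoresEdges_reach {n : ℕ} (R T' T : Finset (Fin n)) (k : ℕ) (hT : T' ⊆ T) :
    open scoped Classical in
    IgnoresEdges (crossing (Finset.univ \ T) (T \ T'))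
      (fun G => if reach G R k = T' ∧ reach G R (k + 1) = T then (1 : ℝ) else 0) := by
  classical
  have key : ∀ G G' : SimpleGraph (Fin n),
      (∀ e, e ∉ crossing (Finset.univ \ T) (T \ T') → (e ∈ G.edgeSet ↔ e ∈ G'.edgeSet)) →
      reach G R k = T' ∧ reach G R (k + 1) = T → reach G' R k = T' ∧ reach G' R (k + 1) = T := by
    rintro G G' hG ⟨rfl, rfl⟩
    have hadj : ∀ u ∈ reach G R k, ∀ v, G.Adj v u ↔ G'.Adj v u := by
      intro u hu v
      refine hG s(v, u) ?_
      rintro ⟨x, hx, y, hy, he⟩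
      simp only [Finset.mem_sdiff, Finset.mem_univ, true_and] at hx hy
      rcases Sym2.eq_iff.1 he with ⟨_, h1⟩ | ⟨_, h1⟩
      · exact hy.2 (h1 ▸ hu)
      · exact hx (h1 ▸ reach_subset_succ G R k hu)
    exact ⟨(reach_congr hadj (by omega)).symm, (reach_congr hadj le_rfl).symm⟩
  intro G G' hG
  have : (reach G R k = T' ∧ reach G R (k + 1) = T) ↔
      (reach G' R k = T' ∧ reach G' R (k + 1) = T) :=
    ⟨key G G' hG, key G' G fun e he => (hG e he).symm⟩
  simp only [this]

/-- If, after exposing `k + 1` rounds of the exploration from `R`, the conditional expectation of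
`g` given the vertices reached is at most `b`, then so is its expectation. -/
lemma gnpExp_reach_le {n : ℕ} {p : ℝ} (R : Finset (Fin n)) (k : ℕ)
    (g : Finset (Fin n) → Finset (Fin n) → SimpleGraph (Fin n) → ℝ) {b : ℝ}
    (hg : ∀ T' T : Finset (Fin n), T' ⊆ T → ∀ h : SimpleGraph (Fin n) → ℝ, (∀ G, 0 ≤ h G) →
      IgnoresEdges (crossing (Finset.univ \ T) (T \ T')) h →
      gnpExp n p (fun G => h G * g T' T G) ≤ gnpExp n p h * b) :
    gnpExp n p (fun G => g (reach G R k) (reach G R (k + 1)) G) ≤ b := by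
  classical
  have hsum : ∀ f : Finset (Fin n) → Finset (Fin n) → SimpleGraph (Fin n) → ℝ,
      (gnpExp n p fun G => f (reach G R k) (reach G R (k + 1)) G) = ∑ T', ∑ T,
        gnpExp n p (fun G =>
          (if reach G R k = T' ∧ reach G R (k + 1) = T then (1 : ℝ) else 0) * f T' T G) := by
    intro f
    simp only [← gnpExp_sum]
    congr 1
    funext G
    simp [ite_and]
  rw [hsum]
  refine (Finset.sum_le_sum fun T' _ => Finset.sum_le_sum fun T _ => ?_).trans_eq
    (b := ∑ T', ∑ T, gnpExp n p (fun G =>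
      (if reach G R k = T' ∧ reach G R (k + 1) = T then (1 : ℝ) else 0) * b)) ?_
  · rw [gnpExp_mul_const]
    by_cases hT : T' ⊆ T
    · exact hg T' T hT _ (fun G => by positivity) (ignoresEdges_reach R T' T k hT)
    · have : ∀ G : SimpleGraph (Fin n), ¬ (reach G R k = T' ∧ reach G R (k + 1) = T) := by
        rintro G ⟨rfl, rfl⟩
        exact hT (reach_subset_succ G R k)
      simp [this, gnpExp]
  · rw [← hsum (fun _ _ _ => b)]
    have := gnpExp_mul_const n p (fun _ => 1) b
    simpa [gnpExp_one] using this

lemma gnpProb_nbrs_le {n : ℕ} {p : ℝ} (hp : 0 ≤ p ∧ p ≤ 1) (t m : ℝ) {W S : Finset (Fin n)}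
    (hWS : Disjoint W S) :
    gnpProb n p {G | t * m ≤ t * (nbrs G W S).card}
      ≤ Real.exp (W.card * ((1 - (1 - p) ^ S.card) * (Real.exp t - 1)) - t * m) := by
  have h := gnpProb_le_gnpExp hp (A := {G | t * m ≤ t * (nbrs G W S).card})
    (f := fun G => Real.exp (t * (nbrs G W S).card) * Real.exp (-(t * m))) (fun G => by positivity)
    (fun G hG => by
      rw [← Real.exp_add]
      exact Real.one_le_exp (by linarith [show t * m ≤ t * (nbrs G W S).card from hG]))
  rw [gnpExp_mul_const] at h
  rw [sub_eq_add_neg, Real.exp_add]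
  exact h.trans (mul_le_mul_of_nonneg_right (gnpExp_exp_nbrs_le hp t hWS) (Real.exp_pos _).le)

lemma exp_sub_one_le {x : ℝ} (hx : |x| ≤ 1) : Real.exp x - 1 ≤ x + x ^ 2 := by
  linarith [(abs_le.1 (Real.abs_exp_sub_one_sub_id_le hx)).2]

lemma gnpProb_exists_degree_le {n : ℕ} {p d κ : ℝ} (hp : 0 ≤ p ∧ p ≤ 1)
    (hd : d = p * ((n : ℝ) - 1)) (hd0 : 0 ≤ d) (hκ : 0 < κ) (hκ1 : κ ≤ 1) :
    gnpProb n p {G | ∃ v ∈ Finset.univ, G ∈ {G : SimpleGraph (Fin n) |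
        (1 + κ) * d ≤ (nbrs G (Finset.univ \ {v}) {v}).card}}
      ≤ n * Real.exp (-(κ ^ 2 * d / 4)) := by
  refine (gnpProb_exists_le hp _ _).trans ?_
  rw [show (n : ℝ) * Real.exp (-(κ ^ 2 * d / 4))
    = ∑ _v : Fin n, Real.exp (-(κ ^ 2 * d / 4)) by simp]
  refine Finset.sum_le_sum fun v _ => ?_
  have h := gnpProb_nbrs_le hp (κ / 2) ((1 + κ) * d) (W := Finset.univ \ {v}) (S := {v})
    Finset.sdiff_disjoint
  refine (gnpProb_mono hp fun G hG => ?_).trans (h.trans (Real.exp_le_exp.2 ?_))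
  · exact mul_le_mul_of_nonneg_left (show (1 + κ) * d ≤ _ from hG) (by linarith)
  · have hn : ((Finset.univ \ {v} : Finset (Fin n)).card : ℝ) = n - 1 := by
      have := v.pos
      rw [Finset.card_sdiff_of_subset (by simp), Finset.card_univ, Fintype.card_fin,
        Finset.card_singleton, Nat.cast_sub (by omega), Nat.cast_one]
    rw [hn, Finset.card_singleton, pow_one, sub_sub_cancel, ← mul_assoc,
      show ((n : ℝ) - 1) * p = d by rw [hd]; ring]
    have := mul_le_mul_of_nonneg_left
      (exp_sub_one_le (x := κ / 2) (by rw [abs_of_pos (by positivity)]; linarith)) hd0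
    nlinarith

lemma sum_inv_pow_card_le (n : ℕ) :
    ∑ S : Finset (Fin n), ((n : ℝ)⁻¹) ^ S.card ≤ Real.exp 1 := by
  have h := Fintype.sum_pow_mul_eq_add_pow (Fin n) ((n : ℝ)⁻¹) 1
  simp only [one_pow, mul_one, Fintype.card_fin] at h
  rw [h]
  refine (pow_le_pow_left₀ (by positivity) (Real.add_one_le_exp _) n).trans ?_
  rw [← Real.exp_nat_mul]
  exact Real.exp_le_exp.2 mul_inv_le_one

lemma one_sub_pow_le {p κ : ℝ} (hp : 0 ≤ p ∧ p ≤ 1) (hκ : κ ≤ 1) {s : ℕ} (hs : p * s ≤ κ) :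
    (1 - κ) * (p * s) ≤ 1 - (1 - p) ^ s := by
  have hps : 0 ≤ p * s := mul_nonneg hp.1 (Nat.cast_nonneg s)
  have h1 : (1 - p) ^ s ≤ Real.exp (-(p * s)) := by
    rw [show -(p * s) = s * (-p) by ring, Real.exp_nat_mul]
    exact pow_le_pow_left₀ (by linarith [hp.2]) (by linarith [Real.add_one_le_exp (-p)]) _
  have h2 := exp_sub_one_le (x := -(p * s)) (by rw [abs_neg, abs_of_nonneg hps]; linarith)
  nlinarith

lemma gnpProb_not_expanding_le {n : ℕ} {p d κ : ℝ} (hn : 1 ≤ n) (hp : 0 ≤ p ∧ p ≤ 1)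
    (hd : d = p * ((n : ℝ) - 1)) (hd0 : 0 ≤ d) (hκ : 0 < κ) (hκ1 : κ ≤ 1 / 4)
    (hdn : 3 * Real.log n ≤ κ ^ 2 * d) :
    gnpProb n p {G | ∃ S ∈ (Finset.univ : Finset (Finset (Fin n))),
      G ∈ {G : SimpleGraph (Fin n) | S.Nonempty ∧ p * S.card ≤ κ ∧ (S.card : ℝ) ≤ κ * n ∧
        ((nbrs G (Finset.univ \ S) S).card : ℝ) ≤ (1 - 4 * κ) * d * S.card}}
      ≤ Real.exp 1 * ((n : ℝ)⁻¹) ^ 2 := by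
  have hn0 : (0 : ℝ) < n := by exact_mod_cast hn
  refine (gnpProb_exists_le hp _ _).trans
    (le_trans ?_ (mul_le_mul_of_nonneg_right (sum_inv_pow_card_le n) (by positivity)))
  rw [Finset.sum_mul]
  refine Finset.sum_le_sum fun S _ => ?_
  by_cases hS : S.Nonempty ∧ p * S.card ≤ κ ∧ (S.card : ℝ) ≤ κ * n
  swap
  · have : {G : SimpleGraph (Fin n) | S.Nonempty ∧ p * S.card ≤ κ ∧ (S.card : ℝ) ≤ κ * n ∧
        ((nbrs G (Finset.univ \ S) S).card : ℝ) ≤ (1 - 4 * κ) * d * S.card} = ∅ := by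
      ext G
      simp only [Set.mem_ofPred_eq, Set.mem_empty_iff_false, iff_false]
      tauto
    rw [this]
    simp only [gnpProb, Set.indicator_empty, tsum_zero]
    positivity
  obtain ⟨hne, hpS, hSn⟩ := hS
  have h := gnpProb_nbrs_le hp (-κ) ((1 - 4 * κ) * d * S.card) (W := Finset.univ \ S) (S := S)
    Finset.sdiff_disjoint
  refine (gnpProb_mono hp fun G hG => ?_).trans (h.trans ?_)
  · exact mul_le_mul_of_nonpos_left hG.2.2.2 (by linarith)
  · have hs1 : (1 : ℝ) ≤ S.card := by exact_mod_cast hne.card_pos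
    have hW : ((Finset.univ \ S : Finset (Fin n)).card : ℝ) = n - S.card := by
      rw [Finset.card_sdiff_of_subset (by simp), Finset.card_univ, Fintype.card_fin,
        Nat.cast_sub (by simpa using Finset.card_le_univ S)]
    have hrhs : ((n : ℝ)⁻¹) ^ S.card * ((n : ℝ)⁻¹) ^ 2
        = Real.exp (-((S.card + 2) * Real.log n)) := by
      rw [← pow_add, inv_pow, Real.exp_neg]
      congr 1
      rw [show ((S.card : ℝ) + 2) * Real.log n = ((S.card + 2 : ℕ) : ℝ) * Real.log n by
        push_cast; ring, Real.exp_nat_mul, Real.exp_log hn0]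
    rw [hrhs, hW]
    refine Real.exp_le_exp.2 ?_
    set s : ℝ := (S.card : ℝ)
    have hL : 0 ≤ Real.log n := Real.log_nonneg (by exact_mod_cast hn)
    have hA : (1 - κ) * (n - 1) ≤ n - s := by nlinarith
    have hB := one_sub_pow_le hp (by linarith) hpS
    have hC : (1 - κ) ^ 2 * (s * d) ≤ (n - s) * (1 - (1 - p) ^ S.card) := by
      have hn1 : (0 : ℝ) ≤ n - 1 := by
        have : (1 : ℝ) ≤ n := by exact_mod_cast hn
        linarith
      have := mul_le_mul hA hB (mul_nonneg (by linarith) (mul_nonneg hp.1 (by positivity)))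
        (by nlinarith)
      calc (1 - κ) ^ 2 * (s * d) = (1 - κ) * (n - 1) * ((1 - κ) * (p * s)) := by rw [hd]; ring
        _ ≤ _ := this
    have hsd : 0 ≤ s * d := mul_nonneg (by linarith) hd0
    have hX : 0 ≤ (n - s) * (1 - (1 - p) ^ S.card) := le_trans (by positivity) hC
    have hE := exp_sub_one_le (x := -κ) (by rw [abs_neg, abs_of_pos hκ]; linarith)
    have hE' : Real.exp (-κ) - 1 ≤ -(κ * (1 - κ)) := by linarith
    have h1 := mul_le_mul_of_nonneg_left hE' hX
    have h2 := mul_le_mul_of_nonneg_left hC (show 0 ≤ κ * (1 - κ) by nlinarith)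
    have h3 : 3 * Real.log n * s ≤ κ ^ 2 * d * s := mul_le_mul_of_nonneg_right hdn (by linarith)
    have h4 : 0 ≤ Real.log n * (s - 1) := mul_nonneg hL (by linarith)
    have h5 : κ * (1 - 3 * κ) * (s * d) ≤ κ * (1 - κ) * ((1 - κ) ^ 2 * (s * d)) := by
      have : κ * (1 - 3 * κ) ≤ κ * (1 - κ) * (1 - κ) ^ 2 := by
        have : 0 ≤ κ ^ 3 * (3 - κ) := mul_nonneg (by positivity) (by linarith)
        nlinarith
      nlinarith
    nlinarith

lemma gnpProb_large_sphere_not_mem_reach_le {n : ℕ} {p : ℝ} (hp : 0 ≤ p ∧ p ≤ 1) (k : ℕ) (t : ℝ)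
    (R : Finset (Fin n)) (v : Fin n) :
    gnpProb n p {G | t ≤ (reach G R (k + 1) \ reach G R k).card ∧ v ∉ reach G R (k + 2)}
      ≤ Real.exp (-(p * t)) := by
  classical
  refine (gnpProb_le_gnpExp hp ?_ ?_).trans (gnpExp_reach_le R k (fun T' T G =>
    if t ≤ ((T \ T').card : ℝ) ∧ v ∉ T then
      (if ∀ u ∈ T \ T', ¬ G.Adj v u then (1 : ℝ) else 0) else 0) ?_)
  · intro G
    positivity
  · rintro G ⟨hG, hv⟩
    rw [mem_reach_succ] at hv
    push Not at hv
    rw [if_pos ⟨hG, hv.2.1⟩, if_pos]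
    exact fun u hu => hv.2.2 u (Finset.mem_sdiff.1 hu).1
  · intro T' T hT h h0 hh
    by_cases hc : t ≤ ((T \ T').card : ℝ) ∧ v ∉ T
    · simp only [if_pos hc]
      rw [gnpExp_not_adj_set (fun hv => hc.2 (Finset.mem_sdiff.1 hv).1)]
      · refine mul_le_mul_of_nonneg_left ?_ (gnpExp_nonneg hp h0)
        refine (pow_le_pow_left₀ (by linarith [hp.2]) (Real.one_sub_le_exp_neg p) _).trans ?_
        rw [← Real.exp_nat_mul]
        refine Real.exp_le_exp.2 ?_
        linarith [mul_le_mul_of_nonneg_left hc.1 hp.1]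
      · refine hh.mono ?_
        rintro e ⟨w, hw, u, hu, rfl⟩
        obtain rfl := Finset.mem_singleton.1 hw
        exact ⟨w, by simp [hc.2], u, hu, rfl⟩
    · simp only [if_neg hc, mul_zero]
      have : gnpExp n p (fun _ => 0) = 0 := by simp [gnpExp]
      rw [this]
      exact mul_nonneg (gnpExp_nonneg hp h0) (Real.exp_pos _).le

open scoped Classical in
lemma gnpProb_many_not_mem_reach_le {n : ℕ} {p : ℝ} (hp : 0 ≤ p ∧ p ≤ 1) (k : ℕ) (t : ℝ) {x : ℝ}
    (hx : 0 < x) :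
    gnpProb n p {G | x ≤ (Finset.univ.filter fun v => ∃ u : Fin n,
        t ≤ (reach G {u} (k + 1) \ reach G {u} k).card ∧ v ∉ reach G {u} (k + 2)).card}
      ≤ (n : ℝ) ^ 2 * Real.exp (-(p * t)) / x := by
  set A : Fin n → Fin n → Set (SimpleGraph (Fin n)) := fun v u =>
    {G | t ≤ (reach G {u} (k + 1) \ reach G {u} k).card ∧ v ∉ reach G {u} (k + 2)}
  have h0 : ∀ v u G, 0 ≤ (A v u).indicator (1 : SimpleGraph (Fin n) → ℝ) G :=
    fun v u G => Set.indicator_nonneg (by simp) G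
  refine (gnpProb_le_gnpExp hp (f := fun G => (∑ v, ∑ u, (A v u).indicator 1 G) * x⁻¹)
    (fun G => mul_nonneg (Finset.sum_nonneg fun v _ => Finset.sum_nonneg fun u _ => h0 v u G)
      (by positivity)) ?_).trans ?_
  · intro G hG
    rw [← div_eq_mul_inv, one_le_div hx]
    refine le_trans hG ?_
    rw [Finset.card_filter, Nat.cast_sum]
    refine Finset.sum_le_sum fun v _ => ?_
    split_ifs with h
    · obtain ⟨u, hu⟩ := h
      refine le_trans ?_ (Finset.single_le_sum (fun u _ => h0 v u G) (Finset.mem_univ u))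
      have : G ∈ A v u := hu
      simp [Set.indicator_of_mem this]
    · simpa using Finset.sum_nonneg fun u _ => h0 v u G
  · rw [gnpExp_mul_const, div_eq_mul_inv]
    refine mul_le_mul_of_nonneg_right ?_ (by positivity)
    simp only [gnpExp_sum, ← gnpProb_eq_gnpExp]
    refine (Finset.sum_le_sum fun v _ => Finset.sum_le_sum fun u _ =>
      gnpProb_large_sphere_not_mem_reach_le hp k t {u} v).trans_eq ?_
    simp
    ring

lemma gnpProb_few_far_le {n : ℕ} {p y τ : ℝ} (hp : 0 ≤ p ∧ p ≤ 1) (hy : 0 ≤ y)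
    (hpy : Real.exp (-y) ≤ 1 - p) (hτ : τ ≤ n / 2) (k : ℕ) (R : Finset (Fin n)) :
    gnpProb n p {G | ((reach G R (k + 1)).card : ℝ) ≤ τ ∧
        ((Finset.univ \ reach G R (k + 2)).card : ℝ) ≤ n / 8 * Real.exp (-(y * τ))}
      ≤ Real.exp (-(n / 8 * Real.exp (-(y * τ)))) := by
  classical
  set m : ℝ := n / 8 * Real.exp (-(y * τ)) with hm
  refine (gnpProb_le_gnpExp hp ?_ ?_).trans (gnpExp_reach_le R k (fun T' T G =>
    if (T.card : ℝ) ≤ τ then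
      Real.exp (-1 * (nonNbrs G (Finset.univ \ T) (T \ T')).card) * Real.exp m else 0) ?_)
  · intro G
    positivity
  · rintro G ⟨hG, hfar⟩
    rw [if_pos hG, ← Real.exp_add]
    refine Real.one_le_exp ?_
    have hsub : nonNbrs G (Finset.univ \ reach G R (k + 1)) (reach G R (k + 1) \ reach G R k)
        ⊆ Finset.univ \ reach G R (k + 2) := by
      intro v hv
      simp only [nonNbrs, Finset.mem_filter, Finset.mem_sdiff, Finset.mem_univ, true_and] at hv ⊢
      obtain ⟨hv, hadj⟩ := hv
      rw [mem_reach_succ]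
      rintro (h | h | ⟨u, hu, h⟩)
      · exact hv (subset_reach_succ G R k h)
      · exact hv h
      · refine hadj u ⟨hu, fun hu' => hv ?_⟩ h
        exact (mem_reach_succ G R).2 (Or.inr (Or.inr ⟨u, hu', h⟩))
    have : ((nonNbrs G (Finset.univ \ reach G R (k + 1))
        (reach G R (k + 1) \ reach G R k)).card : ℝ) ≤ (Finset.univ \ reach G R (k + 2)).card := by
      exact_mod_cast Finset.card_le_card hsub
    linarith
  · intro T' T hT h h0 hh
    by_cases hc : (T.card : ℝ) ≤ τ
    · simp only [if_pos hc, ← mul_assoc]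
      rw [gnpExp_mul_const]
      have hdisj : Disjoint (Finset.univ \ T) (T \ T') :=
        Finset.disjoint_of_subset_right Finset.sdiff_subset Finset.sdiff_disjoint
      refine (mul_le_mul_of_nonneg_right (gnpExp_exp_nonNbrs_le hp (-1) hdisj h0 hh)
        (Real.exp_pos m).le).trans ?_
      rw [mul_assoc, ← Real.exp_add]
      refine mul_le_mul_of_nonneg_left (Real.exp_le_exp.2 ?_) (gnpExp_nonneg hp h0)
      have hW : ((Finset.univ \ T : Finset (Fin n)).card : ℝ) = n - T.card := by
        rw [Finset.card_sdiff_of_subset (by simp), Finset.card_univ, Fintype.card_fin,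
          Nat.cast_sub (by simpa using Finset.card_le_univ T)]
      have hq : Real.exp (-(y * τ)) ≤ (1 - p) ^ (T \ T').card := by
        refine le_trans ?_ (pow_le_pow_left₀ (Real.exp_pos _).le hpy _)
        rw [← Real.exp_nat_mul]
        refine Real.exp_le_exp.2 ?_
        have : ((T \ T').card : ℝ) ≤ τ :=
          le_trans (by exact_mod_cast Finset.card_le_card Finset.sdiff_subset) hc
        linarith [mul_le_mul_of_nonneg_left this hy]
      have h4 : 4 * m ≤ (n - T.card) * (1 - p) ^ (T \ T').card := by
        rw [hm]
        have : (n : ℝ) / 2 ≤ n - T.card := by linarith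
        have := mul_le_mul this hq (Real.exp_pos _).le (le_trans (by positivity) this)
        linarith
      have he : Real.exp (-1) - 1 ≤ -(1 / 2) := by
        have h2 : (2 : ℝ) ≤ Real.exp 1 := by linarith [Real.add_one_le_exp 1]
        have : Real.exp (-1) ≤ 2⁻¹ := by
          rw [Real.exp_neg]
          exact inv_anti₀ two_pos h2
        linarith
      have hm0 : 0 ≤ m := by positivity
      rw [hW, ← mul_assoc]
      have := mul_le_mul_of_nonneg_left he (le_trans (by positivity) h4)
      linarith
    · simp only [if_neg hc, mul_zero]
      have : gnpExp n p (fun _ => 0) = 0 := by simp [gnpExp]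
      rw [this]
      exact mul_nonneg (gnpExp_nonneg hp h0) (Real.exp_pos _).le

lemma gnpProb_exists_few_far_le {n : ℕ} {p y τ ρ : ℝ} (hn : 1 ≤ n) (hp : 0 ≤ p ∧ p ≤ 1)
    (hy : 0 ≤ y) (hpy : Real.exp (-y) ≤ 1 - p) (hτ : τ ≤ n / 2) (k : ℕ) :
    gnpProb n p {G | ∃ R ∈ (Finset.univ : Finset (Finset (Fin n))),
      G ∈ {G : SimpleGraph (Fin n) | (R.card : ℝ) ≤ ρ ∧ ((reach G R (k + 1)).card : ℝ) ≤ τ ∧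
        ((Finset.univ \ reach G R (k + 2)).card : ℝ) ≤ n / 8 * Real.exp (-(y * τ))}}
      ≤ Real.exp (1 + ρ * Real.log n - n / 8 * Real.exp (-(y * τ))) := by
  have hn0 : (0 : ℝ) < n := by exact_mod_cast hn
  have hL : 0 ≤ Real.log n := Real.log_nonneg (by exact_mod_cast hn)
  rw [show 1 + ρ * Real.log n - n / 8 * Real.exp (-(y * τ))
    = 1 + (ρ * Real.log n + -(n / 8 * Real.exp (-(y * τ)))) by ring, Real.exp_add, Real.exp_add]
  refine (gnpProb_exists_le hp _ _).trans
    (le_trans ?_ (mul_le_mul_of_nonneg_right (sum_inv_pow_card_le n) (by positivity)))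
  rw [Finset.sum_mul]
  refine Finset.sum_le_sum fun R _ => ?_
  by_cases hR : (R.card : ℝ) ≤ ρ
  · refine (gnpProb_mono hp fun G hG => hG.2).trans
      ((gnpProb_few_far_le hp hy hpy hτ k R).trans ?_)
    rw [← mul_assoc]
    refine le_mul_of_one_le_left (Real.exp_pos _).le ?_
    rw [show (n : ℝ)⁻¹ = Real.exp (-Real.log n) by rw [Real.exp_neg, Real.exp_log hn0],
      ← Real.exp_nat_mul, ← Real.exp_add]
    refine Real.one_le_exp ?_
    linarith [mul_le_mul_of_nonneg_right hR hL]
  · have : {G : SimpleGraph (Fin n) | (R.card : ℝ) ≤ ρ ∧ ((reach G R (k + 1)).card : ℝ) ≤ τ ∧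
        ((Finset.univ \ reach G R (k + 2)).card : ℝ) ≤ n / 8 * Real.exp (-(y * τ))} = ∅ := by
      ext G
      simp [hR]
    rw [this]
    simp only [gnpProb, Set.indicator_empty, tsum_zero]
    positivity

lemma card_reach_le {n : ℕ} (G : SimpleGraph (Fin n)) (R : Finset (Fin n)) {D a : ℝ}
    (hdeg : ∀ v, ((nbrs G (Finset.univ \ {v}) {v}).card : ℝ) ≤ D) (ha0 : 0 ≤ a)
    (ha : 1 + D ≤ a) (k : ℕ) : ((reach G R (k + 1)).card : ℝ) ≤ R.card * a ^ k := by
  classical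
  induction k with
  | zero => simp [reach_one]
  | succ k ih =>
    have hsub : reach G R (k + 2) ⊆ reach G R (k + 1) ∪
        (reach G R (k + 1)).biUnion fun u => nbrs G (Finset.univ \ {u}) {u} := by
      intro v hv
      rcases (mem_reach_succ G R).1 hv with h | h | ⟨u, hu, h⟩
      · exact Finset.mem_union_left _ (subset_reach_succ G R k h)
      · exact Finset.mem_union_left _ h
      · refine Finset.mem_union_right _ (Finset.mem_biUnion.2 ⟨u, hu, ?_⟩)
        simp [nbrs, h, h.ne]
    have h1 : ((reach G R (k + 2)).card : ℝ) ≤ (reach G R (k + 1)).card +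
        ∑ u ∈ reach G R (k + 1), ((nbrs G (Finset.univ \ {u}) {u}).card : ℝ) := by
      have := (Finset.card_le_card hsub).trans ((Finset.card_union_le _ _).trans
        (Nat.add_le_add_left Finset.card_biUnion_le _))
      exact_mod_cast this
    have h2 : ∑ u ∈ reach G R (k + 1), ((nbrs G (Finset.univ \ {u}) {u}).card : ℝ)
        ≤ (reach G R (k + 1)).card * D := by
      simpa using Finset.sum_le_sum fun u (_ : u ∈ reach G R (k + 1)) => hdeg u
    have h3 : ((reach G R (k + 1)).card : ℝ) * (1 + D) ≤ (reach G R (k + 1)).card * a :=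
      mul_le_mul_of_nonneg_left ha (Nat.cast_nonneg _)
    have h4 := mul_le_mul_of_nonneg_right ih ha0
    rw [pow_succ, ← mul_assoc]
    linarith

lemma pow_le_card_sphere {n : ℕ} (G : SimpleGraph (Fin n)) {p κ D a b : ℝ} (hp : 0 ≤ p)
    (hdeg : ∀ v, ((nbrs G (Finset.univ \ {v}) {v}).card : ℝ) ≤ D) (ha1 : 1 ≤ a)
    (ha : 1 + D ≤ a) (hb : 0 ≤ b)
    (hexp : ∀ S : Finset (Fin n), S.Nonempty → p * S.card ≤ κ → (S.card : ℝ) ≤ κ * n →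
      b * S.card ≤ (nbrs G (Finset.univ \ S) S).card)
    {k : ℕ} (hpa : p * a ^ k ≤ κ) (han : a ^ k ≤ κ * n) (u : Fin n) {j : ℕ} (hj : j ≤ k) :
    b ^ (j + 1) ≤ ((reach G {u} (j + 2) \ reach G {u} (j + 1)).card : ℝ) := by
  have step : ∀ j ≤ k, b * (reach G {u} (j + 1)).card
      ≤ ((reach G {u} (j + 2) \ reach G {u} (j + 1)).card : ℝ) := by
    intro j hj
    have hcard : ((reach G {u} (j + 1)).card : ℝ) ≤ a ^ k := by
      have := card_reach_le G {u} hdeg (by linarith) ha j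
      rw [Finset.card_singleton, Nat.cast_one, one_mul] at this
      exact this.trans (pow_le_pow_right₀ ha1 hj)
    refine (hexp (reach G {u} (j + 1)) ⟨u, subset_reach_succ G {u} j (by simp)⟩
      ((mul_le_mul_of_nonneg_left hcard hp).trans hpa) (hcard.trans han)).trans ?_
    norm_cast
    refine Finset.card_le_card fun v hv => ?_
    simp only [nbrs, Finset.mem_filter, Finset.mem_sdiff, Finset.mem_univ, true_and] at hv ⊢
    exact ⟨(mem_reach_succ G {u}).2 (Or.inr (Or.inr hv.2)), hv.1⟩
  induction j with
  | zero => simpa [reach_one] using step 0 hj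
  | succ j ih =>
    refine le_trans ?_ (step (j + 1) hj)
    rw [pow_succ, mul_comm]
    refine mul_le_mul_of_nonneg_left ((ih (by omega)).trans ?_) hb
    exact_mod_cast Finset.card_le_card Finset.sdiff_subset

lemma le_metricDim_of_far {n : ℕ} (G : SimpleGraph (Fin n)) {ρ m : ℝ} {k : ℕ}
    (hadj : ∀ v, ∃ w, G.Adj v w)
    (hbad : open scoped Classical in
      ((Finset.univ.filter fun v => ∃ u : Fin n, v ∉ reach G {u} (k + 2)).card : ℝ) + 1 ≤ m)
    (hfar : ∀ R : Finset (Fin n), (R.card : ℝ) ≤ ρ →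
      m < (Finset.univ \ reach G R (k + 1)).card) : ρ ≤ metricDim G := by
  classical
  have hne : {l : ℕ | ∃ R : Set (Fin n), R.Finite ∧ R.ncard = l ∧ Resolves G R}.Nonempty := by
    refine ⟨_, Set.univ, Set.finite_univ, rfl, fun v w hvw => ?_⟩
    by_contra! h
    obtain ⟨x, hx⟩ := hadj v
    have h1 := h v (Set.mem_univ v)
    have h2 := h x (Set.mem_univ x)
    rw [SimpleGraph.dist_self] at h1
    rw [SimpleGraph.dist_eq_one_iff_adj.2 hx.symm] at h2
    have hxw : G.Reachable x w := SimpleGraph.Reachable.of_dist_ne_zero (by omega)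
    exact hvw ((hx.reachable.trans hxw).dist_eq_zero_iff.1 h1.symm)
  obtain ⟨R, hR, hcard, hres⟩ := Nat.sInf_mem hne
  by_contra! hlt
  set U := Finset.univ \ reach G hR.toFinset (k + 1)
  set B := Finset.univ.filter fun v => ∃ u : Fin n, v ∉ reach G {u} (k + 2)
  have hU : m < U.card := by
    refine hfar _ (le_trans (le_of_eq ?_) hlt.le)
    rw [← Set.ncard_eq_toFinset_card R hR, hcard]
    rfl
  have hcard2 : B.card + 1 < U.card := by exact_mod_cast hbad.trans_lt hU
  have : 1 < (U \ B).card := by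
    have := Finset.le_card_sdiff B U
    omega
  obtain ⟨v, hv, w, hw, hvw⟩ := Finset.one_lt_card.1 this
  obtain ⟨u, hu, hdist⟩ := hres hvw
  refine hdist ?_
  simp only [U, B, Finset.mem_sdiff, Finset.mem_univ, true_and, Finset.mem_filter, not_exists,
    not_not] at hv hw
  rw [dist_eq_of_mem_reach G hR.toFinset (by simpa using hu) hv.1 (hv.2 u),
    dist_eq_of_mem_reach G hR.toFinset (by simpa using hu) hw.1 (hw.2 u)]

lemma one_sub_le_gnpProb_metricDim {n : ℕ} {p d κ a y ρ x : ℝ} (hn : 1 ≤ n)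
    (hp : 0 ≤ p ∧ p ≤ 1) (hd : d = p * ((n : ℝ) - 1)) (hd0 : 0 ≤ d) (hκ : 0 < κ)
    (hκ1 : κ ≤ 1 / 4) (hdn : 3 * Real.log n ≤ κ ^ 2 * d) (ha1 : 1 ≤ a)
    (ha : 1 + (1 + κ) * d ≤ a) {k : ℕ} (hpa : p * a ^ k ≤ κ) (han : a ^ k ≤ κ * n)
    (hy : 0 ≤ y) (hpy : Real.exp (-y) ≤ 1 - p) (hτ : ρ * a ^ k ≤ n / 2) (hx : 0 < x)
    (hxm : x + 1 ≤ n / 8 * Real.exp (-(y * (ρ * a ^ k)))) :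
    1 - (n * Real.exp (-(κ ^ 2 * d / 4)) + Real.exp 1 * ((n : ℝ)⁻¹) ^ 2
      + (n : ℝ) ^ 2 * Real.exp (-(p * ((1 - 4 * κ) * d) ^ (k + 1))) / x
      + Real.exp (1 + ρ * Real.log n - n / 8 * Real.exp (-(y * (ρ * a ^ k)))))
      ≤ gnpProb n p {G | ρ ≤ (metricDim G : ℝ)} := by
  classical
  have hcompl := gnpProb_add_compl n p {G | ρ ≤ (metricDim G : ℝ)}
  have h1 := gnpProb_exists_degree_le hp hd hd0 hκ (by linarith)
  have h2 := gnpProb_not_expanding_le hn hp hd hd0 hκ hκ1 hdn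
  have h3 := gnpProb_many_not_mem_reach_le (n := n) hp (k + 1) (((1 - 4 * κ) * d) ^ (k + 1)) hx
  have h4 := gnpProb_exists_few_far_le (ρ := ρ) hn hp hy hpy hτ k
  set A₁ : Set (SimpleGraph (Fin n)) := {G | ∃ v ∈ Finset.univ, G ∈ {G : SimpleGraph (Fin n) |
    (1 + κ) * d ≤ (nbrs G (Finset.univ \ {v}) {v}).card}} with hA₁
  set A₂ : Set (SimpleGraph (Fin n)) := {G | ∃ S ∈ (Finset.univ : Finset (Finset (Fin n))),
    G ∈ {G : SimpleGraph (Fin n) | S.Nonempty ∧ p * S.card ≤ κ ∧ (S.card : ℝ) ≤ κ * n ∧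
      ((nbrs G (Finset.univ \ S) S).card : ℝ) ≤ (1 - 4 * κ) * d * S.card}} with hA₂
  set A₃ : Set (SimpleGraph (Fin n)) := {G | x ≤ (Finset.univ.filter fun v => ∃ u : Fin n,
    ((1 - 4 * κ) * d) ^ (k + 1) ≤ (reach G {u} (k + 1 + 1) \ reach G {u} (k + 1)).card ∧
      v ∉ reach G {u} (k + 1 + 2)).card} with hA₃
  set A₄ : Set (SimpleGraph (Fin n)) := {G | ∃ R ∈ (Finset.univ : Finset (Finset (Fin n))),
    G ∈ {G : SimpleGraph (Fin n) | (R.card : ℝ) ≤ ρ ∧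
      ((reach G R (k + 1)).card : ℝ) ≤ ρ * a ^ k ∧ ((Finset.univ \ reach G R (k + 2)).card : ℝ) ≤
        n / 8 * Real.exp (-(y * (ρ * a ^ k)))}} with hA₄
  have hsub : {G : SimpleGraph (Fin n) | ρ ≤ (metricDim G : ℝ)}ᶜ ⊆ A₁ ∪ A₂ ∪ A₃ ∪ A₄ := by
    intro G hG
    by_contra hnot
    simp only [Set.mem_union, not_or] at hnot
    obtain ⟨⟨⟨hG₁, hG₂⟩, hG₃⟩, hG₄⟩ := hnot
    simp only [hA₁, hA₂, hA₃, hA₄, Set.mem_ofPred_eq, Finset.mem_univ, true_and, not_exists,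
      not_and, not_le] at hG₁ hG₂ hG₃ hG₄
    have hdeg : ∀ v, ((nbrs G (Finset.univ \ {v}) {v}).card : ℝ) ≤ (1 + κ) * d :=
      fun v => (hG₁ v).le
    have hb : 0 ≤ (1 - 4 * κ) * d := mul_nonneg (by linarith) hd0
    have hak : 1 ≤ a ^ k := one_le_pow₀ ha1
    have hsph : ∀ u, ((1 - 4 * κ) * d) ^ (k + 1)
        ≤ ((reach G {u} (k + 1 + 1) \ reach G {u} (k + 1)).card : ℝ) := fun u =>
      pow_le_card_sphere G hp.1 hdeg ha1 ha hb (fun S hS hS1 hS2 => (hG₂ S hS hS1 hS2).le)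
        hpa han u le_rfl
    refine hG (le_metricDim_of_far G (k := k + 1)
      (m := n / 8 * Real.exp (-(y * (ρ * a ^ k)))) (fun v => ?_) ?_ fun R hR => ?_)
    · have h := hG₂ {v} (Finset.singleton_nonempty v)
        (by rw [Finset.card_singleton]; push_cast; nlinarith [hp.1])
        (by rw [Finset.card_singleton]; push_cast; linarith)
      have hpos : 0 < (nbrs G (Finset.univ \ {v}) {v}).card := by
        exact_mod_cast lt_of_le_of_lt (mul_nonneg hb (Nat.cast_nonneg _)) h
      obtain ⟨w, hw⟩ := Finset.card_pos.1 hpos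
      simp only [nbrs, Finset.mem_filter, Finset.mem_singleton, exists_eq_left] at hw
      exact ⟨w, hw.2.symm⟩
    · simp only [hsph, true_and] at hG₃
      linarith
    · refine hG₄ R hR ((card_reach_le G R hdeg (by linarith) ha k).trans ?_)
      exact mul_le_mul_of_nonneg_right hR (by linarith)
  have h5 := gnpProb_mono hp hsub
  have h6 := gnpProb_union_le hp (A₁ ∪ A₂ ∪ A₃) A₄
  have h7 := gnpProb_union_le hp (A₁ ∪ A₂) A₃
  have h8 := gnpProb_union_le hp A₁ A₂
  linarith

lemma exp_neg_le_one_sub {p κ : ℝ} (hp : 0 ≤ p) (hpκ : p ≤ κ) (hκ1 : κ ≤ 1 / 4) :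
    Real.exp (-((1 + 2 * κ) * p)) ≤ 1 - p := by
  have h := Real.add_one_le_exp ((1 + 2 * κ) * p)
  have hy : 0 ≤ (1 + 2 * κ) * p := mul_nonneg (by linarith) hp
  rw [Real.exp_neg]
  refine inv_le_of_inv_le₀ (by linarith) (le_trans ?_ h)
  rw [inv_le_iff_one_le_mul₀ (by linarith)]
  nlinarith [mul_nonneg hp (sub_nonneg.2 hpκ), mul_nonneg hp (hp.trans hpκ)]

set_option maxHeartbeats 800000 in
lemma one_sub_le_gnpProb_metricDim_of_large {n : ℕ} {p d κ η δ : ℝ} {k : ℕ}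
    (hp : 0 ≤ p ∧ p ≤ 1) (hd : d = p * ((n : ℝ) - 1)) (hκ : 0 < κ) (hκ1 : κ ≤ 1 / 4) (hδ : 0 < δ)
    (hκδ : (1 + 2 * κ) ^ (k + 2) ≤ 1 + δ / 2) (hκδ' : 1 - δ / 8 ≤ (1 - 4 * κ) ^ (k + 1))
    (hn : 1 ≤ n) (hnκ : (n : ℝ) ≤ (1 + 2 * κ) * (n - 1)) (hL : 1 ≤ Real.log n)
    (hdL : (8 / κ ^ 2 + 2 * (1 + 2 * κ) ^ k) * Real.log n ≤ d)
    (hdn : d ^ (k + 1) ≤ κ / (1 + 2 * κ) ^ (k + 2) * n)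
    (hc : 2 * Real.log n ≤ d ^ (k + 2) / n)
    (hη : η = Real.log (d ^ (k + 1)) / Real.log n)
    (hE : Real.log n ^ 2 + Real.log n ≤ Real.exp (δ / 2 * Real.log n) / 8)
    (hE' : Real.exp (δ / 3 * Real.log n) + 1 ≤ Real.exp (δ / 2 * Real.log n) / 8) :
    1 - (Real.exp (-Real.log n) + Real.exp (1 - 2 * Real.log n)
      + Real.exp (-(δ / 12 * Real.log n)) + Real.exp (1 - Real.log n))
      ≤ gnpProb n p {G | (η - δ) * (n * Real.log n / d ^ (k + 1)) ≤ (metricDim G : ℝ)} := by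
  have hn0 : (0 : ℝ) < n := by exact_mod_cast hn
  have hexpL : Real.exp (Real.log n) = n := Real.exp_log hn0
  set L := Real.log n with hLdef
  clear_value L
  have hκ2 : 0 < κ ^ 2 := by positivity
  have hdκ : 8 * L ≤ κ ^ 2 * d := by
    have h1 : 8 / κ ^ 2 * L ≤ d := by
      refine le_trans ?_ hdL
      have : 0 ≤ 2 * (1 + 2 * κ) ^ k * L := by positivity
      linarith
    have := mul_le_mul_of_nonneg_left h1 hκ2.le
    rwa [← mul_assoc, mul_div_cancel₀ _ hκ2.ne'] at this
  have hd2 : 2 * (1 + 2 * κ) ^ k * L ≤ d := by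
    refine le_trans ?_ hdL
    have : 0 ≤ 8 / κ ^ 2 * L := by positivity
    linarith
  have hd0 : 0 < d := by
    by_contra! h
    nlinarith
  have hκd : 1 ≤ κ * d := by
    have : 8 ≤ κ * (κ * d) := by linarith
    have : κ * (κ * d) ≤ 1 * (κ * d) := mul_le_mul_of_nonneg_right (by linarith) (by positivity)
    linarith
  have hd1 : 1 ≤ d := by nlinarith
  have hdk : 0 < d ^ (k + 1) := by positivity
  have hB : 1 ≤ (1 + 2 * κ) ^ (k + 2) := one_le_pow₀ (by linarith)
  have hdn' : (1 + 2 * κ) ^ (k + 2) * d ^ (k + 1) ≤ κ * n := by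
    have := mul_le_mul_of_nonneg_left hdn (by linarith : 0 ≤ (1 + 2 * κ) ^ (k + 2))
    rwa [← mul_assoc, mul_div_cancel₀ _ (by positivity)] at this
  have hdn1 : d ^ (k + 1) ≤ n := by nlinarith
  rcases le_or_gt η δ with hηδ | hηδ
  · have huniv : {G : SimpleGraph (Fin n) |
        (η - δ) * (n * L / d ^ (k + 1)) ≤ (metricDim G : ℝ)} = Set.univ := by
      refine Set.eq_univ_of_forall fun G => ?_
      have : (η - δ) * (n * L / d ^ (k + 1)) ≤ 0 :=
        mul_nonpos_of_nonpos_of_nonneg (by linarith) (by positivity)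
      exact this.trans (Nat.cast_nonneg _)
    have : gnpProb n p Set.univ = 1 := by
      rw [gnpProb_eq_gnpExp, ← gnpExp_one n p]
      congr 1
      simp
      rfl
    rw [huniv, this, sub_le_self_iff]
    positivity
  have hηL : η * L = Real.log (d ^ (k + 1)) := by
    rw [hη, div_mul_cancel₀ _ (by linarith)]
  have hη1 : η ≤ 1 := by
    rw [hη, div_le_one (by linarith), hLdef]
    exact Real.log_le_log hdk hdn1
  have hexpη : Real.exp (η * L) = d ^ (k + 1) := by rw [hηL, Real.exp_log hdk]
  set ρ := (η - δ) * (n * L / d ^ (k + 1)) with hρ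
  clear_value ρ
  have hpn : p * n ≤ (1 + 2 * κ) * d := by
    rw [hd]
    nlinarith [mul_le_mul_of_nonneg_left hnκ hp.1]
  have hdpn : d ≤ p * n := by
    rw [hd]
    nlinarith [hp.1]
  set a := (1 + 2 * κ) * d with ha
  clear_value a
  have ha1 : 1 ≤ a := by nlinarith
  have hpa : p * a ^ k ≤ κ := by
    have h : p * a ^ k * n ≤ κ * n := by
      calc p * a ^ k * n = p * n * a ^ k := by ring
        _ ≤ a * a ^ k := mul_le_mul_of_nonneg_right hpn (by positivity)
        _ = (1 + 2 * κ) ^ (k + 1) * d ^ (k + 1) := by rw [← pow_succ', ha, mul_pow]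
        _ ≤ (1 + 2 * κ) ^ (k + 2) * d ^ (k + 1) := mul_le_mul_of_nonneg_right
          (pow_le_pow_right₀ (by linarith) (by omega)) hdk.le
        _ ≤ κ * n := hdn'
    exact le_of_mul_le_mul_right h hn0
  have han : a ^ k ≤ κ * n := by
    calc a ^ k ≤ a ^ (k + 1) := pow_le_pow_right₀ ha1 (by omega)
      _ = (1 + 2 * κ) ^ (k + 1) * d ^ (k + 1) := by rw [ha, mul_pow]
      _ ≤ (1 + 2 * κ) ^ (k + 2) * d ^ (k + 1) := mul_le_mul_of_nonneg_right
        (pow_le_pow_right₀ (by linarith) (by omega)) hdk.le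
      _ ≤ κ * n := hdn'
  have hpκ : p ≤ κ := by
    refine le_trans ?_ hpa
    exact le_mul_of_one_le_right hp.1 (one_le_pow₀ ha1)
  have hρa : ρ * a ^ k = (η - δ) * L * (1 + 2 * κ) ^ k * n / d := by
    rw [hρ, ha, mul_pow]
    field_simp
    ring
  have hτ : ρ * a ^ k ≤ n / 2 := by
    rw [hρa, div_le_div_iff₀ hd0 two_pos]
    have h1 : (η - δ) * (L * (1 + 2 * κ) ^ k * n) ≤ 1 * (L * (1 + 2 * κ) ^ k * n) :=
      mul_le_mul_of_nonneg_right (by linarith) (by positivity)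
    have h2 := mul_le_mul_of_nonneg_left hd2 hn0.le
    linarith
  have hyτ : (1 + 2 * κ) * p * (ρ * a ^ k) ≤ η * L - δ / 2 * L := by
    have h1 : (1 + 2 * κ) * p * (ρ * a ^ k)
        = (p * n) / d * ((η - δ) * L * (1 + 2 * κ) ^ (k + 1)) := by
      rw [hρa]
      ring
    have h2 : (p * n) / d ≤ 1 + 2 * κ := by
      rw [div_le_iff₀ hd0, ← ha]
      exact hpn
    have hηδ' : 0 < η - δ := by linarith
    rw [h1]
    calc (p * n) / d * ((η - δ) * L * (1 + 2 * κ) ^ (k + 1))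
        ≤ (1 + 2 * κ) * ((η - δ) * L * (1 + 2 * κ) ^ (k + 1)) :=
          mul_le_mul_of_nonneg_right h2 (by positivity)
      _ = (η - δ) * L * (1 + 2 * κ) ^ (k + 2) := by ring
      _ ≤ (η - δ) * L * (1 + δ / 2) := mul_le_mul_of_nonneg_left hκδ (by positivity)
      _ ≤ η * L - δ / 2 * L := by
        have : (η - δ) * (L * (δ / 2)) ≤ 1 * (L * (δ / 2)) :=
          mul_le_mul_of_nonneg_right (by linarith) (by positivity)
        linarith
  set y := (1 + 2 * κ) * p with hy
  set r := (n : ℝ) / d ^ (k + 1) with hr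
  clear_value r
  have hr1 : 1 ≤ r := hr ▸ (one_le_div hdk).2 hdn1
  have hm : r * (Real.exp (δ / 2 * L) / 8) ≤ n / 8 * Real.exp (-(y * (ρ * a ^ k))) := by
    have h1 : Real.exp (δ / 2 * L) / d ^ (k + 1) ≤ Real.exp (-(y * (ρ * a ^ k))) := by
      rw [← hexpη, ← Real.exp_sub]
      exact Real.exp_le_exp.2 (by linarith)
    have := mul_le_mul_of_nonneg_left h1 (by positivity : 0 ≤ (n : ℝ) / 8)
    refine le_trans (le_of_eq ?_) this
    rw [hr]
    ring
  have hxm : Real.exp (δ / 3 * L) + 1 ≤ n / 8 * Real.exp (-(y * (ρ * a ^ k))) := by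
    refine le_trans ?_ hm
    nlinarith [Real.exp_pos (δ / 2 * L)]
  have hy0 : 0 ≤ y := mul_nonneg (by linarith) hp.1
  have hpy : Real.exp (-y) ≤ 1 - p := exp_neg_le_one_sub hp.1 hpκ hκ1
  have h3L : 3 * Real.log n ≤ κ ^ 2 * d := by
    rw [← hLdef]
    linarith
  have key := one_sub_le_gnpProb_metricDim (ρ := ρ) hn hp hd hd0.le hκ hκ1 h3L ha1
    (by rw [ha]; linarith) hpa han hy0 hpy hτ (Real.exp_pos _) hxm
  rw [← hLdef] at key
  clear_value y
  refine le_trans (sub_le_sub_left (add_le_add (add_le_add (add_le_add ?_ ?_) ?_) ?_) 1) key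
  · have h (z : ℝ) : n * Real.exp z = Real.exp (L + z) := by rw [Real.exp_add, hexpL]
    rw [h]
    exact Real.exp_le_exp.2 (by linarith)
  · have : (n : ℝ)⁻¹ = Real.exp (-L) := by rw [Real.exp_neg, hexpL]
    rw [this, ← Real.exp_nat_mul, ← Real.exp_add]
    refine Real.exp_le_exp.2 (le_of_eq ?_)
    push_cast
    ring
  · have hpt : 2 * L * (1 - δ / 8) ≤ p * ((1 - 4 * κ) * d) ^ (k + 1) := by
      have h1 : d ^ (k + 2) / n ≤ p * d ^ (k + 1) := by
        rw [div_le_iff₀ hn0]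
        calc d ^ (k + 2) = d * d ^ (k + 1) := by ring
          _ ≤ p * n * d ^ (k + 1) := mul_le_mul_of_nonneg_right hdpn hdk.le
          _ = _ := by ring
      have hα : 0 ≤ (1 - 4 * κ) ^ (k + 1) := pow_nonneg (by linarith) _
      calc 2 * L * (1 - δ / 8) ≤ 2 * L * (1 - 4 * κ) ^ (k + 1) :=
            mul_le_mul_of_nonneg_left hκδ' (by linarith)
        _ ≤ p * d ^ (k + 1) * (1 - 4 * κ) ^ (k + 1) :=
            mul_le_mul_of_nonneg_right (hc.trans h1) hα
        _ = _ := by rw [mul_pow]; ring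
    have h2 : (n : ℝ) ^ 2 = Real.exp (2 * L) := by
      rw [← hexpL, ← Real.exp_nat_mul]
      norm_num
    rw [h2, ← Real.exp_add, ← Real.exp_sub]
    exact Real.exp_le_exp.2 (by linarith)
  · refine Real.exp_le_exp.2 ?_
    have h1 : ρ * L ≤ r * L ^ 2 := by
      have : ρ * L = (η - δ) * (r * L ^ 2) := by
        rw [hρ, hr]
        ring
      rw [this]
      exact mul_le_of_le_one_left (by positivity) (by linarith)
    have h2 := mul_le_mul_of_nonneg_left hE (by linarith : 0 ≤ r)
    have h3 : L ≤ r * L := le_mul_of_one_le_left (by linarith) hr1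
    linarith

lemma exists_expansion_constant (δ : ℝ) (hδ : 0 < δ) (k : ℕ) : ∃ κ : ℝ, 0 < κ ∧ κ ≤ 1 / 4 ∧
    (1 + 2 * κ) ^ (k + 2) ≤ 1 + δ / 2 ∧ 1 - δ / 8 ≤ (1 - 4 * κ) ^ (k + 1) := by
  have h1 : Tendsto (fun κ : ℝ => (1 + 2 * κ) ^ (k + 2)) (𝓝[>] 0) (𝓝 1) := by
    have : Continuous fun κ : ℝ => (1 + 2 * κ) ^ (k + 2) := by fun_prop
    simpa using (this.tendsto 0).mono_left nhdsWithin_le_nhds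
  have h2 : Tendsto (fun κ : ℝ => (1 - 4 * κ) ^ (k + 1)) (𝓝[>] 0) (𝓝 1) := by
    have : Continuous fun κ : ℝ => (1 - 4 * κ) ^ (k + 1) := by fun_prop
    simpa using (this.tendsto 0).mono_left nhdsWithin_le_nhds
  obtain ⟨κ, h⟩ := ((eventually_mem_nhdsWithin (a := (0 : ℝ)) (s := Set.Ioi 0)).and
    ((eventually_nhdsWithin_of_eventually_nhds
      (eventually_le_nhds (show (0 : ℝ) < 1 / 4 by norm_num))).and
    ((h1.eventually_le_const (show 1 < 1 + δ / 2 by linarith)).and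
    (h2.eventually_const_le (show 1 - δ / 8 < 1 by linarith))))).exists
  exact ⟨κ, h.1, h.2.1, h.2.2.1, h.2.2.2⟩

lemma eventually_le_exp_mul_div {b : ℝ} {f : ℝ → ℝ}
    (hf : f =o[atTop] fun x => Real.exp (b * x)) :
    ∀ᶠ x in atTop, f x ≤ Real.exp (b * x) / 8 := by
  filter_upwards [hf.bound (show (0 : ℝ) < 1 / 8 by norm_num)] with x hx
  rw [Real.norm_of_nonneg (Real.exp_pos _).le] at hx
  linarith [Real.le_norm_self (f x)]

/-- Theorem 4.3: if `log n ≪ d = o(n)` and `c − 2 log n → ∞`, then a.a.s.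
`β(G) ≥ (η+o(1))·n·log n/d^i` where `η = log_n(d^i)`. -/
theorem stmt_12 (p d c η : ℕ → ℝ)
    (hp : ∀ n, 0 ≤ p n ∧ p n ≤ 1)
    (hd : ∀ n, d n = p n * ((n : ℝ) - 1))
    (hd_lower : Tendsto (fun n : ℕ => d n / Real.log n) atTop atTop)
    (hd_upper : (fun n : ℕ => d n) =o[atTop] (fun n : ℕ => (n : ℝ)))
    (i : ℕ) (hi1 : 1 ≤ i)
    (hi : (fun n : ℕ => d n ^ i) =o[atTop] (fun n : ℕ => (n : ℝ)))
    (hi_max : ∀ j : ℕ, ((fun n : ℕ => d n ^ j) =o[atTop] (fun n : ℕ => (n : ℝ))) → j ≤ i)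
    (hc : ∀ n : ℕ, c n = d n ^ (i + 1) / n)
    (hc_big : Tendsto (fun n : ℕ => c n - 2 * Real.log n) atTop atTop)
    (hη : ∀ n : ℕ, η n = Real.log (d n ^ i) / Real.log n) :
    ∀ δ : ℝ, 0 < δ →
      Tendsto (fun n : ℕ => gnpProb n (p n)
        {G : SimpleGraph (Fin n) |
          (η n - δ) * ((n : ℝ) * Real.log n / d n ^ i) ≤ (metricDim G : ℝ)})
        atTop (𝓝 1) := by
  intro δ hδ
  obtain ⟨k, rfl⟩ : ∃ k, i = k + 1 := ⟨i - 1, by omega⟩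
  obtain ⟨κ, hκ, hκ1, hκδ, hκδ'⟩ := exists_expansion_constant δ hδ k
  have hlog : Tendsto (fun n : ℕ => Real.log n) atTop atTop :=
    Real.tendsto_log_atTop.comp tendsto_natCast_atTop_atTop
  have hexp : ∀ a b : ℝ, 0 < b →
      Tendsto (fun n : ℕ => Real.exp (a - b * Real.log n)) atTop (𝓝 0) := fun a b hb =>
    Real.tendsto_exp_atBot.comp
      (tendsto_atBot_add_const_left _ a (tendsto_neg_atTop_atBot.comp (hlog.const_mul_atTop hb)))
  have herr : Tendsto (fun n : ℕ => 1 - (Real.exp (-Real.log n) + Real.exp (1 - 2 * Real.log n)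
      + Real.exp (-(δ / 12 * Real.log n)) + Real.exp (1 - Real.log n))) atTop (𝓝 1) := by
    have := ((((hexp 0 1 one_pos).add (hexp 1 2 two_pos)).add
      (hexp 0 (δ / 12) (by positivity))).add (hexp 1 1 one_pos)).const_sub 1
    simpa using this
  refine tendsto_of_tendsto_of_tendsto_of_le_of_le' herr tendsto_const_nhds ?_ ?_
  · have hE : ∀ᶠ x : ℝ in atTop, x ^ 2 + x ≤ Real.exp (δ / 2 * x) / 8 := by
      refine eventually_le_exp_mul_div (IsLittleO.add ?_ ?_)
      · exact isLittleO_pow_exp_pos_mul_atTop 2 (by positivity)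
      · simpa using isLittleO_pow_exp_pos_mul_atTop 1 (show 0 < δ / 2 by positivity)
    have hE' : ∀ᶠ x : ℝ in atTop, Real.exp (δ / 3 * x) + 1 ≤ Real.exp (δ / 2 * x) / 8 := by
      refine eventually_le_exp_mul_div (IsLittleO.add ?_ ?_)
      · rw [Real.isLittleO_exp_comp_exp_comp]
        have : (fun x : ℝ => δ / 2 * x - δ / 3 * x) = fun x => δ / 6 * x := by
          funext x
          ring
        rw [this]
        exact tendsto_id.const_mul_atTop (by positivity)
      · simpa using isLittleO_pow_exp_pos_mul_atTop 0 (show 0 < δ / 2 by positivity)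
    have hdn := hi.bound (show 0 < κ / (1 + 2 * κ) ^ (k + 2) by positivity)
    filter_upwards [hlog.eventually_ge_atTop 1, eventually_ge_atTop 1,
      tendsto_natCast_atTop_atTop.eventually_ge_atTop ((1 + 2 * κ) / (2 * κ)),
      hd_lower.eventually_ge_atTop (8 / κ ^ 2 + 2 * (1 + 2 * κ) ^ k), hdn,
      hc_big.eventually_ge_atTop 0, hlog.eventually hE, hlog.eventually hE'] with
      n hL hn hnκ hdL hdn hc2 hE hE'
    refine one_sub_le_gnpProb_metricDim_of_large (hp n) (hd n) hκ hκ1 hδ hκδ hκδ' hn ?_ hL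
      ((le_div_iff₀ (by linarith)).1 hdL) ?_ ?_ (hη n) hE hE'
    · rw [div_le_iff₀ (by positivity)] at hnκ
      linarith
    · rw [Real.norm_of_nonneg (Nat.cast_nonneg n)] at hdn
      exact (Real.le_norm_self _).trans hdn
    · have := hc n
      linarith
  · refine Eventually.of_forall fun n => ?_
    have := gnpProb_add_compl n (p n) {G : SimpleGraph (Fin n) |
      (η n - δ) * ((n : ℝ) * Real.log n / d n ^ (k + 1)) ≤ (metricDim G : ℝ)}
    linarith [gnpProb_nonneg (hp n) {G : SimpleGraph (Fin n) |
      (η n - δ) * ((n : ℝ) * Real.log n / d n ^ (k + 1)) ≤ (metricDim G : ℝ)}ᶜ]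
end
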